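/- arXiv:2507.03889 — 2 statements merged into one kernel-verified Lean document; each statement's English description precedes it below -/
import Mathlib

section
/- Let G be a connected block graph on vertex set [n] and J_G ⊆ S = K[x_1,...,x_n,y_1,...,y_n] its binomial edge ideal. Then the projective dimension of S/J_G equals the big height of J_G, and both equal n - 1. -/
open SimpleGraph

/-- The binomial edge ideal of a graph `G`, in the polynomial ring over `K` with variables
`x_i = X (Sum.inl i)` and `y_i = X (Sum.inr i)`. -/
noncomputable def binomialEdgeIdeal (K : Type) [Field K] {V : Type} (G : SimpleGraph V) :
    Ideal (MvPolynomial (V ⊕ V) K) :=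
  Ideal.span { f | ∃ i j, G.Adj i j ∧
    f = MvPolynomial.X (Sum.inl i) * MvPolynomial.X (Sum.inr j)
      - MvPolynomial.X (Sum.inl j) * MvPolynomial.X (Sum.inr i) }

/-- The height of an ideal: the least height of a minimal prime over it. -/
noncomputable def idealHeight {R : Type*} [CommRing R] (I : Ideal R) : ℕ∞ :=
  sInf { h | ∃ p : PrimeSpectrum R, p.asIdeal ∈ I.minimalPrimes ∧ h = Order.height p }

/-- The big height of an ideal: the largest height of a minimal prime over it. -/
noncomputable def bigHeight {R : Type*} [CommRing R] (I : Ideal R) : ℕ∞ :=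
  sSup { h | ∃ p : PrimeSpectrum R, p.asIdeal ∈ I.minimalPrimes ∧ h = Order.height p }

open CategoryTheory in
/-- The projective dimension of a module `M`, characterized via vanishing of `Ext`:
`projDim R M ≤ n` iff `Ext^k (M, N) = 0` for all `N` and all `k > n`. -/
noncomputable def projDim (R : Type) [CommRing R] (M : ModuleCat R) : ℕ∞ :=
  sInf { n : ℕ∞ | ∀ (N : ModuleCat R) (k : ℕ), n < (k : ℕ∞) →
    Subsingleton (((Ext R (ModuleCat R) k).obj (Opposite.op M)).obj N) }

/-- Number of connected components of the induced subgraph on `s`. -/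
noncomputable def numComponents {V : Type*} (G : SimpleGraph V) (s : Set V) : ℕ :=
  Nat.card (G.induce s).ConnectedComponent

/-- `v` is a cut vertex of the induced subgraph of `G` on `s`. -/
def IsCutVertexOf {V : Type*} (G : SimpleGraph V) (s : Set V) (v : V) : Prop :=
  v ∈ s ∧ numComponents G s < numComponents G (s \ {v})

/-- `B` is a block of `G`: a maximal vertex set whose induced subgraph is connected and has
no cut vertex. -/
def IsBlock {V : Type*} (G : SimpleGraph V) (B : Set V) : Prop :=
  ((G.induce B).Connected ∧ ∀ v, ¬ IsCutVertexOf G B v) ∧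
    ∀ B' : Set V, B ⊆ B' → ((G.induce B').Connected ∧ ∀ v, ¬ IsCutVertexOf G B' v) → B' = B

/-- `G` is a block graph: every block induces a complete graph. -/
def IsBlockGraph {V : Type*} (G : SimpleGraph V) : Prop :=
  ∀ B : Set V, IsBlock G B → ∀ u ∈ B, ∀ v ∈ B, u ≠ v → G.Adj u v

namespace BlockGraph

section Graph

variable {V : Type}

/-- The graph obtained from `G` by making every vertex of `A` isolated. -/
def del (G : SimpleGraph V) (A : Set V) : SimpleGraph V where
  Adj a b := G.Adj a b ∧ a ∉ A ∧ b ∉ A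
  symm := ⟨fun _ _ h ↦ ⟨h.1.symm, h.2.2, h.2.1⟩⟩
  loopless := ⟨fun _ h ↦ G.loopless.irrefl _ h.1⟩

/-- The graph obtained from `G` by completing the neighbourhood of `v` to a clique. -/
def complNbhd (G : SimpleGraph V) (v : V) : SimpleGraph V where
  Adj a b := a ≠ b ∧ (G.Adj a b ∨ (G.Adj v a ∧ G.Adj v b))
  symm := ⟨fun _ _ h ↦ ⟨h.1.symm, h.2.imp (·.symm) (·.symm)⟩⟩
  loopless := ⟨fun _ h ↦ h.1 rfl⟩

/-- `G` is a disjoint union of complete graphs. -/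
def IsCluster (G : SimpleGraph V) : Prop :=
  ∀ ⦃v a b⦄, G.Adj v a → G.Adj v b → a ≠ b → G.Adj a b

/-- Nonadjacent neighbours of a vertex `v` are separated by `v`. -/
def SeparatesNbrs (G : SimpleGraph V) : Prop :=
  ∀ ⦃v a b⦄, G.Adj v a → G.Adj v b → a ≠ b → ¬ G.Adj a b → ¬ (del G {v}).Reachable a b

lemma del_le (G : SimpleGraph V) (A : Set V) : del G A ≤ G := fun _ _ h ↦ h.1

lemma le_complNbhd (G : SimpleGraph V) (v : V) : G ≤ complNbhd G v :=
  fun _ _ h ↦ ⟨h.ne, Or.inl h⟩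

lemma del_mono {G H : SimpleGraph V} (h : G ≤ H) (A : Set V) : del G A ≤ del H A :=
  fun _ _ e ↦ ⟨h e.1, e.2⟩

lemma not_adj_del_left {G : SimpleGraph V} {A : Set V} {v : V} (hv : v ∈ A) (w : V) :
    ¬ (del G A).Adj v w := fun h ↦ h.2.1 hv

lemma complNbhd_adj_self {G : SimpleGraph V} {v w : V} :
    (complNbhd G v).Adj v w ↔ G.Adj v w :=
  ⟨fun h ↦ h.2.elim id fun h' ↦ h'.2, fun h ↦ le_complNbhd G v h⟩

lemma del_del (G : SimpleGraph V) (A B : Set V) : del (del G A) B = del G (B ∪ A) := by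
  ext a b
  simp only [del, Set.mem_union]
  tauto

protected lemma IsCluster.del {G : SimpleGraph V} (hG : IsCluster G) (A : Set V) :
    IsCluster (del G A) :=
  fun _ _ _ ha hb hab ↦ ⟨hG ha.1 hb.1 hab, ha.2.2, hb.2.2⟩

protected lemma SeparatesNbrs.del {G : SimpleGraph V} (hG : SeparatesNbrs G) (u : V) :
    SeparatesNbrs (del G {u}) :=
  fun _ _ _ ha hb hab hn hr ↦ hG ha.1 hb.1 hab (fun h ↦ hn ⟨h, ha.2.2, hb.2.2⟩)
    (hr.mono (del_mono (del_le _ _) _))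

lemma reachable_del_of_complNbhd {G : SimpleGraph V} {v u a b : V} (huv : u ≠ v)
    (h : (BlockGraph.del (complNbhd G v) {u}).Reachable a b) :
    (BlockGraph.del G {u}).Reachable a b := by
  obtain ⟨p⟩ := h
  induction p with
  | nil => rfl
  | @cons x y z e _ ih =>
    refine .trans ?_ ih
    obtain ⟨⟨-, h | ⟨h1, h2⟩⟩, hx, hy⟩ := e
    · exact Adj.reachable (G := BlockGraph.del G {u}) ⟨h, hx, hy⟩
    · exact (Adj.reachable (G := BlockGraph.del G {u}) ⟨h1.symm, hx, huv.symm⟩).trans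
        (Adj.reachable (G := BlockGraph.del G {u}) ⟨h2, huv.symm, hy⟩)

protected lemma SeparatesNbrs.complNbhd {G : SimpleGraph V} (hG : SeparatesNbrs G) (v : V) :
    SeparatesNbrs (complNbhd G v) := by
  have key : ∀ ⦃u a b⦄, u ≠ v → G.Adj v u → G.Adj v a → u ≠ a →
      (BlockGraph.complNbhd G v).Adj u b → a ≠ b → ¬ (BlockGraph.complNbhd G v).Adj a b →
      ¬ (BlockGraph.del G {u}).Reachable a b := by
    intro u a b huv hvu hva hua hub hab hn hr
    obtain ⟨hub', h | h⟩ := hub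
    · by_cases hbv : b = v
      · subst hbv
        exact hn ⟨hab, Or.inl hva.symm⟩
      · refine hG hvu.symm h (Ne.symm hbv) (fun hvb ↦ hn ⟨hab, Or.inr ⟨hva, hvb⟩⟩) ?_
        exact (Adj.reachable (G := BlockGraph.del G {u}) ⟨hva, huv.symm, hua.symm⟩).trans hr
    · exact hn ⟨hab, Or.inr ⟨hva, h.2⟩⟩
  intro u a b ha hb hab hn hr
  by_cases huv : u = v
  · subst huv
    exact hn ⟨hab, Or.inr ⟨complNbhd_adj_self.1 ha, complNbhd_adj_self.1 hb⟩⟩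
  have hr' := reachable_del_of_complNbhd huv hr
  rcases ha.2 with ha' | ha'
  · rcases hb.2 with hb' | hb'
    · exact hG ha' hb' hab (fun h ↦ hn ⟨hab, Or.inl h⟩) hr'
    · exact key huv hb'.1 hb'.2 hb.1 ha hab.symm (fun h ↦ hn h.symm) hr'.symm
  · exact key huv ha'.1 ha'.2 ha.1 hb hab hn hr'

/-- On a path, every vertex other than `u` is joined to an end of the path by a walk inside the
support avoiding `u`. -/
lemma exists_walk_avoiding {H : SimpleGraph V} {a b : V} (p : H.Walk a b) (hp : p.IsPath)
    (u : V) {w : V} (hw : w ∈ p.support) (hwu : w ≠ u) :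
    (∃ q : H.Walk w a, ∀ x ∈ q.support, x ∈ p.support ∧ x ≠ u) ∨
      ∃ q : H.Walk w b, ∀ x ∈ q.support, x ∈ p.support ∧ x ≠ u := by
  classical
  induction p with
  | nil =>
    obtain rfl : w = _ := by simpa using hw
    exact Or.inl ⟨.nil, by simp [hwu]⟩
  | @cons a c b h p ih =>
    rw [Walk.cons_isPath_iff] at hp
    rw [Walk.support_cons, List.mem_cons] at hw
    by_cases hwa : w = a
    · subst hwa
      exact Or.inl ⟨.nil, by simp [hwu]⟩
    have hw' := hw.resolve_left hwa
    by_cases hua : u = a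
    · subst hua
      refine Or.inr ⟨p.dropUntil w hw', fun x hx ↦ ?_⟩
      have := p.support_dropUntil_subset_support hw' hx
      exact ⟨by simp [this], fun h ↦ hp.2 (h ▸ this)⟩
    · rcases ih hp.1 hw' with ⟨q, hq⟩ | ⟨q, hq⟩
      · refine Or.inl ⟨q.concat h.symm, fun x hx ↦ ?_⟩
        rw [Walk.support_concat, List.mem_append, List.mem_singleton] at hx
        rcases hx with hx | rfl
        · exact ⟨by simp [(hq x hx).1], (hq x hx).2⟩
        · exact ⟨by simp, Ne.symm hua⟩
      · exact Or.inr ⟨q, fun x hx ↦ ⟨by simp [(hq x hx).1], (hq x hx).2⟩⟩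

lemma not_isCutVertexOf_of_preconnected {G : SimpleGraph V} {B : Set V} [Finite V]
    (hB : (G.induce B).Connected) {u : V} (hu : (G.induce (B \ {u})).Preconnected) :
    ¬ IsCutVertexOf G B u := by
  rintro ⟨-, h⟩
  have h1 : numComponents G (B \ {u}) ≤ 1 :=
    Finite.card_le_one_iff_subsingleton.2 hu.subsingleton_connectedComponent
  have h2 : 0 < numComponents G B := by
    have := hB.nonempty
    have : Nonempty (G.induce B).ConnectedComponent := ⟨connectedComponentMk _ this.some⟩
    exact Nat.card_pos
  omega

lemma preconnected_induce_of_forall {G : SimpleGraph V} {B : Set V} {v : V} (hv : v ∈ B)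
    (h : ∀ w (hw : w ∈ B), (G.induce B).Reachable ⟨w, hw⟩ ⟨v, hv⟩) :
    (G.induce B).Preconnected :=
  fun x y ↦ (h x.1 x.2).trans (h y.1 y.2).symm

lemma separatesNbrs_of_isBlockGraph [Finite V] {G : SimpleGraph V} (hG : IsBlockGraph G) :
    SeparatesNbrs G := by
  classical
  intro v a b hva hvb hab hn hr
  obtain ⟨p, hp⟩ := hr.exists_isPath
  have hvp : v ∉ p.support := by
    intro h
    obtain ⟨q, -⟩ : ∃ q : (del G {v}).Walk v b, True := ⟨p.dropUntil v h, trivial⟩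
    cases q with
    | nil => exact G.loopless.irrefl _ hvb
    | cons e _ => exact e.2.1 rfl
  set B : Set V := insert v {x | x ∈ p.support} with hBdef
  have hvB : v ∈ B := Set.mem_insert _ _
  have walk_reach : ∀ (T : Set V) {x y : V} (q : (del G {v}).Walk x y)
      (hq : ∀ z ∈ q.support, z ∈ T) (hx : x ∈ T) (hy : y ∈ T),
      (G.induce T).Reachable ⟨x, hx⟩ ⟨y, hy⟩ := by
    intro T x y q hq hx hy
    refine ⟨((q.mapLe (del_le G {v})).induce T ?_)⟩
    intro z hz
    exact hq z (by simpa using hz)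
  have conn_away : ∀ u, u ≠ v → (G.induce (B \ {u})).Preconnected := by
    intro u huv
    have hv' : v ∈ B \ {u} := ⟨hvB, huv.symm⟩
    refine preconnected_induce_of_forall hv' ?_
    rintro w ⟨hw, hwu⟩
    rcases hw with rfl | hw
    · rfl
    rcases exists_walk_avoiding p hp u hw hwu with ⟨q, hq⟩ | ⟨q, hq⟩
    · have ha : a ∈ B \ {u} := ⟨Or.inr (hq a (by simp)).1, (hq a (by simp)).2⟩
      refine (walk_reach (B \ {u}) q (fun z hz ↦ ⟨Or.inr (hq z hz).1, (hq z hz).2⟩) ⟨Or.inr hw, hwu⟩ ha).trans ?_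
      exact Adj.reachable (G := G.induce (B \ {u})) (u := ⟨a, ha⟩) (v := ⟨v, hv'⟩) hva.symm
    · have hb : b ∈ B \ {u} := ⟨Or.inr (hq b (by simp)).1, (hq b (by simp)).2⟩
      refine (walk_reach (B \ {u}) q (fun z hz ↦ ⟨Or.inr (hq z hz).1, (hq z hz).2⟩) ⟨Or.inr hw, hwu⟩ hb).trans ?_
      exact Adj.reachable (G := G.induce (B \ {u})) (u := ⟨b, hb⟩) (v := ⟨v, hv'⟩) hvb.symm
  have hBc : (G.induce B).Connected := by
    have : Nonempty B := ⟨⟨v, hvB⟩⟩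
    refine ⟨preconnected_induce_of_forall hvB ?_⟩
    rintro w (rfl | hw)
    · rfl
    have ha : a ∈ B := Or.inr p.start_mem_support
    refine ((walk_reach B (p.takeUntil w hw) (fun z hz ↦ Or.inr
      (p.support_takeUntil_subset_support hw hz)) ha _).symm).trans ?_
    exact Adj.reachable (G := G.induce B) (u := ⟨a, ha⟩) (v := ⟨v, hvB⟩) hva.symm
  have hBcut : ∀ u, ¬ IsCutVertexOf G B u := by
    intro u
    refine not_isCutVertexOf_of_preconnected hBc ?_
    by_cases huv : u = v
    · subst huv
      have ha : a ∈ B \ {u} := ⟨Or.inr p.start_mem_support, hva.ne'⟩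
      refine preconnected_induce_of_forall ha ?_
      rintro w ⟨hw, hwu⟩
      have hw' : w ∈ p.support := hw.resolve_left hwu
      exact (walk_reach (B \ {u}) (p.takeUntil w hw') (fun z hz ↦
        have hz' := p.support_takeUntil_subset_support hw' hz
        ⟨Or.inr hz', fun h ↦ hvp (h ▸ hz')⟩) ha ⟨hw, hwu⟩).symm
    · exact conn_away u huv
  obtain ⟨C, hBC, hC⟩ := (Set.toFinite {C : Set V | (G.induce C).Connected ∧
    ∀ v, ¬ IsCutVertexOf G C v}).exists_le_maximal ⟨hBc, hBcut⟩
  refine hn (hG C ⟨hC.prop, fun B' h h' ↦ (hC.eq_of_le h' h).symm⟩ a (hBC (Or.inr ?_)) b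
    (hBC (Or.inr ?_)) hab)
  · exact p.start_mem_support
  · exact p.end_mem_support

end Graph

section Rank

variable {V : Type} [DecidableEq V] (K : Type) [Field K]

/-- The span of the vectors `e_a - e_b`, for the edges `{a, b}` of `G`. -/
def edgeSpan (G : SimpleGraph V) : Submodule K (V → K) :=
  Submodule.span K {u | ∃ a b, G.Adj a b ∧ u = Pi.single a 1 - Pi.single b 1}

/-- The rank of the graphic matroid of `G`. -/
noncomputable def rk (G : SimpleGraph V) : ℕ := Module.finrank K (edgeSpan K G)

variable {K}

lemma mem_edgeSpan {G : SimpleGraph V} {a b : V} (h : G.Adj a b) :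
    (Pi.single a 1 - Pi.single b 1 : V → K) ∈ edgeSpan K G :=
  Submodule.subset_span ⟨a, b, h, rfl⟩

lemma edgeSpan_le {G : SimpleGraph V} {W : Submodule K (V → K)}
    (h : ∀ a b, G.Adj a b → (Pi.single a 1 - Pi.single b 1 : V → K) ∈ W) :
    edgeSpan K G ≤ W := by
  rw [edgeSpan, Submodule.span_le]
  rintro _ ⟨a, b, hab, rfl⟩
  exact h a b hab

lemma edgeSpan_mono {G H : SimpleGraph V} (h : G ≤ H) : edgeSpan K G ≤ edgeSpan K H :=
  edgeSpan_le fun _ _ hab ↦ mem_edgeSpan (h hab)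

lemma edgeSpan_del_le_ker (G : SimpleGraph V) (v : V) :
    edgeSpan K (del G {v}) ≤ LinearMap.ker (LinearMap.proj (R := K) (φ := fun _ ↦ K) v) := by
  refine edgeSpan_le fun a b h ↦ ?_
  have ha : v ≠ a := fun e ↦ h.2.1 e.symm
  have hb : v ≠ b := fun e ↦ h.2.2 e.symm
  simp [ha, hb]

variable [Fintype V]

lemma rk_mono {G H : SimpleGraph V} (h : G ≤ H) : rk K G ≤ rk K H :=
  Submodule.finrank_mono (edgeSpan_mono h)

lemma rk_complNbhd_le (G : SimpleGraph V) (v : V) : rk K (complNbhd G v) ≤ rk K G := by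
  refine Submodule.finrank_mono (edgeSpan_le ?_)
  rintro a b ⟨-, h | ⟨ha, hb⟩⟩
  · exact mem_edgeSpan h
  · simpa using add_mem (mem_edgeSpan (K := K) ha.symm) (mem_edgeSpan hb)

lemma rk_del_add_one_le {G : SimpleGraph V} {v w : V} (h : G.Adj v w) :
    rk K (del G {v}) + 1 ≤ rk K G := by
  refine Submodule.finrank_lt_finrank_of_lt
    (lt_of_le_of_ne (edgeSpan_mono (del_le _ _)) fun e ↦ ?_)
  have := edgeSpan_del_le_ker (K := K) G v (e ▸ mem_edgeSpan h)
  simp [h.ne] at this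

lemma rk_del_add_two_le {G : SimpleGraph V} {v a b : V} (ha : G.Adj v a) (hb : G.Adj v b)
    (h : ¬ (del G {v}).Reachable a b) : rk K (del G {v}) + 2 ≤ rk K G := by
  classical
  set w : V → K := Pi.single a 1 - Pi.single b 1 with hw
  set W := edgeSpan K (del G {v}) ⊔ Submodule.span K {w} with hW
  have h1 : edgeSpan K (del G {v}) < W := by
    refine lt_of_le_of_ne le_sup_left fun e ↦ ?_
    have hmem : w ∈ edgeSpan K (del G {v}) :=
      e ▸ Submodule.mem_sup_right (Submodule.mem_span_singleton_self w)
    let φ : (V → K) →ₗ[K] K :=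
      ∑ x : V with (del G {v}).Reachable a x, LinearMap.proj (R := K) (φ := fun _ ↦ K) x
    have hφ : ∀ x, φ (Pi.single x 1) = if (del G {v}).Reachable a x then 1 else 0 := by
      intro x
      simp [φ, LinearMap.sum_apply]
    have hker : edgeSpan K (del G {v}) ≤ LinearMap.ker φ := by
      refine edgeSpan_le fun x y hxy ↦ ?_
      have : (del G {v}).Reachable a x ↔ (del G {v}).Reachable a y :=
        ⟨fun h ↦ h.trans hxy.reachable, fun h ↦ h.trans hxy.symm.reachable⟩
      rw [LinearMap.mem_ker, map_sub, hφ, hφ]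
      simp [this]
    have := hker hmem
    rw [LinearMap.mem_ker, hw, map_sub, hφ, hφ] at this
    simp [h] at this
  have h2 : W < edgeSpan K G := by
    refine lt_of_le_of_ne (sup_le (edgeSpan_mono (del_le _ _)) ?_) fun e ↦ ?_
    · rw [Submodule.span_le, Set.singleton_subset_iff]
      simpa [hw] using add_mem (mem_edgeSpan (K := K) ha.symm) (mem_edgeSpan hb)
    · have hle : W ≤ LinearMap.ker (LinearMap.proj (R := K) (φ := fun _ ↦ K) v) := by
        refine sup_le (edgeSpan_del_le_ker G v) ?_
        rw [Submodule.span_le, Set.singleton_subset_iff]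
        simp [hw, ha.ne, hb.ne]
      have := hle (e ▸ mem_edgeSpan ha)
      simp [ha.ne] at this
  have h1' := Submodule.finrank_lt_finrank_of_lt h1
  have h2' := Submodule.finrank_lt_finrank_of_lt h2
  simp only [rk]
  omega

lemma rk_del_add_card_le {G : SimpleGraph V} {v : V} (A : Finset V) (hA : ∀ a ∈ A, G.Adj v a) :
    rk K (del G A) + A.card ≤ rk K G := by
  induction A using Finset.induction_on with
  | empty => simpa using rk_mono (del_le _ _)
  | insert a A ha ih =>
    have h1 := ih fun b hb ↦ hA b (Finset.mem_insert_of_mem hb)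
    have hv : v ∉ A := fun h ↦ G.loopless.irrefl v (hA v (Finset.mem_insert_of_mem h))
    have hadj : (del G (A : Set V)).Adj a v :=
      ⟨(hA a (Finset.mem_insert_self _ _)).symm, by simpa using ha, by simpa using hv⟩
    have h2 := rk_del_add_one_le (K := K) hadj
    rw [del_del] at h2
    rw [Finset.card_insert_of_notMem ha, Finset.coe_insert, Set.insert_eq]
    omega

lemma rk_le_card_sub_one [Nonempty V] (G : SimpleGraph V) : rk K G ≤ Fintype.card V - 1 := by
  let φ : (V → K) →ₗ[K] K := ∑ x : V, LinearMap.proj (R := K) (φ := fun _ ↦ K) x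
  have hφ : ∀ x, φ (Pi.single x 1) = 1 := by
    intro x
    simp [φ, LinearMap.sum_apply]
  have hle : edgeSpan K G ≤ LinearMap.ker φ := edgeSpan_le fun x y _ ↦ by
    rw [LinearMap.mem_ker, map_sub, hφ, hφ, sub_self]
  have hlt : edgeSpan K G < ⊤ := by
    refine lt_of_le_of_lt hle (lt_top_iff_ne_top.2 fun e ↦ ?_)
    have : Pi.single (Classical.arbitrary V) 1 ∈ LinearMap.ker φ := e ▸ Submodule.mem_top
    rw [LinearMap.mem_ker, hφ] at this
    exact one_ne_zero this
  have := Submodule.finrank_lt_finrank_of_lt hlt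
  rw [finrank_top, Module.finrank_fintype_fun_eq_card] at this
  simp only [rk]
  omega

end Rank

section FreeVariables

open MvPolynomial

variable {σ K : Type} [Field K]

open Classical in
/-- The substitution setting the variables in `s` to zero. -/
noncomputable def zeroAt (s : Set σ) : MvPolynomial σ K →ₐ[K] MvPolynomial σ K :=
  aeval fun z ↦ if z ∈ s then 0 else X z

/-- The ideal generated by the variables in `s`. -/
noncomputable def varIdeal (K : Type) [Field K] (s : Set σ) : Ideal (MvPolynomial σ K) :=
  Ideal.span (X '' s)

@[simp]
lemma zeroAt_X_of_mem {s : Set σ} {z : σ} (h : z ∈ s) : zeroAt s (X z : MvPolynomial σ K) = 0 := by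
  simp [zeroAt, h]

@[simp]
lemma zeroAt_X_of_notMem {s : Set σ} {z : σ} (h : z ∉ s) :
    zeroAt s (X z : MvPolynomial σ K) = X z := by
  simp [zeroAt, h]

lemma X_mem_varIdeal {s : Set σ} {z : σ} (h : z ∈ s) : X z ∈ varIdeal K s :=
  Ideal.subset_span ⟨z, h, rfl⟩

lemma sub_zeroAt_mem (s : Set σ) (f : MvPolynomial σ K) : f - zeroAt s f ∈ varIdeal K s := by
  rw [← Ideal.Quotient.eq]
  have h : (Ideal.Quotient.mkₐ K (varIdeal K s)).comp (zeroAt s) =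
      Ideal.Quotient.mkₐ K (varIdeal K s) := by
    refine algHom_ext fun z ↦ ?_
    by_cases hz : z ∈ s
    · simpa [hz] using (Ideal.Quotient.eq_zero_iff_mem.2 (X_mem_varIdeal hz)).symm
    · simp [hz]
  exact (congrArg (fun φ ↦ φ f) h).symm

lemma exists_eq_zeroAt_add (z : σ) (f : MvPolynomial σ K) :
    ∃ g, f = zeroAt {z} f + X z * g := by
  have h := sub_zeroAt_mem {z} f
  rw [varIdeal, Set.image_singleton, Ideal.mem_span_singleton] at h
  obtain ⟨g, hg⟩ := h
  exact ⟨g, by rw [← hg]; ring⟩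

/-- The variable `X z` is free for the ideal `I`. -/
def FreeOf (z : σ) (I : Ideal (MvPolynomial σ K)) : Prop :=
  ∀ f ∈ I, ∃ g ∈ I, f = zeroAt {z} f + X z * g

namespace FreeOf

variable {z : σ} {I J : Ideal (MvPolynomial σ K)}

lemma span {S : Set (MvPolynomial σ K)} (h : ∀ g ∈ S, zeroAt {z} g = g) :
    FreeOf z (Ideal.span S) := by
  intro f hf
  induction hf using Submodule.span_induction with
  | mem g hg => exact ⟨0, zero_mem _, by rw [h g hg]; ring⟩
  | zero => exact ⟨0, zero_mem _, by simp⟩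
  | add f g _ _ hf hg =>
    obtain ⟨a, ha, ha'⟩ := hf
    obtain ⟨b, hb, hb'⟩ := hg
    refine ⟨a + b, add_mem ha hb, ?_⟩
    rw [map_add]
    linear_combination ha' + hb'
  | smul a f hf h =>
    obtain ⟨g, hg, h⟩ := h
    obtain ⟨b, hb⟩ := exists_eq_zeroAt_add z a
    refine ⟨b * f + zeroAt {z} a * g, add_mem (Ideal.mul_mem_left _ _ hf)
      (Ideal.mul_mem_left _ _ hg), ?_⟩
    rw [smul_eq_mul, map_mul]
    linear_combination f * hb + zeroAt {z} a * h

lemma sup (hI : FreeOf z I) (hJ : FreeOf z J) : FreeOf z (I ⊔ J) := by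
  intro f hf
  obtain ⟨a, ha, b, hb, rfl⟩ := Submodule.mem_sup.1 hf
  obtain ⟨a', ha', h⟩ := hI a ha
  obtain ⟨b', hb', h'⟩ := hJ b hb
  refine ⟨a' + b', add_mem (Ideal.mem_sup_left ha') (Ideal.mem_sup_right hb'), ?_⟩
  rw [map_add]
  linear_combination h + h'

lemma zeroAt_mem (hI : FreeOf z I) {f : MvPolynomial σ K} (hf : f ∈ I) : zeroAt {z} f ∈ I := by
  obtain ⟨g, hg, h⟩ := hI f hf
  rw [← sub_eq_iff_eq_add] at h
  exact h ▸ sub_mem hf (Ideal.mul_mem_left _ _ hg)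

lemma mem_of_X_mul_mem (hI : FreeOf z I) {f : MvPolynomial σ K} (hf : X z * f ∈ I) : f ∈ I := by
  obtain ⟨g, hg, h⟩ := hI _ hf
  rw [map_mul, zeroAt_X_of_mem (Set.mem_singleton z), zero_mul, zero_add] at h
  rwa [mul_left_cancel₀ (X_ne_zero z) h]

lemma varIdeal {s : Set σ} (h : z ∉ s) : FreeOf z (varIdeal K s) := by
  refine span ?_
  rintro _ ⟨y, hy, rfl⟩
  exact zeroAt_X_of_notMem fun e ↦ h (Set.mem_singleton_iff.1 e ▸ hy)

end FreeOf

lemma exists_eq_zeroAt_add_totalDegree (z : σ) (f : MvPolynomial σ K) :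
    ∃ g, f = zeroAt {z} f + X z * g ∧ (g = 0 ∨ g.totalDegree < f.totalDegree) := by
  set d := Finsupp.single z 1
  have hf := divMonomial_add_modMonomial_single f z
  have hmod : zeroAt {z} (f.modMonomial d) = f.modMonomial d := by
    have := hom_congr_vars (f₁ := (zeroAt (K := K) {z} : _ →+* _)) (f₂ := RingHom.id _)
      (p₁ := f.modMonomial d) (by ext; simp) (fun i hi _ ↦ ?_) rfl
    · simpa using this
    · have : i ≠ z := by
        rintro rfl
        obtain ⟨m, hm, hi⟩ := (mem_vars_iff_mem_support _).1 hi
        refine mem_support_iff.1 hm (coeff_modMonomial_of_le _ ?_)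
        rw [Finsupp.single_le_iff]
        exact Nat.one_le_iff_ne_zero.2 (Finsupp.mem_support_iff.1 hi)
      simp [this]
  refine ⟨f.divMonomial d, ?_, ?_⟩
  · have h := congrArg (zeroAt {z}) hf
    rw [map_add, map_mul, zeroAt_X_of_mem (Set.mem_singleton z), hmod] at h
    linear_combination -hf + h
  · by_cases h0 : f.divMonomial d = 0
    · exact .inl h0
    · right
      obtain ⟨m, hm, h⟩ := Finset.exists_mem_eq_sup _ (support_nonempty.2 h0) fun m ↦ m.sum fun _ e ↦ e
      rw [totalDegree, h]
      have := le_totalDegree (p := f) (s := d + m) (by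
        rw [mem_support_iff, ← coeff_divMonomial]; exact mem_support_iff.1 hm)
      rw [Finsupp.sum_add_index' (by simp) (by simp)] at this
      simp [d] at this
      omega

/-- The binomial `x_v y_w - x_w y_v` is a nonzerodivisor modulo an ideal not involving `x_w, y_w`
as soon as `x_v` is. -/
lemma mem_of_minor_mul_mem {x y a b : σ} {I : Ideal (MvPolynomial σ K)} (hx : FreeOf x I)
    (hy : FreeOf y I) (hxy : x ≠ y) (hxa : x ≠ a) (ha : ∀ f, X a * f ∈ I → f ∈ I)
    (f : MvPolynomial σ K) (hf : (X a * X y - X x * X b) * f ∈ I) : f ∈ I := by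
  induction h : f.totalDegree using Nat.strong_induction_on generalizing f with
  | _ n ih =>
  subst h
  have h0 : zeroAt {x} f ∈ I := by
    have := hx.zeroAt_mem hf
    simp only [map_mul, map_sub, zeroAt_X_of_mem (Set.mem_singleton x),
      zeroAt_X_of_notMem (Set.mem_singleton_iff.not.2 hxy.symm),
      zeroAt_X_of_notMem (Set.mem_singleton_iff.not.2 hxa.symm), zero_mul, sub_zero] at this
    exact hy.mem_of_X_mul_mem (ha _ (by rwa [← mul_assoc]))
  obtain ⟨g, hg, hg'⟩ := exists_eq_zeroAt_add_totalDegree x f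
  have hgI : (X a * X y - X x * X b) * g ∈ I := by
    refine hx.mem_of_X_mul_mem ?_
    have : X x * ((X a * X y - X x * X b) * g) =
      (X a * X y - X x * X b) * f - (X a * X y - X x * X b) * zeroAt {x} f := by
      linear_combination -(X a * X y - X x * X b) * hg
    exact this ▸ sub_mem hf (Ideal.mul_mem_left _ _ h0)
  rw [hg]
  refine add_mem h0 (Ideal.mul_mem_left _ _ ?_)
  obtain rfl | hlt := hg'
  · exact zero_mem _
  · exact ih _ hlt g hgI rfl

end FreeVariables

section EdgeIdeals

open MvPolynomial

variable {V K : Type} [Field K] {G H : SimpleGraph V}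

/-- The binomial `x_a y_b - x_b y_a`. -/
noncomputable def minor (K : Type) [Field K] (a b : V) : MvPolynomial (V ⊕ V) K :=
  X (Sum.inl a) * X (Sum.inr b) - X (Sum.inl b) * X (Sum.inr a)

/-- The variables attached to the vertices in `A`. -/
def vert (A : Set V) : Set (V ⊕ V) := {z | z.elim id id ∈ A}

lemma vert_singleton [DecidableEq V] (v : V) : vert {v} = ↑({Sum.inl v, Sum.inr v} : Finset (V ⊕ V)) := by
  ext (z | z) <;> simp [vert]

lemma minor_mem {a b : V} (h : G.Adj a b) : minor K a b ∈ binomialEdgeIdeal K G :=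
  Ideal.subset_span ⟨a, b, h, rfl⟩

lemma binomialEdgeIdeal_le {I : Ideal (MvPolynomial (V ⊕ V) K)}
    (h : ∀ a b, G.Adj a b → minor K a b ∈ I) : binomialEdgeIdeal K G ≤ I := by
  rw [binomialEdgeIdeal, Ideal.span_le]
  rintro _ ⟨a, b, hab, rfl⟩
  exact h a b hab

lemma binomialEdgeIdeal_mono (h : G ≤ H) : binomialEdgeIdeal K G ≤ binomialEdgeIdeal K H :=
  binomialEdgeIdeal_le fun _ _ hab ↦ minor_mem (h hab)

lemma zeroAt_minor {s : Set (V ⊕ V)} {a b : V} (ha : ∀ z ∈ s, z.elim id id ≠ a)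
    (hb : ∀ z ∈ s, z.elim id id ≠ b) : zeroAt s (minor K a b) = minor K a b := by
  have h (z : V ⊕ V) (hz : z.elim id id = a ∨ z.elim id id = b) : z ∉ s := fun hzs ↦
    hz.elim (ha z hzs) (hb z hzs)
  simp [minor, zeroAt_X_of_notMem (h (Sum.inl a) (by simp)),
    zeroAt_X_of_notMem (h (Sum.inl b) (by simp)), zeroAt_X_of_notMem (h (Sum.inr a) (by simp)),
    zeroAt_X_of_notMem (h (Sum.inr b) (by simp))]

lemma freeOf_binomialEdgeIdeal {z : V ⊕ V} (hz : ∀ w, ¬ G.Adj (z.elim id id) w) :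
    FreeOf z (binomialEdgeIdeal K G) := by
  refine FreeOf.span ?_
  rintro _ ⟨a, b, h, rfl⟩
  refine zeroAt_minor ?_ ?_
  · rintro _ rfl rfl
    exact hz _ h
  · rintro _ rfl rfl
    exact hz _ h.symm

lemma freeOf_sup_varIdeal {z : V ⊕ V} {s : Set (V ⊕ V)} (hz : ∀ w, ¬ G.Adj (z.elim id id) w)
    (hs : z ∉ s) : FreeOf z (binomialEdgeIdeal K G ⊔ varIdeal K s) :=
  (freeOf_binomialEdgeIdeal hz).sup (.varIdeal hs)

lemma mul_minor_mem_of_adj {v a b : V} (ha : G.Adj v a) (hb : G.Adj v b) {z : V ⊕ V}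
    (hz : z ∈ vert {v}) : X z * minor K a b ∈ binomialEdgeIdeal K G := by
  obtain z | z := z <;> obtain rfl : z = v := hz
  · have : X (Sum.inl z) * minor K a b =
      X (Sum.inl a) * minor K z b - X (Sum.inl b) * minor K z a := by simp only [minor]; ring
    exact this ▸ sub_mem (Ideal.mul_mem_left _ _ (minor_mem hb))
      (Ideal.mul_mem_left _ _ (minor_mem ha))
  · have : X (Sum.inr z) * minor K a b =
      X (Sum.inr a) * minor K z b - X (Sum.inr b) * minor K z a := by simp only [minor]; ring
    exact this ▸ sub_mem (Ideal.mul_mem_left _ _ (minor_mem hb))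
      (Ideal.mul_mem_left _ _ (minor_mem ha))

lemma varIdeal_mul_complNbhd_le (v : V) :
    varIdeal K (vert {v}) * binomialEdgeIdeal K (complNbhd G v) ≤ binomialEdgeIdeal K G := by
  rw [varIdeal, binomialEdgeIdeal, Ideal.span_mul_span, Ideal.span_le]
  rintro _ ⟨_, ⟨z, hz, rfl⟩, _, ⟨a, b, ⟨-, h⟩, rfl⟩, rfl⟩
  obtain h | ⟨ha, hb⟩ := h
  · exact Ideal.mul_mem_left _ _ (minor_mem h)
  · exact mul_minor_mem_of_adj ha hb hz

lemma minor_mem_varIdeal {A : Set V} {a b : V} (h : a ∈ A ∨ b ∈ A) :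
    minor K a b ∈ varIdeal K (vert A) := by
  obtain h | h := h
  · exact sub_mem (Ideal.mul_mem_right _ _ (X_mem_varIdeal h))
      (Ideal.mul_mem_left _ _ (X_mem_varIdeal h))
  · exact sub_mem (Ideal.mul_mem_left _ _ (X_mem_varIdeal h))
      (Ideal.mul_mem_right _ _ (X_mem_varIdeal h))

lemma binomialEdgeIdeal_sup_varIdeal (A : Set V) :
    binomialEdgeIdeal K G ⊔ varIdeal K (vert A) =
      binomialEdgeIdeal K (del G A) ⊔ varIdeal K (vert A) := by
  refine le_antisymm (sup_le (binomialEdgeIdeal_le fun a b h ↦ ?_) le_sup_right)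
    (sup_le_sup_right (binomialEdgeIdeal_mono (del_le G A)) _)
  by_cases hab : a ∈ A ∨ b ∈ A
  · exact Ideal.mem_sup_right (minor_mem_varIdeal hab)
  · rw [not_or] at hab
    exact Ideal.mem_sup_left (minor_mem ⟨h, hab⟩)

lemma zeroAt_mem_binomialEdgeIdeal_del {A : Set V} {f : MvPolynomial (V ⊕ V) K}
    (hf : f ∈ binomialEdgeIdeal K (del G A) ⊔ varIdeal K (vert A)) :
    zeroAt (vert A) f ∈ binomialEdgeIdeal K (del G A) := by
  have : binomialEdgeIdeal K (del G A) ⊔ varIdeal K (vert A) ≤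
      (binomialEdgeIdeal K (del G A)).comap (zeroAt (vert A)) := by
    refine sup_le (binomialEdgeIdeal_le fun a b h ↦ ?_) (Ideal.span_le.2 ?_)
    · rw [Ideal.mem_comap, zeroAt_minor]
      · exact minor_mem h
      · rintro z hz rfl
        exact h.2.1 hz
      · rintro z hz rfl
        exact h.2.2 hz
    · rintro _ ⟨z, hz, rfl⟩
      simp [hz]
  exact this hf

lemma sub_zeroAt_mem_of_mem_complNbhd (v : V) {f : MvPolynomial (V ⊕ V) K}
    (hf : f ∈ binomialEdgeIdeal K (complNbhd G v)) :
    f - zeroAt (vert {v}) f ∈ binomialEdgeIdeal K G := by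
  induction hf using Submodule.span_induction with
  | mem f hf =>
    obtain ⟨a, b, h, rfl⟩ := hf
    change minor K a b - zeroAt _ (minor K a b) ∈ _
    by_cases hab : v = a ∨ v = b
    · have h0 : zeroAt (vert {v}) (minor K a b) = 0 := by
        obtain rfl | rfl := hab
        · have h1 : Sum.inl v ∈ vert {v} := rfl
          have h2 : Sum.inr v ∈ vert {v} := rfl
          simp [minor, h1, h2]
        · have h1 : Sum.inl v ∈ vert {v} := rfl
          have h2 : Sum.inr v ∈ vert {v} := rfl
          simp [minor, h1, h2]
      rw [h0, sub_zero]
      obtain rfl | rfl := hab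
      · exact minor_mem (complNbhd_adj_self.1 h)
      · exact minor_mem (complNbhd_adj_self.1 h.symm).symm
    · rw [not_or] at hab
      rw [zeroAt_minor (by rintro z hz rfl; exact hab.1 hz.symm)
        (by rintro z hz rfl; exact hab.2 hz.symm), sub_self]
      exact zero_mem _
  | zero => simp
  | add f g _ _ hf hg =>
    rw [map_add, add_sub_add_comm]
    exact add_mem hf hg
  | smul a f hf h =>
    rw [smul_eq_mul, map_mul]
    have : a * f - zeroAt (vert {v}) a * zeroAt (vert {v}) f = (a - zeroAt (vert {v}) a) * f +
      zeroAt (vert {v}) a * (f - zeroAt (vert {v}) f) := by ring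
    rw [this]
    exact add_mem (varIdeal_mul_complNbhd_le v (Ideal.mul_mem_mul (sub_zeroAt_mem _ a) hf))
      (Ideal.mul_mem_left _ _ h)

/-- Ohtani's decomposition of a binomial edge ideal at a vertex. -/
lemma complNbhd_inf_del (G : SimpleGraph V) (v : V) :
    binomialEdgeIdeal K (complNbhd G v) ⊓
      (binomialEdgeIdeal K (del G {v}) ⊔ varIdeal K (vert {v})) = binomialEdgeIdeal K G := by
  refine le_antisymm ?_ (le_inf (binomialEdgeIdeal_mono (le_complNbhd G v)) ?_)
  · rintro f ⟨hf, hf'⟩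
    rw [← sub_add_cancel f (zeroAt (vert {v}) f)]
    exact add_mem (sub_zeroAt_mem_of_mem_complNbhd v hf)
      (binomialEdgeIdeal_mono (del_le G _) (zeroAt_mem_binomialEdgeIdeal_del hf'))
  · exact le_sup_left.trans (binomialEdgeIdeal_sup_varIdeal {v}).le

lemma complNbhd_sup_del (G : SimpleGraph V) (v : V) :
    binomialEdgeIdeal K (complNbhd G v) ⊔
      (binomialEdgeIdeal K (del G {v}) ⊔ varIdeal K (vert {v})) =
    binomialEdgeIdeal K (del (complNbhd G v) {v}) ⊔ varIdeal K (vert {v}) := by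
  rw [← binomialEdgeIdeal_sup_varIdeal, ← binomialEdgeIdeal_sup_varIdeal, ← sup_assoc,
    sup_of_le_left (binomialEdgeIdeal_mono (le_complNbhd G v))]

/-- Modulo the ideal of a disjoint union of cliques, variables are nonzerodivisors. -/
lemma IsCluster.mem_of_X_mul_mem [Fintype V] [DecidableEq V] (hG : IsCluster G) {s : Set (V ⊕ V)}
    (hs : ∀ z ∈ s, ∀ w, ¬ G.Adj (z.elim id id) w) {v : V} (hv : Sum.inl v ∉ s)
    {f : MvPolynomial (V ⊕ V) K}
    (hf : X (Sum.inl v) * f ∈ binomialEdgeIdeal K G ⊔ varIdeal K s) :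
    f ∈ binomialEdgeIdeal K G ⊔ varIdeal K s := by
  induction h : rk K G using Nat.strong_induction_on generalizing G v f with
  | _ n ih =>
  subst h
  by_cases hiso : ∀ w, ¬ G.Adj v w
  · exact (freeOf_sup_varIdeal hiso hv).mem_of_X_mul_mem hf
  push Not at hiso
  obtain ⟨k, hk⟩ := hiso
  set I := binomialEdgeIdeal K G ⊔ varIdeal K s
  set I' := binomialEdgeIdeal K (del G {v}) ⊔ varIdeal K s with hI'
  have hI'I : I' ≤ I := sup_le_sup_right (binomialEdgeIdeal_mono (del_le G _)) _
  have hvs (z : V ⊕ V) (hz : z.elim id id = v) : FreeOf z I' := by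
    subst hz
    exact freeOf_sup_varIdeal (not_adj_del_left rfl) fun h ↦ hs z h k hk
  have hx := hvs (Sum.inl v) rfl
  have hkk {g : MvPolynomial (V ⊕ V) K} : X (Sum.inl k) * g ∈ I' → g ∈ I' := fun hg ↦
    ih (rk K (del G {v})) (by have := rk_del_add_one_le (K := K) hk; omega) (hG.del {v})
      (fun z hz w h ↦ hs z hz w h.1) (fun h ↦ hs _ h v hk.symm) hg rfl
  let T : Submodule (MvPolynomial (V ⊕ V) K) (MvPolynomial (V ⊕ V) K × MvPolynomial (V ⊕ V) K) :=
    Submodule.span _ {u | ∃ j, G.Adj v j ∧ u = (X (Sum.inr j), X (Sum.inl j))}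
  let L (a : V) : MvPolynomial (V ⊕ V) K × MvPolynomial (V ⊕ V) K →ₗ[MvPolynomial (V ⊕ V) K]
      MvPolynomial (V ⊕ V) K :=
    (X (Sum.inl a) : MvPolynomial (V ⊕ V) K) • LinearMap.fst _ _ _ -
      (X (Sum.inr a) : MvPolynomial (V ⊕ V) K) • LinearMap.snd _ _ _
  have hL (a j : V) : L a (X (Sum.inr j), X (Sum.inl j)) = minor K a j := by
    simp [L, minor, mul_comm]
  have hTv : T ≤ Submodule.comap (L v) I := by
    refine Submodule.span_le.2 ?_
    rintro _ ⟨j, hj, rfl⟩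
    rw [SetLike.mem_coe, Submodule.mem_comap, hL]
    exact Ideal.mem_sup_left (minor_mem hj)
  have hTk : T ≤ Submodule.comap (L k) I' := by
    refine Submodule.span_le.2 ?_
    rintro _ ⟨j, hj, rfl⟩
    rw [SetLike.mem_coe, Submodule.mem_comap, hL]
    by_cases hkj : k = j
    · simp [hkj, minor]
    · exact Ideal.mem_sup_left (minor_mem ⟨hG hk hj hkj, hk.ne', hj.ne'⟩)
  have hTfree : ∀ u ∈ T, ∃ u' ∈ T,
      u = (zeroAt {Sum.inl v} u.1, zeroAt {Sum.inl v} u.2) +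
        (X (Sum.inl v) : MvPolynomial (V ⊕ V) K) • u' := by
    intro u hu
    induction hu using Submodule.span_induction with
    | mem u hu =>
      obtain ⟨j, hj, rfl⟩ := hu
      refine ⟨0, zero_mem _, ?_⟩
      have : Sum.inl j ∉ ({Sum.inl v} : Set (V ⊕ V)) := by simpa using hj.ne'
      simp [this]
    | zero => exact ⟨0, zero_mem _, by simp [Prod.ext_iff]⟩
    | add f g _ _ hf hg =>
      obtain ⟨a, ha, ha'⟩ := hf
      obtain ⟨b, hb, hb'⟩ := hg
      refine ⟨a + b, add_mem ha hb, ?_⟩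
      conv_lhs => rw [ha', hb']
      ext : 1 <;> simp <;> ring
    | smul a f hf h =>
      obtain ⟨g, hg, h⟩ := h
      obtain ⟨b, hb⟩ := exists_eq_zeroAt_add (Sum.inl v) a
      refine ⟨b • f + zeroAt {Sum.inl v} a • g, add_mem (T.smul_mem _ hf) (T.smul_mem _ hg), ?_⟩
      have h1 := congrArg Prod.fst h
      have h2 := congrArg Prod.snd h
      simp only [Prod.fst_add, Prod.snd_add, Prod.smul_fst, Prod.smul_snd, smul_eq_mul] at h1 h2
      ext : 1
      · simp only [Prod.fst_add, Prod.smul_fst, smul_eq_mul, map_mul]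
        linear_combination f.1 * hb + zeroAt {Sum.inl v} a * h1
      · simp only [Prod.snd_add, Prod.smul_snd, smul_eq_mul, map_mul]
        linear_combination f.2 * hb + zeroAt {Sum.inl v} a * h2
  have hI : I ≤ T.map (L v) ⊔ I' := by
    refine sup_le (binomialEdgeIdeal_le fun a b hab ↦ ?_) (le_sup_right.trans le_sup_right)
    have hvj (j : V) (hj : G.Adj v j) : minor K v j ∈ T.map (L v) ⊔ I' :=
      Submodule.mem_sup_left ⟨_, Submodule.subset_span ⟨j, hj, rfl⟩, hL v j⟩
    by_cases ha : v = a
    · subst ha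
      exact hvj b hab
    by_cases hb : v = b
    · subst hb
      have : minor K a v = - minor K v a := by simp [minor]
      exact this ▸ neg_mem (hvj a hab.symm)
    exact Submodule.mem_sup_right (Ideal.mem_sup_left
      (minor_mem ⟨hab, fun e ↦ ha e.symm, fun e ↦ hb e.symm⟩))
  obtain ⟨_, ⟨u, hu, rfl⟩, g, hg, hfg⟩ := Submodule.mem_sup.1 (hI hf)
  obtain ⟨u', hu', huu⟩ := hTfree u hu
  obtain ⟨g', hg', hgg⟩ := hx g hg
  have h0 : (zeroAt {Sum.inl v} u.1, zeroAt {Sum.inl v} u.2) ∈ T := by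
    rw [← sub_eq_iff_eq_add] at huu
    exact huu ▸ sub_mem hu (T.smul_mem _ hu')
  have h1 := congrArg Prod.fst huu
  have h2 := congrArg Prod.snd huu
  simp only [Prod.fst_add, Prod.snd_add, Prod.smul_fst, Prod.smul_snd, smul_eq_mul] at h1 h2
  have h3 := congrArg (zeroAt {Sum.inl v}) hfg
  have hvv : Sum.inr v ∉ ({Sum.inl v} : Set (V ⊕ V)) := by simp
  simp only [L, LinearMap.sub_apply, LinearMap.smul_apply, LinearMap.fst_apply,
    LinearMap.snd_apply, smul_eq_mul, map_add, map_sub, map_mul,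
    zeroAt_X_of_mem (Set.mem_singleton _), zeroAt_X_of_notMem hvv] at h3 hfg
  have hq : zeroAt {Sum.inl v} u.2 ∈ I' := by
    refine (hvs (Sum.inr v) rfl).mem_of_X_mul_mem ?_
    have : X (Sum.inr v) * zeroAt {Sum.inl v} u.2 = zeroAt {Sum.inl v} g := by
      linear_combination -h3
    exact this ▸ hx.zeroAt_mem hg
  have hp : zeroAt {Sum.inl v} u.1 ∈ I' := by
    refine hkk ?_
    have := hTk h0
    simp only [L, Submodule.mem_comap, LinearMap.sub_apply, LinearMap.smul_apply,
      LinearMap.fst_apply, LinearMap.snd_apply, smul_eq_mul] at this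
    exact (Submodule.sub_mem_iff_left _ (Ideal.mul_mem_left _ _ hq)).1 this
  have hfin : f = zeroAt {Sum.inl v} u.1 + L v u' + g' := by
    refine mul_left_cancel₀ (X_ne_zero (R := K) (Sum.inl v)) ?_
    simp only [L, LinearMap.sub_apply, LinearMap.smul_apply, LinearMap.fst_apply,
      LinearMap.snd_apply, smul_eq_mul]
    linear_combination -hfg + h3 + hgg + X (Sum.inl v) * h1 - X (Sum.inr v) * h2
  rw [hfin]
  exact add_mem (add_mem (hI'I hp) (hTv hu')) (hI'I hg')

/-- The closed neighbourhood of a vertex. -/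
def closedNbhd (G : SimpleGraph V) (v : V) : Set V := {j | j = v ∨ G.Adj v j}

lemma IsCluster.X_mul_mem_iff (hG : IsCluster G) (v : V) (f : MvPolynomial (V ⊕ V) K) :
    X (Sum.inr v) * f ∈ binomialEdgeIdeal K G ⊔ varIdeal K {Sum.inl v} ↔
      f ∈ binomialEdgeIdeal K (del G (closedNbhd G v)) ⊔
        varIdeal K (Sum.inl '' closedNbhd G v) := by
  constructor
  · intro h
    refine (freeOf_sup_varIdeal (z := Sum.inr v) (not_adj_del_left (.inl rfl))
      (by simp)).mem_of_X_mul_mem (sup_le (binomialEdgeIdeal_le fun a b hab ↦ ?_) ?_ h)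
    · have key {a b : V} (hab : G.Adj a b) (ha : a ∈ closedNbhd G v) : b ∈ closedNbhd G v := by
        obtain rfl | ha := ha
        · exact .inr hab
        · by_cases hb : b = v
          · exact .inl hb
          · exact .inr (hG ha.symm hab (Ne.symm hb))
      have hx {a : V} (ha : a ∈ closedNbhd G v) :
          X (Sum.inl a) ∈ varIdeal K (Sum.inl '' closedNbhd G v : Set (V ⊕ V)) :=
        X_mem_varIdeal ⟨a, ha, rfl⟩
      by_cases ha : a ∈ closedNbhd G v
      · exact Ideal.mem_sup_right (sub_mem (Ideal.mul_mem_right _ _ (hx ha))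
          (Ideal.mul_mem_right _ _ (hx (key hab ha))))
      · exact Ideal.mem_sup_left (minor_mem ⟨hab, ha, fun hb ↦ ha (key hab.symm hb)⟩)
    · refine le_trans (Ideal.span_mono (Set.image_mono ?_)) le_sup_right
      rintro _ rfl
      exact ⟨v, .inl rfl, rfl⟩
  · suffices h : binomialEdgeIdeal K (del G (closedNbhd G v)) ⊔
        varIdeal K (Sum.inl '' closedNbhd G v) ≤
        Submodule.comap (LinearMap.mulLeft _ (X (Sum.inr v)))
          (binomialEdgeIdeal K G ⊔ varIdeal K {Sum.inl v}) from fun hf ↦ h hf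
    refine sup_le (binomialEdgeIdeal_le fun a b hab ↦ ?_) (Ideal.span_le.2 ?_)
    · exact Ideal.mem_sup_left (Ideal.mul_mem_left _ _ (minor_mem hab.1))
    · rintro _ ⟨_, ⟨j, hj, rfl⟩, rfl⟩
      have hv : X (Sum.inl v) ∈ varIdeal K {(Sum.inl v : V ⊕ V)} := X_mem_varIdeal rfl
      change X (Sum.inr v) * X (Sum.inl j) ∈ binomialEdgeIdeal K G ⊔ varIdeal K {Sum.inl v}
      obtain rfl | hj := hj
      · exact Ideal.mem_sup_right (Ideal.mul_mem_left _ _ hv)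
      · have : (X (Sum.inr v) * X (Sum.inl j) : MvPolynomial (V ⊕ V) K) =
          X (Sum.inl v) * X (Sum.inr j) - minor K v j := by simp only [minor]; ring
        rw [this]
        exact sub_mem (Ideal.mem_sup_right (Ideal.mul_mem_right _ _ hv))
          (Ideal.mem_sup_left (minor_mem hj))

lemma IsCluster.X_mul_mem_del_sup_span (hG : IsCluster G) {v w : V} (hvw : G.Adj v w)
    {f : MvPolynomial (V ⊕ V) K} (hf : f ∈ binomialEdgeIdeal K G) :
    X (Sum.inl v) * f ∈ binomialEdgeIdeal K (del G {w}) ⊔ Ideal.span {minor K v w} := by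
  suffices h : binomialEdgeIdeal K G ≤ Submodule.comap (LinearMap.mulLeft _ (X (Sum.inl v)))
    (binomialEdgeIdeal K (del G {w}) ⊔ Ideal.span {minor K v w}) from h hf
  have hm : minor K v w ∈ binomialEdgeIdeal K (del G {w}) ⊔ Ideal.span {minor K v w} :=
    Ideal.mem_sup_right (Ideal.subset_span rfl)
  have key (b : V) (h : G.Adj w b) : X (Sum.inl v) * minor K w b ∈
      binomialEdgeIdeal K (del G {w}) ⊔ Ideal.span {minor K v w} := by
    have : X (Sum.inl v) * minor K w b =
      X (Sum.inl w) * minor K v b - X (Sum.inl b) * minor K v w := by simp only [minor]; ring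
    rw [this]
    refine sub_mem (Ideal.mul_mem_left _ _ ?_) (Ideal.mul_mem_left _ _ hm)
    by_cases hb : v = b
    · simp [hb, minor]
    · exact Ideal.mem_sup_left (minor_mem ⟨hG hvw.symm h hb, hvw.ne, h.ne'⟩)
  refine binomialEdgeIdeal_le fun a b hab ↦ ?_
  change X (Sum.inl v) * minor K a b ∈ binomialEdgeIdeal K (del G {w}) ⊔ Ideal.span {minor K v w}
  by_cases ha : w = a
  · exact ha ▸ key b (ha ▸ hab)
  by_cases hb : w = b
  · have : minor K a b = - minor K b a := by simp [minor]
    rw [this, mul_neg]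
    exact neg_mem (hb ▸ key a (hb ▸ hab.symm))
  exact Ideal.mem_sup_left (Ideal.mul_mem_left _ _
    (minor_mem ⟨hab, fun e ↦ ha e.symm, fun e ↦ hb e.symm⟩))

end EdgeIdeals

section ProjectiveDimension

open CategoryTheory Abelian

variable {R : Type} [CommRing R]

lemma shortExact_of_linearMap {A B C : Type} [AddCommGroup A] [AddCommGroup B] [AddCommGroup C]
    [Module R A] [Module R B] [Module R C] {f : A →ₗ[R] B} {g : B →ₗ[R] C}
    (hf : Function.Injective f) (hfg : Function.Exact f g) (hg : Function.Surjective g) :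
    (ModuleCat.shortComplexOfCompEqZero f g hfg.linearMap_comp_eq_zero).ShortExact :=
  ModuleCat.shortComplex_shortExact _ hfg hf hg

/-- The module `R ⧸ I` has projective dimension less than `k`. -/
def PdLT (I : Ideal R) (k : ℕ) : Prop :=
  HasProjectiveDimensionLT (ModuleCat.of R (R ⧸ I)) k

/-- Multiplication by `z`, as a map from `R ⧸ I` to `R ⧸ J`. -/
def mulQ {I J : Ideal R} (z : R) (h : ∀ f ∈ I, z * f ∈ J) : (R ⧸ I) →ₗ[R] (R ⧸ J) :=
  Submodule.mapQ I J (LinearMap.mulLeft R z) h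

/-- The projection from `R ⧸ I` to `R ⧸ J` for `I ≤ J`. -/
def projQ {I J : Ideal R} (h : I ≤ J) : (R ⧸ I) →ₗ[R] (R ⧸ J) :=
  Submodule.mapQ I J LinearMap.id h

lemma projQ_mk {I J : Ideal R} (h : I ≤ J) (f : R) :
    projQ h (Ideal.Quotient.mk I f) = Ideal.Quotient.mk J f := rfl

namespace PdLT

variable {I J C : Ideal R} {k : ℕ} {z : R}

lemma mono (h : PdLT I k) {m : ℕ} (hkm : k ≤ m) : PdLT I m :=
  have : HasProjectiveDimensionLT (ModuleCat.of R (R ⧸ I)) k := h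
  hasProjectiveDimensionLT_of_ge _ k m hkm

lemma bot : PdLT (⊥ : Ideal R) 1 := by
  have : Module.Free R (R ⧸ (⊥ : Ideal R)) :=
    Module.Free.of_equiv (Submodule.quotEquivOfEqBot (⊥ : Ideal R) rfl).symm
  have : Projective (ModuleCat.of R (R ⧸ (⊥ : Ideal R))) :=
    (IsProjective.iff_projective (R ⧸ (⊥ : Ideal R))).1 inferInstance
  exact projective_iff_hasProjectiveDimensionLT_one.1 this

lemma inf (hI : PdLT I k) (hJ : PdLT J k) (hIJ : PdLT (I ⊔ J) (k + 1)) : PdLT (I ⊓ J) k := by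
  have hprod : HasProjectiveDimensionLT (ModuleCat.of R ((R ⧸ I) × (R ⧸ J))) k :=
    (shortExact_of_linearMap (f := LinearMap.inl R (R ⧸ I) (R ⧸ J))
      (g := LinearMap.snd R (R ⧸ I) (R ⧸ J)) LinearMap.inl_injective .inl_snd
      LinearMap.snd_surjective).hasProjectiveDimensionLT_X₂ k hI hJ
  refine (shortExact_of_linearMap
    (f := (projQ inf_le_left : (R ⧸ I ⊓ J) →ₗ[R] (R ⧸ I)).prod (projQ inf_le_right))
    (g := (projQ le_sup_left : (R ⧸ I) →ₗ[R] (R ⧸ I ⊔ J)).coprod (-projQ le_sup_right))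
    ?_ ?_ ?_).hasProjectiveDimensionLT_X₁ k hprod hIJ
  · rw [injective_iff_map_eq_zero]
    intro a ha
    obtain ⟨a, rfl⟩ := Ideal.Quotient.mk_surjective a
    obtain ⟨h1, h2⟩ := Prod.ext_iff.1 ha
    exact Ideal.Quotient.eq_zero_iff_mem.2
      ⟨Ideal.Quotient.eq_zero_iff_mem.1 h1, Ideal.Quotient.eq_zero_iff_mem.1 h2⟩
  · rintro ⟨a, b⟩
    obtain ⟨a, rfl⟩ := Ideal.Quotient.mk_surjective a
    obtain ⟨b, rfl⟩ := Ideal.Quotient.mk_surjective b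
    constructor
    · intro h
      have h' : Ideal.Quotient.mk (I ⊔ J) a + -Ideal.Quotient.mk (I ⊔ J) b = 0 := h
      rw [← sub_eq_add_neg, ← map_sub, Ideal.Quotient.eq_zero_iff_mem] at h'
      obtain ⟨i, hi, j, hj, hij⟩ := Submodule.mem_sup.1 h'
      refine ⟨Ideal.Quotient.mk _ (a - i), Prod.ext ?_ ?_⟩
      · exact Ideal.Quotient.eq.2 (by simpa using hi)
      · refine Ideal.Quotient.eq.2 ?_
        have : a - i - b = j := by linear_combination -hij
        exact this ▸ hj
    · rintro ⟨c, hc⟩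
      obtain ⟨c, rfl⟩ := Ideal.Quotient.mk_surjective c
      rw [← hc]
      exact add_neg_cancel (Ideal.Quotient.mk (I ⊔ J) c)
  · intro c
    obtain ⟨c, rfl⟩ := Ideal.Quotient.mk_surjective c
    refine ⟨(Ideal.Quotient.mk _ c, 0), ?_⟩
    simp [projQ_mk]

lemma colon_shortExact (h : ∀ f, z * f ∈ I ↔ f ∈ C) :
    (ModuleCat.shortComplexOfCompEqZero (mulQ z fun f hf ↦ (h f).2 hf)
      (projQ (le_sup_left : I ≤ I ⊔ Ideal.span {z})) (by
        refine LinearMap.ext fun f ↦ ?_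
        obtain ⟨f, rfl⟩ := Ideal.Quotient.mk_surjective f
        exact Ideal.Quotient.eq_zero_iff_mem.2 (Ideal.mem_sup_right
          (Ideal.mul_mem_right _ _ (Ideal.mem_span_singleton_self z))))).ShortExact := by
  refine shortExact_of_linearMap ?_ ?_ ?_
  · rw [injective_iff_map_eq_zero]
    intro f hf
    obtain ⟨f, rfl⟩ := Ideal.Quotient.mk_surjective f
    exact Ideal.Quotient.eq_zero_iff_mem.2 ((h f).1 (Ideal.Quotient.eq_zero_iff_mem.1 hf))
  · intro f
    obtain ⟨f, rfl⟩ := Ideal.Quotient.mk_surjective f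
    constructor
    · intro hf
      obtain ⟨i, hi, j, hj, rfl⟩ := Submodule.mem_sup.1 (Ideal.Quotient.eq_zero_iff_mem.1 hf)
      obtain ⟨c, rfl⟩ := Ideal.mem_span_singleton.1 hj
      exact ⟨Ideal.Quotient.mk _ c, Ideal.Quotient.eq.2 (by simpa using hi)⟩
    · rintro ⟨c, hc⟩
      obtain ⟨c, rfl⟩ := Ideal.Quotient.mk_surjective c
      rw [← hc]
      exact Ideal.Quotient.eq_zero_iff_mem.2 (Ideal.mem_sup_right
        (Ideal.mul_mem_right _ _ (Ideal.mem_span_singleton_self z)))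
  · intro f
    obtain ⟨f, rfl⟩ := Ideal.Quotient.mk_surjective f
    exact ⟨Ideal.Quotient.mk _ f, rfl⟩

lemma of_colon (hC : PdLT C k) (hz : PdLT (I ⊔ Ideal.span {z}) k)
    (h : ∀ f, z * f ∈ I ↔ f ∈ C) : PdLT I k :=
  (colon_shortExact h).hasProjectiveDimensionLT_X₂ k hC hz

lemma sup_span_singleton (hI : PdLT I k) (h : ∀ f, z * f ∈ I → f ∈ I) :
    PdLT (I ⊔ Ideal.span {z}) (k + 1) :=
  (colon_shortExact fun f ↦ ⟨h f, I.mul_mem_left z⟩).hasProjectiveDimensionLT_X₃ k hI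
    (hI.mono (Nat.le_succ k))

/-- If a nonzerodivisor `z` modulo `I` multiplies `I` into `J ≤ I`, the projective dimension of
`R ⧸ I` is controlled by those of `R ⧸ J` and `R ⧸ (I + z)`. -/
lemma of_mul_mem (hJ : PdLT J k) (hz : PdLT (I ⊔ Ideal.span {z}) (k + 1))
    (h : ∀ f, z * f ∈ I → f ∈ I) (hJI : J ≤ I) (hIJ : ∀ f ∈ I, z * f ∈ J) : PdLT I k := by
  have hS := colon_shortExact fun f ↦ ⟨h f, I.mul_mem_left z⟩
  have hJ' : HasProjectiveDimensionLT (ModuleCat.of R (R ⧸ J)) k := hJ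
  have hz' : HasProjectiveDimensionLT (ModuleCat.of R (R ⧸ (I ⊔ Ideal.span {z}))) (k + 1) := hz
  refine HasProjectiveDimensionLT.mk fun i hi Y e ↦ ?_
  obtain ⟨x, hx⟩ := Ext.contravariant_sequence_exact₁ hS Y e (add_comm 1 i)
    (Ext.eq_zero_of_hasProjectiveDimensionLT (X := ModuleCat.of R (R ⧸ (I ⊔ Ideal.span {z}))) _
      (k + 1) (by omega))
  have hfac : ModuleCat.ofHom (mulQ z fun f hf ↦ I.mul_mem_left z hf : (R ⧸ I) →ₗ[R] (R ⧸ I)) =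
      ModuleCat.ofHom (mulQ z hIJ) ≫ ModuleCat.ofHom (projQ hJI) := by
    ext
    rfl
  have hx' : e = (Ext.mk₀ (ModuleCat.ofHom (mulQ z hIJ) ≫ ModuleCat.ofHom (projQ hJI))).comp x
    (zero_add i) := by rw [← hx, ← hfac]
  rw [hx', ← Ext.mk₀_comp_mk₀_assoc,
    Ext.eq_zero_of_hasProjectiveDimensionLT ((Ext.mk₀ (ModuleCat.ofHom (projQ hJI))).comp x _) k hi,
    Ext.comp_zero]

lemma sup_varIdeal {σ K : Type} [Field K] {I : Ideal (MvPolynomial σ K)} {k : ℕ} (hI : PdLT I k)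
    (s : Finset σ) (h : ∀ z ∈ s, FreeOf z I) : PdLT (I ⊔ varIdeal K s) (k + s.card) := by
  classical
  induction s using Finset.induction_on with
  | empty => simpa [varIdeal] using hI
  | insert z s hz ih =>
    have h1 := (ih fun y hy ↦ h y (Finset.mem_insert_of_mem hy)).sup_span_singleton
      fun f hf ↦ ((h z (Finset.mem_insert_self z s)).sup
        (.varIdeal (by simpa using hz))).mem_of_X_mul_mem hf
    rw [sup_assoc, varIdeal, ← Ideal.span_union, Set.union_comm, ← Set.insert_eq,
      ← Set.image_insert_eq, ← Finset.coe_insert] at h1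
    rwa [Finset.card_insert_of_notMem hz, ← add_assoc]

end PdLT

end ProjectiveDimension

section UpperBound

open MvPolynomial

variable {V K : Type} [DecidableEq V] [Field K] {G : SimpleGraph V}

lemma PdLT.del_sup_vert {v : V} {k : ℕ} (h : PdLT (binomialEdgeIdeal K (del G {v})) k) :
    PdLT (binomialEdgeIdeal K (del G {v}) ⊔ varIdeal K (vert {v})) (k + 2) := by
  rw [vert_singleton]
  refine h.sup_varIdeal {Sum.inl v, Sum.inr v} fun z hz ↦ freeOf_binomialEdgeIdeal ?_
  simp only [Finset.mem_insert, Finset.mem_singleton] at hz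
  obtain rfl | rfl := hz <;> exact not_adj_del_left rfl

variable [Fintype V]

/-- Induction along Ohtani's decomposition, with disjoint unions of cliques as the base case. -/
lemma SeparatesNbrs.induction {P : SimpleGraph V → Prop} (cluster : ∀ G, IsCluster G → P G)
    (step : ∀ (G : SimpleGraph V) (v a b : V), SeparatesNbrs G → G.Adj v a → G.Adj v b → a ≠ b →
      ¬ G.Adj a b → P (complNbhd G v) → P (del G {v}) → P (del (complNbhd G v) {v}) → P G)
    (hG : SeparatesNbrs G) : P G := by
  induction hr : rk ℚ G using Nat.strong_induction_on generalizing G with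
  | _ r ih =>
  induction G using WellFoundedGT.induction with
  | _ G ih' =>
  by_cases hc : IsCluster G
  · exact cluster G hc
  simp only [IsCluster] at hc
  push Not at hc
  obtain ⟨v, a, b, ha, hb, hab, h⟩ := hc
  have h1 := rk_complNbhd_le (K := ℚ) G v
  have h2 := rk_del_add_one_le (K := ℚ) ha
  have h3 := rk_del_add_one_le (K := ℚ) (complNbhd_adj_self.2 ha)
  refine step G v a b hG ha hb hab h ?_ (ih _ (hr ▸ h2) (hG.del v) rfl)
    (ih _ (by omega) ((hG.complNbhd v).del v) rfl)
  by_cases heq : rk ℚ (complNbhd G v) = r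
  · refine ih' _ (lt_of_le_of_ne (le_complNbhd G v) fun e ↦ h ?_) (hG.complNbhd v) heq
    rw [e]
    exact ⟨hab, .inr ⟨ha, hb⟩⟩
  · exact ih _ (by omega) (hG.complNbhd v) rfl

lemma IsCluster.mem_of_inl_mul_mem (hG : IsCluster G) {v : V} {f : MvPolynomial (V ⊕ V) K}
    (hf : X (Sum.inl v) * f ∈ binomialEdgeIdeal K G) : f ∈ binomialEdgeIdeal K G := by
  have h : binomialEdgeIdeal K G ⊔ varIdeal K ∅ = binomialEdgeIdeal K G := by simp [varIdeal]
  rw [← h] at hf ⊢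
  exact hG.mem_of_X_mul_mem (by simp) (Set.notMem_empty _) hf

lemma IsCluster.pdLT_sup_span_minor (hG : IsCluster G) {v w : V} (hvw : v ≠ w)
    (hw : ∀ a, ¬ G.Adj w a) {k : ℕ} (h : PdLT (binomialEdgeIdeal K G) k) :
    PdLT (binomialEdgeIdeal K G ⊔ Ideal.span {minor K v w}) (k + 1) := by
  have h1 : FreeOf (Sum.inl w) (binomialEdgeIdeal K G) := freeOf_binomialEdgeIdeal hw
  have h2 : FreeOf (Sum.inr w) (binomialEdgeIdeal K G) := freeOf_binomialEdgeIdeal hw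
  refine h.sup_span_singleton fun f hf ↦ ?_
  exact mem_of_minor_mul_mem h1 h2 Sum.inl_ne_inr (Sum.inl_injective.ne hvw.symm)
    (fun f ↦ hG.mem_of_inl_mul_mem) f hf

lemma IsCluster.pdLT (hG : IsCluster G) : PdLT (binomialEdgeIdeal K G) (rk K G + 1) := by
  induction hr : rk K G using Nat.strong_induction_on generalizing G with
  | _ r ih =>
  by_cases hbot : ∀ v w, ¬ G.Adj v w
  · have : binomialEdgeIdeal K G = ⊥ :=
      le_bot_iff.1 (binomialEdgeIdeal_le fun a b h ↦ (hbot a b h).elim)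
    rw [this]
    exact PdLT.bot.mono (by omega)
  push Not at hbot
  obtain ⟨v, w, hvw⟩ := hbot
  have hw := rk_del_add_one_le (K := K) hvw.symm
  have hv := rk_del_add_one_le (K := K) hvw
  replace ih {H : SimpleGraph V} (hH : IsCluster H) (h : rk K H < r) :
      PdLT (binomialEdgeIdeal K H) (rk K H + 1) := ih _ h hH rfl
  have hJ : PdLT (binomialEdgeIdeal K (del G {w}) ⊔ Ideal.span {minor K v w}) (r + 1) :=
    ((hG.del {w}).pdLT_sup_span_minor hvw.ne (not_adj_del_left rfl) (ih (hG.del {w}) (by omega))).mono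
      (by omega)
  have hspan (z : V ⊕ V) : Ideal.span {X z} = varIdeal K {z} := by
    rw [varIdeal, Set.image_singleton]
  refine hJ.of_mul_mem (z := X (Sum.inl v)) ?_ (fun f ↦ hG.mem_of_inl_mul_mem) (sup_le
    (binomialEdgeIdeal_mono (del_le G _)) ?_) fun f hf ↦ hG.X_mul_mem_del_sup_span hvw hf
  · rw [hspan]
    refine PdLT.of_colon (z := X (Sum.inr v)) ?_ ?_ (hG.X_mul_mem_iff v)
    · classical
      set A : Finset V := Finset.univ.filter (G.Adj v)
      have hA : closedNbhd G v = ↑(insert v A) := by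
        ext j
        simp [closedNbhd, A]
      have h1 := rk_del_add_card_le (K := K) (G := G) (v := v) A (by simp [A])
      have h2 : 0 < A.card := Finset.card_pos.2 ⟨w, by simpa [A] using hvw⟩
      have h3 : rk K (del G (closedNbhd G v)) ≤ rk K (del G A) := rk_mono fun a b h ↦
        ⟨h.1, fun ha ↦ h.2.1 (.inr (by simpa [A] using ha)),
          fun hb ↦ h.2.2 (.inr (by simpa [A] using hb))⟩
      have h4 := (ih (hG.del (closedNbhd G v)) (by omega)).sup_varIdeal
        ((insert v A).map .inl) fun z hz ↦ by
          obtain ⟨a, ha, rfl⟩ := Finset.mem_map.1 hz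
          exact freeOf_binomialEdgeIdeal (not_adj_del_left (hA ▸ ha))
      rw [Finset.coe_map, Finset.card_map, ← hA,
        Finset.card_insert_of_notMem (by simp [A])] at h4
      exact h4.mono (by omega)
    · rw [hspan, sup_assoc, varIdeal, varIdeal, ← Ideal.span_union, ← Set.image_union]
      have : ({Sum.inl v} ∪ {Sum.inr v} : Set (V ⊕ V)) = vert {v} := by
        ext (z | z) <;> simp [vert]
      rw [this]
      change PdLT (_ ⊔ varIdeal K (vert {v})) _
      rw [binomialEdgeIdeal_sup_varIdeal]
      exact (ih (hG.del {v}) (by omega)).del_sup_vert.mono (by omega)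
  · rw [Ideal.span_singleton_le_iff_mem]
    exact minor_mem hvw

lemma SeparatesNbrs.pdLT (hG : SeparatesNbrs G) : PdLT (binomialEdgeIdeal K G) (rk K G + 1) := by
  refine SeparatesNbrs.induction (fun G h ↦ h.pdLT) (fun G v a b hG ha hb hab h h1 h2 h3 ↦ ?_) hG
  have r1 := rk_complNbhd_le (K := K) G v
  have r2 := rk_del_add_two_le (K := K) ha hb (hG ha hb hab h)
  have r3 := rk_del_add_one_le (K := K) (complNbhd_adj_self.2 ha)
  rw [← complNbhd_inf_del G v]
  refine (h1.mono (by omega)).inf (h2.del_sup_vert.mono (by omega)) ?_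
  rw [complNbhd_sup_del]
  exact h3.del_sup_vert.mono (by omega)

end UpperBound

section HeightUpperBound

open MvPolynomial

lemma mem_minimalPrimes_of_le {R : Type*} [CommRing R] {I J p : Ideal R}
    (hp : p ∈ I.minimalPrimes) (hIJ : I ≤ J) (hJ : J ≤ p) : p ∈ J.minimalPrimes :=
  ⟨⟨hp.1.1, hJ⟩, fun _ hq hqp ↦ hp.2 ⟨hq.1, hIJ.trans hq.2⟩ hqp⟩

variable {V K : Type} [Fintype V] [DecidableEq V] [Field K] {G : SimpleGraph V}

/-- The linear map sending `e_i` to `y_i * ∏ x_k`, the product running over the `k ∉ A ∪ {i}`. -/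
noncomputable def clearDenom (K : Type) [Field K] (A : Finset V) :
    (V → K) →ₗ[K] MvPolynomial (V ⊕ V) K :=
  Fintype.linearCombination K fun i ↦ X (Sum.inr i) * ∏ k ∈ Aᶜ.erase i, X (Sum.inl k)

lemma clearDenom_single_sub {A : Finset V} {a b : V} (ha : a ∉ A) (hb : b ∉ A) (hab : a ≠ b) :
    clearDenom K A (Pi.single a 1 - Pi.single b 1) =
      minor K b a * ∏ k ∈ (Aᶜ.erase a).erase b, X (Sum.inl k) := by
  have h1 : ∏ k ∈ Aᶜ.erase a, X (R := K) (Sum.inl k : V ⊕ V) =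
      X (Sum.inl b) * ∏ k ∈ (Aᶜ.erase a).erase b, X (Sum.inl k) :=
    (Finset.mul_prod_erase _ _ (by simp [hab.symm, hb])).symm
  have h2 : ∏ k ∈ Aᶜ.erase b, X (R := K) (Sum.inl k : V ⊕ V) =
      X (Sum.inl a) * ∏ k ∈ (Aᶜ.erase a).erase b, X (Sum.inl k) := by
    rw [Finset.erase_right_comm]
    exact (Finset.mul_prod_erase _ _ (by simp [hab, ha])).symm
  rw [map_sub, clearDenom, Fintype.linearCombination_apply_single,
    Fintype.linearCombination_apply_single, h1, h2, minor, one_smul, one_smul]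
  ring

lemma IsCluster.height_le [Nonempty V] (hG : IsCluster G) {A : Finset V} (hA : ∀ a ∈ A, ∀ w, ¬ G.Adj a w)
    {p : Ideal (MvPolynomial (V ⊕ V) K)}
    (hp : p ∈ (binomialEdgeIdeal K G ⊔ varIdeal K (vert ↑A)).minimalPrimes) :
    p.height ≤ (rk K G + 2 * A.card : ℕ) := by
  classical
  have hx (v : V) (hv : v ∉ A) : X (Sum.inl v) ∉ p := by
    intro hmem
    obtain ⟨y, hy, hxy⟩ := Ideal.exists_mul_mem_of_mem_minimalPrimes hp hmem
    exact hy (hG.mem_of_X_mul_mem (fun z hz ↦ hA _ hz) hv hxy)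
  obtain ⟨t, hts, hcard, hspan, -⟩ := Submodule.exists_finset_span_eq_linearIndepOn K
    {u : V → K | ∃ a b, G.Adj a b ∧ u = Pi.single a 1 - Pi.single b 1}
  have hex (u) (hu : u ∈ t) : ∃ a b, G.Adj a b ∧ u = Pi.single a 1 - Pi.single b 1 := hts hu
  choose! f g hfg using hex
  have hadj {a b : V} (h : G.Adj a b) : a ∉ A ∧ b ∉ A :=
    ⟨fun ha ↦ hA a ha b h, fun hb ↦ hA b hb a h.symm⟩
  set T : Finset (MvPolynomial (V ⊕ V) K) := t.image (fun u ↦ minor K (g u) (f u)) ∪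
    (A.image fun a ↦ X (Sum.inl a)) ∪ A.image fun a ↦ X (Sum.inr a)
  have hT : T.card ≤ rk K G + 2 * A.card := by
    have h1 : T.card ≤ _ := Finset.card_union_le _ _
    have h2 := Finset.card_union_le (t.image (fun u ↦ minor K (g u) (f u)))
      (A.image fun a ↦ X (Sum.inl a))
    have h3 : (t.image (fun u ↦ minor K (g u) (f u))).card ≤ t.card := Finset.card_image_le
    have h4 : (A.image fun a ↦ (X (Sum.inl a) : MvPolynomial (V ⊕ V) K)).card ≤ A.card :=
      Finset.card_image_le
    have h5 : (A.image fun a ↦ (X (Sum.inr a) : MvPolynomial (V ⊕ V) K)).card ≤ A.card :=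
      Finset.card_image_le
    have h6 : t.card = rk K G := hcard
    omega
  refine (Ideal.height_le_card_of_mem_minimalPrimes_span_finset (s := T)
    ⟨⟨hp.1.1, ?_⟩, fun q ⟨hq, hTq⟩ hqp ↦ hp.2 ⟨hq, sup_le ?_ ?_⟩ hqp⟩).trans
    (Nat.cast_le.2 hT)
  · rw [Ideal.span_le]
    intro z hz
    refine hp.1.2 ?_
    simp only [T, Finset.coe_union, Finset.coe_image, Set.mem_union, Set.mem_image] at hz
    obtain (⟨u, hu, rfl⟩ | ⟨a, ha, rfl⟩) | ⟨a, ha, rfl⟩ := hz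
    · exact Ideal.mem_sup_left (minor_mem (hfg u hu).1.symm)
    · exact Ideal.mem_sup_right (X_mem_varIdeal ha)
    · exact Ideal.mem_sup_right (X_mem_varIdeal ha)
  · have hle : edgeSpan K G ≤ (q.restrictScalars K).comap (clearDenom K A) := by
      rw [edgeSpan, ← hspan, Submodule.span_le]
      intro u hu
      obtain ⟨hu1, hu2⟩ := hfg u hu
      obtain ⟨hf, hg⟩ := hadj hu1
      rw [hu2]
      change clearDenom K A _ ∈ q
      rw [clearDenom_single_sub hf hg hu1.ne]
      refine Ideal.mul_mem_right _ _ (hTq (Ideal.subset_span ?_))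
      simp only [T, Finset.coe_union, Finset.coe_image]
      exact Or.inl (Or.inl ⟨u, hu, rfl⟩)
    refine binomialEdgeIdeal_le fun a b h ↦ ?_
    obtain ⟨ha, hb⟩ := hadj h
    have hmem : clearDenom K A (Pi.single b 1 - Pi.single a 1) ∈ q := hle (mem_edgeSpan h.symm)
    rw [clearDenom_single_sub hb ha h.ne.symm] at hmem
    refine (hq.mem_or_mem hmem).resolve_right fun hprod ↦ ?_
    obtain ⟨k, hk, hkq⟩ := (hq.prod_mem_iff).1 hprod
    exact hx k (by simpa using Finset.mem_of_mem_erase (Finset.mem_of_mem_erase hk)) (hqp hkq)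
  · rw [varIdeal, Ideal.span_le]
    rintro _ ⟨z, hz, rfl⟩
    refine hTq (Ideal.subset_span ?_)
    simp only [T, Finset.coe_union, Finset.coe_image]
    obtain z | z := z
    · exact Or.inl (Or.inr ⟨z, hz, rfl⟩)
    · exact Or.inr ⟨z, hz, rfl⟩

lemma SeparatesNbrs.height_le [Nonempty V] (hG : SeparatesNbrs G) {A : Finset V}
    (hA : ∀ a ∈ A, ∀ w, ¬ G.Adj a w) {p : Ideal (MvPolynomial (V ⊕ V) K)}
    (hp : p ∈ (binomialEdgeIdeal K G ⊔ varIdeal K (vert ↑A)).minimalPrimes) :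
    p.height ≤ (rk K G + 2 * A.card : ℕ) := by
  refine SeparatesNbrs.induction (P := fun G ↦ ∀ A : Finset V, (∀ a ∈ A, ∀ w, ¬ G.Adj a w) →
    p ∈ (binomialEdgeIdeal K G ⊔ varIdeal K (vert ↑A)).minimalPrimes →
    p.height ≤ (rk K G + 2 * A.card : ℕ)) (fun G h A hA hp ↦ h.height_le hA hp)
    (fun G v a b hG ha hb hab h h1 h2 _ A hA hp ↦ ?_) hG A hA hp
  have hvA : v ∉ A := fun hv ↦ hA v hv a ha
  have hJ : binomialEdgeIdeal K G ≤ p := le_sup_left.trans hp.1.2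
  have hX : varIdeal K (vert ↑A) ≤ p := le_sup_right.trans hp.1.2
  obtain hv | hv := hp.1.1.mul_le.1 ((varIdeal_mul_complNbhd_le v).trans hJ)
  · have r2 := rk_del_add_two_le (K := K) ha hb (hG ha hb hab h)
    have hsup : varIdeal K (vert ↑(insert v A)) =
        varIdeal K (vert ↑A) ⊔ varIdeal K (vert {v}) := by
      rw [varIdeal, varIdeal, varIdeal, ← Ideal.span_union, ← Set.image_union]
      congr 2
      ext z
      simp [vert, or_comm]
    refine (h2 (insert v A) ?_ (mem_minimalPrimes_of_le hp ?_ ?_)).trans (Nat.cast_le.2 ?_)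
    · intro u hu w huw
      obtain rfl | hu := Finset.mem_insert.1 hu
      · exact huw.2.1 rfl
      · exact hA u hu w huw.1
    · rw [hsup, sup_left_comm, ← binomialEdgeIdeal_sup_varIdeal, sup_left_comm, ← sup_assoc]
      exact le_sup_left
    · rw [hsup]
      exact sup_le ((binomialEdgeIdeal_mono (del_le _ _)).trans hJ) (sup_le hX hv)
    · rw [Finset.card_insert_of_notMem hvA]
      omega
  · refine (h1 A ?_ (mem_minimalPrimes_of_le hp (sup_le_sup_right
      (binomialEdgeIdeal_mono (le_complNbhd G v)) _) (sup_le hv hX))).trans (Nat.cast_le.2 ?_)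
    · rintro u hu w ⟨-, huw | ⟨huv, -⟩⟩
      · exact hA u hu w huw
      · exact hA u hu v huv.symm
    · exact Nat.add_le_add_right (rk_complNbhd_le G v) _

end HeightUpperBound

section HeightLowerBound

open MvPolynomial

variable {V K : Type} [Field K]

/-- The substitution `y_i ↦ x_i * y_{σ i}`. -/
noncomputable def colorHom (K : Type) [Field K] (σ : V → V) :
    MvPolynomial (V ⊕ V) K →ₐ[K] MvPolynomial (V ⊕ V) K :=
  aeval (Sum.elim (fun i ↦ X (Sum.inl i)) fun i ↦ X (Sum.inl i) * X (Sum.inr (σ i)))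

lemma colorHom_minor (σ : V → V) (a b : V) : colorHom K σ (minor K a b) =
    X (Sum.inl a) * X (Sum.inl b) * (X (Sum.inr (σ b)) - X (Sum.inr (σ a))) := by
  simp only [colorHom, minor, map_sub, map_mul, aeval_X, Sum.elim_inl, Sum.elim_inr]
  ring

/-- The kernel of `colorHom`, a prime ideal generated by the minors `x_i y_j - x_j y_i`
with `σ i = σ j`. -/
noncomputable def colorPrime (K : Type) [Field K] (σ : V → V) :
    PrimeSpectrum (MvPolynomial (V ⊕ V) K) :=
  ⟨RingHom.ker (colorHom K σ), RingHom.ker_isPrime _⟩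

lemma colorPrime_le_comp (σ τ : V → V) : colorPrime K σ ≤ colorPrime K (τ ∘ σ) := by
  have h : colorHom K (τ ∘ σ) =
      (aeval (Sum.elim (fun i ↦ X (Sum.inl i)) fun i ↦ X (Sum.inr (τ i)))).comp (colorHom K σ) := by
    ext (i | i) <;> simp [colorHom]
  intro f (hf : colorHom K σ f = 0)
  change colorHom K (τ ∘ σ) f = 0
  rw [h, AlgHom.comp_apply, hf, map_zero]

lemma minor_mem_colorPrime {σ : V → V} {a b : V} :
    minor K a b ∈ (colorPrime K σ).asIdeal ↔ σ a = σ b := by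
  change colorHom K σ _ = 0 ↔ _
  rw [colorHom_minor, mul_eq_zero, or_iff_right (mul_ne_zero (X_ne_zero _) (X_ne_zero _)),
    sub_eq_zero, (X_injective (R := K)).eq_iff, Sum.inr_injective.eq_iff, eq_comm]

lemma minor_mem_of_reachable {G : SimpleGraph V} {q : Ideal (MvPolynomial (V ⊕ V) K)}
    (hq : q.IsPrime) (hG : binomialEdgeIdeal K G ≤ q) (hx : ∀ v, X (Sum.inl v) ∉ q) {a b : V}
    (h : G.Reachable a b) : minor K a b ∈ q := by
  obtain ⟨p⟩ := h
  induction p with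
  | nil => simp [minor]
  | @cons u v w h p ih =>
    have hm : X (Sum.inl v) * minor K u w =
        X (Sum.inl u) * minor K v w + X (Sum.inl w) * minor K u v := by
      simp only [minor]
      ring
    exact (hq.mem_or_mem (hm ▸ add_mem (q.mul_mem_left _ ih)
      (q.mul_mem_left _ (hG (minor_mem h))))).resolve_left (hx v)

lemma colorPrime_const_mem_minimalPrimes {G : SimpleGraph V} (hG : G.Connected) (r : V) :
    (colorPrime K fun _ ↦ r).asIdeal ∈ (binomialEdgeIdeal K G).minimalPrimes := by
  refine ⟨⟨(colorPrime K fun _ ↦ r).isPrime, binomialEdgeIdeal_le fun a b _ ↦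
    minor_mem_colorPrime.2 rfl⟩, fun q ⟨hq, hJ⟩ hqp ↦ ?_⟩
  have hx (v : V) : X (Sum.inl v) ∉ q := fun h ↦ by
    have : colorHom K (fun _ ↦ r) (X (Sum.inl v)) = 0 := hqp h
    simp [colorHom] at this
  let F := FractionRing (MvPolynomial (V ⊕ V) K ⧸ q)
  let π : MvPolynomial (V ⊕ V) K →ₐ[K] F :=
    (IsScalarTower.toAlgHom K _ F).comp (Ideal.Quotient.mkₐ K q)
  have hπ (f) : π f = 0 ↔ f ∈ q := by
    change algebraMap _ F (Ideal.Quotient.mk q f) = 0 ↔ _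
    rw [FaithfulSMul.algebraMap_eq_zero_iff, Ideal.Quotient.eq_zero_iff_mem]
  have hr : π (X (Sum.inl r)) ≠ 0 := fun h ↦ hx r ((hπ _).1 h)
  have hcomp : π = (aeval (Sum.elim (fun i ↦ π (X (Sum.inl i)))
      fun _ ↦ π (X (Sum.inr r)) / π (X (Sum.inl r)))).comp (colorHom K fun _ ↦ r) := by
    ext (i | i)
    · simp [colorHom]
    · have h := (hπ _).2 (minor_mem_of_reachable hq hJ hx (hG.preconnected r i))
      simp only [minor, map_sub, map_mul] at h
      simp only [colorHom, AlgHom.comp_apply, aeval_X, Sum.elim_inr, Sum.elim_inl, map_mul]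
      rw [← mul_div_assoc, eq_div_iff hr]
      linear_combination h
  intro f (hf : colorHom K (fun _ ↦ r) f = 0)
  rw [← hπ, hcomp, AlgHom.comp_apply, hf, map_zero]

lemma le_height_colorPrime {m k : ℕ} (hk : k ≤ m) :
    k ≤ Order.height (colorPrime K fun i : Fin (m + 1) ↦ if i.1 ≤ k then 0 else i) := by
  induction k with
  | zero => simp
  | succ k ih =>
    refine le_trans ?_ (Order.height_add_one_le (lt_of_le_of_ne
      (a := colorPrime K fun i : Fin (m + 1) ↦ if i.1 ≤ k then 0 else i) ?_ fun h ↦ ?_))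
    · push_cast
      gcongr
      exact ih (by omega)
    · convert! colorPrime_le_comp (K := K) (fun i : Fin (m + 1) ↦ if i.1 ≤ k then 0 else i)
        (fun i ↦ if i.1 ≤ k + 1 then 0 else i) using 2
      ext i
      by_cases h : i.1 ≤ k
      · simp [h, h.trans (Nat.le_succ k)]
      · simp [h]
    · have hmem : minor K (0 : Fin (m + 1)) ⟨k + 1, by omega⟩ ∈ (colorPrime K
          fun i : Fin (m + 1) ↦ if i.1 ≤ k + 1 then 0 else i).asIdeal :=
        minor_mem_colorPrime.2 (by simp)
      rw [← h, minor_mem_colorPrime] at hmem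
      simp [Fin.ext_iff] at hmem

lemma le_bigHeight {m : ℕ} {G : SimpleGraph (Fin (m + 1))} (hG : G.Connected) :
    m ≤ bigHeight (binomialEdgeIdeal K G) := by
  have h := le_height_colorPrime (K := K) (le_refl m)
  have hc : (fun i : Fin (m + 1) ↦ if i.1 ≤ m then 0 else i) = fun _ ↦ 0 := by
    funext i
    simp [Nat.lt_succ_iff.1 i.2]
  rw [hc] at h
  exact h.trans (le_sSup ⟨_, colorPrime_const_mem_minimalPrimes hG 0, rfl⟩)

end HeightLowerBound

section ExtComparison

open CategoryTheory Limits

variable {R : Type} [CommRing R]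

/-- The two constructions of `Ext` groups vanish simultaneously in positive degrees. -/
lemma subsingleton_ext_iff (M N : ModuleCat R) (p : ℕ) :
    Subsingleton (((Ext R (ModuleCat R) (p + 1)).obj (Opposite.op M)).obj N) ↔
      ∀ e : Abelian.Ext M N (p + 1), e = 0 := by
  let P := ProjectiveResolution.of M
  trans ∀ f : P.complex.X (p + 1) ⟶ N, P.complex.d (p + 2) (p + 1) ≫ f = 0 →
    ∃ g : P.complex.X p ⟶ N, P.complex.d (p + 1) p ≫ g = f
  · rw [← ModuleCat.isZero_iff_subsingleton, (P.isoExt (p + 1) N).isZero_iff,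
      ← HomologicalComplex.exactAt_iff_isZero_homology,
      HomologicalComplex.exactAt_iff' _ p (p + 1) (p + 2) (by simp) (by simp),
      ShortComplex.moduleCat_exact_iff]
    rfl
  · refine ⟨fun h e ↦ ?_, fun h f hf ↦ ?_⟩
    · obtain ⟨f, hf, rfl⟩ := P.extMk_surjective e (p + 2) rfl
      exact (P.extMk_eq_zero_iff f (p + 2) rfl hf p rfl).2 (h f hf)
    · exact (P.extMk_eq_zero_iff f (p + 2) rfl hf p rfl).1 (h _)

end ExtComparison

section Grade

open CategoryTheory Abelian

variable {R : Type} [CommRing R] {M N N' : Type} [AddCommGroup M] [AddCommGroup N]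
  [AddCommGroup N'] [Module R M] [Module R N] [Module R N']

/-- `m` is the least degree in which `Ext (M, N)` is nonzero. -/
def HasGrade (R M N : Type) [CommRing R] [AddCommGroup M] [AddCommGroup N] [Module R M]
    [Module R N] (m : ℕ) : Prop :=
  (∀ i < m, ∀ e : Ext (ModuleCat.of R M) (ModuleCat.of R N) i, e = 0) ∧
    ∃ e : Ext (ModuleCat.of R M) (ModuleCat.of R N) m, e ≠ 0

lemma comp_lsmul_eq_zero {h : R} (hM : ∀ x : M, h • x = 0) {i : ℕ}
    (e : Ext (ModuleCat.of R M) (ModuleCat.of R N) i) :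
    e.comp (Ext.mk₀ (ModuleCat.ofHom (LinearMap.lsmul R N h))) (add_zero i) = 0 := by
  have h1 : ModuleCat.ofHom (LinearMap.lsmul R N h) = h • 𝟙 (ModuleCat.of R N) := rfl
  have h2 : h • 𝟙 (ModuleCat.of R M) = 0 := by
    ext x
    exact hM x
  rw [h1, ← Ext.smul_eq_comp_mk₀, ← Ext.mk₀_id_comp e, ← Ext.smul_comp, ← Ext.mk₀_smul, h2,
    Ext.mk₀_zero, Ext.zero_comp]

lemma HasGrade.succ {m : ℕ} (hm : HasGrade R M N' m) {h : R} (hM : ∀ x : M, h • x = 0)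
    (hN : ∀ y : N, h • y = 0 → y = 0) {φ : N →ₗ[R] N'} (hφ : Function.Surjective φ)
    (hφ0 : ∀ y, φ y = 0 ↔ ∃ z, h • z = y) : HasGrade R M N (m + 1) := by
  have hS := shortExact_of_linearMap (f := LinearMap.lsmul R N h) (g := φ)
    ((injective_iff_map_eq_zero _).2 hN) hφ0 hφ
  have := hS.mono_f
  have hvan (i : ℕ) (hi : i < m + 1) (e : Ext (ModuleCat.of R M) (ModuleCat.of R N) i) :
      e = 0 := by
    have he := comp_lsmul_eq_zero hM e
    cases i with
    | zero =>
      refine Ext.postcomp_mk₀_injective_of_mono _ (ModuleCat.ofHom (LinearMap.lsmul R N h))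
        (hf := this) ?_
      rw [map_zero]
      exact he
    | succ i =>
      obtain ⟨x, rfl⟩ := Ext.covariant_sequence_exact₁ _ hS e he rfl
      rw [hm.1 i (by omega) x, Ext.zero_comp]
  refine ⟨hvan, ?_⟩
  obtain ⟨e, he⟩ := hm.2
  refine ⟨e.comp hS.extClass rfl, fun h0 ↦ he ?_⟩
  obtain ⟨x, rfl⟩ := Ext.covariant_sequence_exact₃ _ hS e rfl h0
  rw [hvan m (Nat.lt_succ_self m) x, Ext.zero_comp]

end Grade

section ColorModule

open MvPolynomial CategoryTheory

variable {V K : Type} [Field K] {m : ℕ}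

/-- The substitution `x_i ↦ 1`, `y_i ↦ t_{σ i}`. -/
noncomputable def colorEval (K : Type) [Field K] (σ : V → Fin (m + 1)) :
    MvPolynomial (V ⊕ V) K →ₐ[K] MvPolynomial (Fin (m + 1)) K :=
  aeval (Sum.elim (fun _ ↦ 1) fun i ↦ X (σ i))

lemma colorEval_minor (σ : V → Fin (m + 1)) (a b : V) :
    colorEval K σ (minor K a b) = X (σ b) - X (σ a) := by
  simp [colorEval, minor]

/-- The polynomial ring in `t_0, …, t_m`, as a module through `colorEval`. -/
def ColorModule (K : Type) [Field K] (_ : V → Fin (m + 1)) : Type :=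
  MvPolynomial (Fin (m + 1)) K

noncomputable instance (σ : V → Fin (m + 1)) : AddCommGroup (ColorModule K σ) :=
  inferInstanceAs (AddCommGroup (MvPolynomial (Fin (m + 1)) K))

noncomputable instance (σ : V → Fin (m + 1)) :
    Module (MvPolynomial (V ⊕ V) K) (ColorModule K σ) :=
  Module.compHom (MvPolynomial (Fin (m + 1)) K) (colorEval K σ).toRingHom

/-- The surjection identifying `0` and `1`. -/
def collapse : Fin (m + 2) → Fin (m + 1) := Fin.cases 0 id

@[simp] lemma collapse_zero : collapse (0 : Fin (m + 2)) = 0 := rfl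

@[simp] lemma collapse_succ (i : Fin (m + 1)) : collapse i.succ = i := rfl

lemma rename_collapse_colorEval (σ : V → Fin (m + 2)) (f : MvPolynomial (V ⊕ V) K) :
    rename collapse (colorEval K σ f) = colorEval K (collapse ∘ σ) f := by
  have h : (rename (R := K) collapse).comp (colorEval K σ) = colorEval K (collapse ∘ σ) := by
    ext (i | i) <;> simp [colorEval]
  exact DFunLike.congr_fun h f

/-- Setting `t_0 = t_1`. -/
noncomputable def collapseMap (K : Type) [Field K] (σ : V → Fin (m + 2)) :
    ColorModule K σ →ₗ[MvPolynomial (V ⊕ V) K] ColorModule K (collapse ∘ σ) where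
  toFun g := rename collapse (show MvPolynomial (Fin (m + 2)) K from g)
  map_add' f g := (rename (R := K) (collapse (m := m))).map_add f g
  map_smul' f g := ((rename (R := K) (collapse (m := m))).map_mul (colorEval K σ f) g).trans
    (congrArg (· * _) (rename_collapse_colorEval σ f))

lemma rename_succ_collapse (f : MvPolynomial (Fin (m + 1)) K) :
    rename collapse (rename Fin.succ f) = f := by
  rw [rename_rename]
  exact rename_id_apply f

lemma rename_collapse_eq_zero_iff (f : MvPolynomial (Fin (m + 2)) K) :
    rename collapse f = 0 ↔
      (X 0 - X 1 : MvPolynomial (Fin (m + 2)) K) ∣ f := by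
  constructor
  · intro hf
    let I : Ideal (MvPolynomial (Fin (m + 2)) K) := Ideal.span {X 0 - X 1}
    have h : ((Ideal.Quotient.mkₐ K I).comp (rename Fin.succ)).comp
        (rename collapse) = Ideal.Quotient.mkₐ K I := by
      ext i
      refine Fin.cases ?_ (fun i ↦ ?_) i
      · have : Ideal.Quotient.mk I (X 1) = Ideal.Quotient.mk I (X 0) := by
          rw [eq_comm, Ideal.Quotient.eq]
          exact Ideal.mem_span_singleton_self _
        simpa using this
      · simp
    rw [← Ideal.mem_span_singleton, ← Ideal.Quotient.eq_zero_iff_mem]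
    have h' := DFunLike.congr_fun h f
    rw [AlgHom.comp_apply, hf, map_zero] at h'
    exact h'.symm
  · rintro ⟨g, rfl⟩
    rw [map_mul, map_sub, rename_X, rename_X, ← Fin.succ_zero_eq_one, collapse_succ, collapse_zero,
      sub_self, zero_mul]

lemma exists_colorEval_eq {G : SimpleGraph V} (σ : V → Fin (m + 1)) {a b : V}
    (h : G.Reachable a b) :
    ∃ f ∈ binomialEdgeIdeal K G, colorEval K σ f = X (σ b) - X (σ a) := by
  obtain ⟨p⟩ := h
  induction p with
  | nil => exact ⟨0, zero_mem _, by simp⟩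
  | @cons u v w h p ih =>
    obtain ⟨f, hf, hfe⟩ := ih
    refine ⟨f + minor K u v, add_mem hf (minor_mem h), ?_⟩
    rw [map_add, hfe, colorEval_minor]
    ring

lemma hasGrade_zero (G : SimpleGraph V) (σ : V → Fin 1) :
    HasGrade (MvPolynomial (V ⊕ V) K) (MvPolynomial (V ⊕ V) K ⧸ binomialEdgeIdeal K G)
      (ColorModule K σ) 0 := by
  refine ⟨fun i hi ↦ absurd hi (Nat.not_lt_zero i), ?_⟩
  have hker : binomialEdgeIdeal K G ≤ LinearMap.ker (LinearMap.toSpanSingleton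
      (MvPolynomial (V ⊕ V) K) (ColorModule K σ) (1 : MvPolynomial (Fin 1) K)) := by
    refine binomialEdgeIdeal_le fun a b _ ↦ ?_
    have : colorEval K σ (minor K a b) * 1 = 0 := by
      rw [colorEval_minor, Subsingleton.elim (σ a) (σ b), sub_self, zero_mul]
    exact this
  refine ⟨Abelian.Ext.mk₀ (ModuleCat.ofHom (Submodule.liftQ _ _ hker)), fun h ↦ ?_⟩
  rw [← Abelian.Ext.mk₀_zero, (Abelian.Ext.mk₀_bijective _ _).injective.eq_iff] at h
  have h1 : colorEval K σ 1 * 1 = 0 :=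
    congrArg (fun φ ↦ φ.hom (Ideal.Quotient.mk (binomialEdgeIdeal K G) 1)) h
  simp at h1

lemma hasGrade {G : SimpleGraph V} (hG : G.Connected) (σ : V → Fin (m + 1))
    (hσ : Function.Surjective σ) :
    HasGrade (MvPolynomial (V ⊕ V) K) (MvPolynomial (V ⊕ V) K ⧸ binomialEdgeIdeal K G)
      (ColorModule K σ) m := by
  induction m with
  | zero => exact hasGrade_zero G σ
  | succ m ih =>
    obtain ⟨a, ha⟩ := hσ 1
    obtain ⟨b, hb⟩ := hσ 0
    obtain ⟨h, hJ, hev⟩ := exists_colorEval_eq (K := K) σ (hG.preconnected a b)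
    rw [ha, hb] at hev
    refine (ih (collapse ∘ σ) (Function.Surjective.comp
      (fun i ↦ ⟨i.succ, rfl⟩) hσ)).succ (h := h) (φ := collapseMap K σ) ?_ ?_ ?_ ?_
    · intro x
      obtain ⟨x, rfl⟩ := Ideal.Quotient.mk_surjective x
      exact Ideal.Quotient.eq_zero_iff_mem.2 (Ideal.mul_mem_right _ _ hJ)
    · intro y hy
      have hy' : colorEval K σ h * (show MvPolynomial (Fin (m + 2)) K from y) = 0 := hy
      rw [hev] at hy'
      refine (mul_eq_zero.1 hy').resolve_left fun h0 ↦ ?_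
      exact Fin.zero_ne_one (X_injective (R := K) (sub_eq_zero.1 h0))
    · exact fun g ↦ ⟨rename Fin.succ g, rename_succ_collapse g⟩
    · intro y
      refine (rename_collapse_eq_zero_iff y).trans ?_
      rw [← hev]
      exact ⟨fun ⟨z, hz⟩ ↦ ⟨z, hz.symm⟩, fun ⟨z, hz⟩ ↦ ⟨z, hz.symm⟩⟩

end ColorModule

section Main

variable {K : Type} [Field K] {m : ℕ} {G : SimpleGraph (Fin (m + 1))}

lemma bigHeight_eq (hG : G.Connected) (hblock : IsBlockGraph G) :
    bigHeight (binomialEdgeIdeal K G) = m := by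
  refine le_antisymm (sSup_le ?_) (le_bigHeight hG)
  rintro _ ⟨p, hp, rfl⟩
  have h0 : binomialEdgeIdeal K G ⊔ varIdeal K (vert ↑(∅ : Finset (Fin (m + 1)))) =
      binomialEdgeIdeal K G := by simp [varIdeal, vert]
  have h := (separatesNbrs_of_isBlockGraph hblock).height_le (K := K) (A := ∅) (by simp)
    (p := p.asIdeal) (h0.symm ▸ hp)
  rw [PrimeSpectrum.height_eq_orderHeight] at h
  refine le_trans h (Nat.cast_le.2 ?_)
  simpa using rk_le_card_sub_one (K := K) G

lemma projDim_eq (hG : G.Connected) (hblock : IsBlockGraph G) :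
    projDim (MvPolynomial (Fin (m + 1) ⊕ Fin (m + 1)) K)
      (ModuleCat.of _ (MvPolynomial (Fin (m + 1) ⊕ Fin (m + 1)) K ⧸ binomialEdgeIdeal K G)) =
      m := by
  refine le_antisymm (sInf_le fun N k hk ↦ ?_) (le_sInf fun d hd ↦ ?_)
  · obtain _ | p := k
    · simp at hk
    have hrk := rk_le_card_sub_one (K := K) G
    have h : PdLT (binomialEdgeIdeal K G) (m + 1) :=
      (separatesNbrs_of_isBlockGraph hblock).pdLT.mono (by simpa using hrk)
    have hp : m < p + 1 := Nat.cast_lt.1 hk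
    have : CategoryTheory.HasProjectiveDimensionLT (ModuleCat.of _
      (MvPolynomial (Fin (m + 1) ⊕ Fin (m + 1)) K ⧸ binomialEdgeIdeal K G)) (m + 1) := h
    exact (subsingleton_ext_iff _ N p).2 fun e ↦
      e.eq_zero_of_hasProjectiveDimensionLT (m + 1) (by omega)
  · by_contra hlt
    obtain ⟨e, he⟩ := (hasGrade (K := K) hG id Function.surjective_id).2
    obtain _ | p := m
    · simp at hlt
    exact he ((subsingleton_ext_iff _ _ p).1 (hd _ (p + 1) (not_le.1 hlt)) e)

end Main

end BlockGraph

theorem blockGraph_pd_eq_bigHeight (n : ℕ) (K : Type) [Field K]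
    (G : SimpleGraph (Fin n)) (hconn : G.Connected) (hblock : IsBlockGraph G) :
    projDim (MvPolynomial (Fin n ⊕ Fin n) K)
        (ModuleCat.of _ (MvPolynomial (Fin n ⊕ Fin n) K ⧸ binomialEdgeIdeal K G))
      = bigHeight (binomialEdgeIdeal K G) ∧
    bigHeight (binomialEdgeIdeal K G) = ((n - 1 : ℕ) : ℕ∞) := by
  obtain _ | m := n
  · exact hconn.nonempty.elim fun v ↦ v.elim0
  · exact ⟨(BlockGraph.projDim_eq hconn hblock).trans (BlockGraph.bigHeight_eq hconn hblock).symm,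
      BlockGraph.bigHeight_eq hconn hblock⟩
end

section
/- Let G = C_n be the cycle on n ≥ 4 vertices and J_G its binomial edge ideal in S = K[x_1,...,x_n,y_1,...,y_n]. Then pd(S/J_G) = bigheight(J_G) = n. -/
open SimpleGraph

section PolynomialExtension

open CategoryTheory Polynomial TensorProduct

/-- Additive induction on `R[X] ⊗ M` from the tensors `X ^ i ⊗ m`. -/
lemma polyTensor_induction {R M : Type} [CommRing R] [AddCommGroup M] [Module R M]
    {p : R[X] ⊗[R] M → Prop} (h : ∀ i m, p ((X ^ i : R[X]) ⊗ₜ m))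
    (h0 : p 0) (hadd : ∀ a b, p a → p b → p (a + b)) (z) : p z := by
  induction z with
  | zero => exact h0
  | add a b ha hb => exact hadd a b ha hb
  | tmul q m =>
    induction q using Polynomial.induction_on' with
    | add q r hq hr => rw [TensorProduct.add_tmul]; exact hadd _ _ hq hr
    | monomial i a =>
      rw [← mul_one a, ← smul_eq_mul, ← Polynomial.smul_monomial, TensorProduct.smul_tmul,
        Polynomial.monomial_one_right_eq_X_pow]
      exact h i _

variable (R M : Type) [CommRing R] [AddCommGroup M] [Module R M] [Module R[X] M]
  [IsScalarTower R R[X] M]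

/-- Multiplication by the variable on a module over a polynomial ring, as a linear map over the
coefficients. -/
noncomputable def polyMulX : M →ₗ[R] M :=
  (LinearMap.lsmul R[X] M X).restrictScalars R

/-- The map `p ⊗ m ↦ X p ⊗ m - p ⊗ X m`. -/
noncomputable def charMap : R[X] ⊗[R] M →ₗ[R[X]] R[X] ⊗[R] M :=
  LinearMap.lsmul R[X] (R[X] ⊗[R] M) X - (polyMulX R M).baseChange R[X]

/-- The action map `p ⊗ m ↦ p • m`. -/
noncomputable def actMap : R[X] ⊗[R] M →ₗ[R[X]] M :=
  LinearMap.liftBaseChange R[X] (LinearMap.id : M →ₗ[R] M)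

/-- A contracting homotopy for the characteristic sequence. -/
noncomputable def charHomotopy : R[X] ⊗[R] M →ₗ[R] R[X] ⊗[R] M :=
  TensorProduct.lift ((Polynomial.basisMonomials R).constr R fun i =>
    ∑ j ∈ Finset.range i, (TensorProduct.mk R R[X] M (X ^ (i - 1 - j))) ∘ₗ (polyMulX R M ^ j))

variable {R M}

@[simp] lemma polyMulX_apply (m : M) : polyMulX R M m = (X : R[X]) • m := rfl

lemma polyMulX_pow_apply (j : ℕ) (m : M) : (polyMulX R M ^ j) m = (X ^ j : R[X]) • m := by
  induction j with
  | zero => simp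
  | succ j ih => rw [pow_succ', Module.End.mul_apply, ih, polyMulX_apply, smul_smul, pow_succ']

@[simp] lemma actMap_tmul (p : R[X]) (m : M) : actMap R M (p ⊗ₜ m) = p • m := by
  simp [actMap]

lemma charMap_apply (z : R[X] ⊗[R] M) :
    charMap R M z = (X : R[X]) • z - (polyMulX R M).baseChange R[X] z := rfl

lemma charHomotopy_X_pow_tmul (i : ℕ) (m : M) :
    charHomotopy R M ((X ^ i : R[X]) ⊗ₜ m) =
      ∑ j ∈ Finset.range i, (X ^ (i - 1 - j) : R[X]) ⊗ₜ[R] ((X ^ j : R[X]) • m) := by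
  have h := (Polynomial.basisMonomials R).constr_basis R (fun i =>
    ∑ j ∈ Finset.range i, (TensorProduct.mk R R[X] M (X ^ (i - 1 - j))) ∘ₗ (polyMulX R M ^ j)) i
  rw [charHomotopy, TensorProduct.lift.tmul, ← Polynomial.monomial_one_right_eq_X_pow]
  rw [Polynomial.coe_basisMonomials] at h
  rw [h]
  simp [LinearMap.sum_apply, polyMulX_pow_apply]

lemma charHomotopy_X_smul (z : R[X] ⊗[R] M) :
    charHomotopy R M ((X : R[X]) • z) =
      (X : R[X]) • charHomotopy R M z + (1 : R[X]) ⊗ₜ actMap R M z := by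
  induction z using polyTensor_induction with
  | h0 => simp
  | hadd a b ha hb => simp only [smul_add, map_add, ha, hb, TensorProduct.tmul_add]; abel
  | h i m =>
    rw [TensorProduct.smul_tmul', smul_eq_mul, ← pow_succ', charHomotopy_X_pow_tmul,
      charHomotopy_X_pow_tmul, Finset.sum_range_succ, Finset.smul_sum]
    congr 1
    · refine Finset.sum_congr rfl fun j hj => ?_
      rw [TensorProduct.smul_tmul', smul_eq_mul, ← pow_succ']
      congr 2
      have := Finset.mem_range.1 hj
      lia
    · simp

lemma charHomotopy_baseChange (z : R[X] ⊗[R] M) :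
    charHomotopy R M ((polyMulX R M).baseChange R[X] z) =
      (polyMulX R M).baseChange R[X] (charHomotopy R M z) := by
  induction z using polyTensor_induction with
  | h0 => simp
  | hadd a b ha hb => simp only [map_add, ha, hb]
  | h i m =>
    rw [LinearMap.baseChange_tmul, charHomotopy_X_pow_tmul, charHomotopy_X_pow_tmul, map_sum]
    refine Finset.sum_congr rfl fun j _ => ?_
    simp [smul_smul, mul_comm]

lemma charMap_charHomotopy (z : R[X] ⊗[R] M) :
    charMap R M (charHomotopy R M z) = z - (1 : R[X]) ⊗ₜ actMap R M z := by
  induction z using polyTensor_induction with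
  | h0 => simp
  | hadd a b ha hb => simp only [map_add, ha, hb, TensorProduct.tmul_add]; abel
  | h i m =>
    induction i with
    | zero => simp [show (1 : R[X]) ⊗ₜ[R] m = (X ^ 0 : R[X]) ⊗ₜ m by simp,
        charHomotopy_X_pow_tmul, -pow_zero]
    | succ i ih =>
      have : (X ^ (i + 1) : R[X]) ⊗ₜ[R] m = (X : R[X]) • ((X ^ i : R[X]) ⊗ₜ[R] m) := by
        rw [TensorProduct.smul_tmul', smul_eq_mul, ← pow_succ']
      rw [this, charHomotopy_X_smul, map_add, map_smul, ih, map_smul, charMap_apply]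
      simp [smul_sub, TensorProduct.smul_tmul']

lemma charHomotopy_charMap (z : R[X] ⊗[R] M) : charHomotopy R M (charMap R M z) = z := by
  have h := charMap_charHomotopy z
  rw [charMap_apply] at h
  rw [charMap_apply, map_sub, charHomotopy_X_smul, charHomotopy_baseChange, add_sub_right_comm, h]
  abel

lemma actMap_charMap (z : R[X] ⊗[R] M) : actMap R M (charMap R M z) = 0 := by
  rw [charMap_apply]
  induction z with
  | zero => simp
  | add a b ha hb => rw [smul_add, map_add, add_sub_add_comm, map_add, ha, hb, add_zero]
  | tmul p m => simp [smul_smul, mul_comm]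

variable (R M) in
/-- A module over `R[X]` which is projective over `R` has projective dimension at most one. -/
theorem hasProjectiveDimensionLE_one_of_polynomial [Module.Projective R M] :
    HasProjectiveDimensionLE (ModuleCat.of R[X] M) 1 := by
  have hex : Function.Exact (charMap R M) (actMap R M) := by
    intro z
    refine ⟨fun hz => ⟨charHomotopy R M z, ?_⟩, ?_⟩
    · rw [charMap_charHomotopy, hz, TensorProduct.tmul_zero, sub_zero]
    · rintro ⟨w, rfl⟩
      exact actMap_charMap w
  have hS := ModuleCat.shortComplex_shortExact (ModuleCat.shortComplexOfCompEqZero _ _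
    hex.linearMap_comp_eq_zero) hex (Function.LeftInverse.injective charHomotopy_charMap)
    (fun m => ⟨(1 : R[X]) ⊗ₜ m, (actMap_tmul _ _).trans (one_smul _ _)⟩)
  have hp : Projective (ModuleCat.of R[X] (R[X] ⊗[R] M)) :=
    (IsProjective.iff_projective _).1 inferInstance
  have h1 : HasProjectiveDimensionLT (ModuleCat.of R[X] (R[X] ⊗[R] M)) 1 :=
    projective_iff_hasProjectiveDimensionLT_one.1 hp
  exact (hS.hasProjectiveDimensionLT_X₃_iff 0 hp).2 h1

end PolynomialExtension

section PolynomialDimension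

open CategoryTheory Polynomial

/-- Passing to a polynomial ring raises the projective dimension by at most one. -/
theorem hasProjectiveDimensionLE_succ_of_polynomial {R M : Type} [CommRing R] [AddCommGroup M]
    [Module R M] [Module R[X] M] [IsScalarTower R R[X] M] (k : ℕ)
    (h : HasProjectiveDimensionLE (ModuleCat.of R M) k) :
    HasProjectiveDimensionLE (ModuleCat.of R[X] M) (k + 1) := by
  induction k generalizing M with
  | zero =>
    have : Module.Projective R M :=
      (IsProjective.iff_projective _).2 (projective_iff_hasProjectiveDimensionLT_one.2 h)
    exact hasProjectiveDimensionLE_one_of_polynomial R M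
  | succ k ih =>
    let f : (M →₀ R[X]) →ₗ[R[X]] M := Finsupp.linearCombination R[X] id
    have hf : Function.Surjective f := Finsupp.linearCombination_id_surjective R[X] M
    have hS := LinearMap.shortExact_shortComplexKer hf
    let g : (M →₀ R[X]) →ₗ[R] M := f.restrictScalars R
    have hT := LinearMap.shortExact_shortComplexKer (f := g) hf
    have hF : Projective (ModuleCat.of R[X] (M →₀ R[X])) :=
      (IsProjective.iff_projective _).1 inferInstance
    have hG : Projective (ModuleCat.of R (M →₀ R[X])) :=
      (IsProjective.iff_projective _).1 inferInstance
    have hg : HasProjectiveDimensionLE (ModuleCat.of R g.ker) k :=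
      (hT.hasProjectiveDimensionLT_X₃_iff k hG).1 h
    have hf' : HasProjectiveDimensionLE (ModuleCat.of R f.ker) k :=
      ModuleCat.hasProjectiveDimensionLE_of_linearEquiv (M := ModuleCat.of R g.ker)
        (N := ModuleCat.of R f.ker) (LinearEquiv.refl R g.ker) k
    exact (hS.hasProjectiveDimensionLT_X₃_iff (k + 1) hF).2 (ih hf')

/-- The projective dimension over a polynomial ring in `m` variables of a module which is
projective over the coefficients is at most `m`. -/
theorem hasProjectiveDimensionLE_of_algEquiv_mvPolynomial {A : Type} [CommRing A] (m : ℕ)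
    {P M : Type} [CommRing P] [Algebra A P] (e : MvPolynomial (Fin m) A ≃ₐ[A] P)
    [AddCommGroup M] [Module A M] [Module P M] [IsScalarTower A P M] [Module.Projective A M] :
    HasProjectiveDimensionLE (ModuleCat.of P M) m := by
  induction m generalizing P M with
  | zero =>
    let e' : A ≃+* P := ((MvPolynomial.isEmptyAlgEquiv A (Fin 0)).symm.trans e).toRingEquiv
    have he' (a : A) : e' a = algebraMap A P a := e.commutes a
    have := RingHomInvPair.of_ringEquiv e'
    have := RingHomInvPair.of_ringEquiv e'.symm
    let l : M ≃ₛₗ[RingHomClass.toRingHom e'] M :=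
      { AddEquiv.refl M with
        map_smul' := fun a x => by
          change a • x = e' a • x
          rw [he', algebraMap_smul] }
    have : HasProjectiveDimensionLE (ModuleCat.of A M) 0 :=
      projective_iff_hasProjectiveDimensionLT_one.1 ((IsProjective.iff_projective _).1 inferInstance)
    exact ModuleCat.hasProjectiveDimensionLE_of_semiLinearEquiv (M := ModuleCat.of A M)
      (N := ModuleCat.of P M) e' l 0
  | succ m ih =>
    let e' : (MvPolynomial (Fin m) A)[X] ≃+* P :=
      ((MvPolynomial.finSuccEquiv A m).symm.trans e).toRingEquiv
    let := Module.compHom M (e' : (MvPolynomial (Fin m) A)[X] →+* P)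
    let := Module.compHom M ((e' : (MvPolynomial (Fin m) A)[X] →+* P).comp C)
    have : IsScalarTower (MvPolynomial (Fin m) A) (MvPolynomial (Fin m) A)[X] M :=
      ⟨fun a b x => by
        change e' (a • b) • x = e' (C a) • e' b • x
        rw [smul_smul, ← map_mul, C_mul']⟩
    have : IsScalarTower A (MvPolynomial (Fin m) A) M :=
      ⟨fun a b x => by
        change e' (C (a • b)) • x = a • e' (C b) • x
        rw [← smul_assoc]
        congr 1
        change e ((MvPolynomial.finSuccEquiv A m).symm (C (a • b))) =
          a • e ((MvPolynomial.finSuccEquiv A m).symm (C b))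
        rw [← map_smul, ← map_smul, smul_C]⟩
    have h := hasProjectiveDimensionLE_succ_of_polynomial m (ih AlgEquiv.refl (M := M))
    have := RingHomInvPair.of_ringEquiv e'
    have := RingHomInvPair.of_ringEquiv e'.symm
    let l : M ≃ₛₗ[RingHomClass.toRingHom e'] M :=
      { AddEquiv.refl M with map_smul' := fun a x => rfl }
    exact ModuleCat.hasProjectiveDimensionLE_of_semiLinearEquiv
      (M := ModuleCat.of (MvPolynomial (Fin m) A)[X] M)
      (N := ModuleCat.of P M) e' l (m + 1)

end PolynomialDimension

section OldExt

open CategoryTheory Limits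

/-- In positive degrees, the two versions of `Ext` for modules vanish simultaneously. -/
theorem subsingleton_extFunctor_iff {R : Type} [CommRing R] (X Y : ModuleCat.{0} R) (k : ℕ) :
    Subsingleton (((Ext R (ModuleCat R) (k + 1)).obj (Opposite.op X)).obj Y) ↔
      Subsingleton (Abelian.Ext X Y (k + 1)) := by
  let P := projectiveResolution X
  have hP (f : P.complex.X (k + 1) ⟶ Y) (hf : P.complex.d (k + 2) (k + 1) ≫ f = 0) :=
    P.extMk_eq_zero_iff f (k + 2) rfl hf k rfl
  rw [← ModuleCat.isZero_iff_subsingleton, (P.isoExt (R := R) (k + 1) Y).isZero_iff,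
    ← HomologicalComplex.exactAt_iff_isZero_homology,
    HomologicalComplex.exactAt_iff' _ k (k + 1) (k + 2) (by simp) (by simp),
    ShortComplex.moduleCat_exact_iff]
  constructor
  · intro h
    refine subsingleton_of_forall_eq 0 fun α => ?_
    obtain ⟨f, hf, rfl⟩ := P.extMk_surjective α (k + 2) rfl
    rw [hP]
    obtain ⟨g, hg⟩ := h f hf
    exact ⟨g, hg⟩
  · intro h f hf
    obtain ⟨g, hg⟩ := (hP f hf).1 (Subsingleton.elim _ _)
    exact ⟨g, hg⟩

end OldExt

section ReesShift

open CategoryTheory Abelian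

/-- The dimension shifting step in Rees' theorem: if `r` annihilates `M` and is regular on `N`,
the first nonvanishing `Ext` of `M` into `N / r N` is shifted by one when passing to `N`. -/
theorem ext_shift_of_smul_shortExact {R : Type} [CommRing R] {M N N' : ModuleCat.{0} R} {r : R}
    (hr : r ∈ Module.annihilator R M) {g : N ⟶ N'} {w : (r • 𝟙 N) ≫ g = 0}
    (hS : (ShortComplex.mk (r • 𝟙 N) g w).ShortExact) {m : ℕ}
    (h₀ : ∀ j < m, Subsingleton (Ext M N' j)) (h₁ : Nontrivial (Ext M N' m)) :
    (∀ j < m + 1, Subsingleton (Ext M N j)) ∧ Nontrivial (Ext M N (m + 1)) := by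
  have hzero (j : ℕ) (x : Ext M N j) : x.comp (Ext.mk₀ (r • 𝟙 N)) (add_zero j) = 0 := by
    have h0 : r • 𝟙 M = 0 := by
      ext y
      exact Module.mem_annihilator.1 hr y
    have hx : r • x = (Ext.mk₀ (r • 𝟙 M)).comp x (zero_add j) := by simp [Ext.mk₀_smul]
    rw [h0, Ext.mk₀_zero, Ext.zero_comp] at hx
    simpa [Ext.mk₀_smul] using hx
  have hvan : ∀ j < m + 1, Subsingleton (Ext M N j) := by
    intro j hj
    refine subsingleton_of_forall_eq 0 fun x => ?_
    obtain _ | j := j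
    · have := hS.mono_f
      refine Ext.postcomp_mk₀_injective_of_mono M (r • 𝟙 N) ?_
      simpa using hzero 0 x
    · obtain ⟨y, rfl⟩ := Ext.covariant_sequence_exact₁ M hS x (hzero _ x) rfl
      have := h₀ j (by lia)
      rw [Subsingleton.elim y 0, Ext.zero_comp]
  refine ⟨hvan, ?_⟩
  obtain ⟨x, hx⟩ := exists_ne (0 : Ext M N' m)
  refine ⟨x.comp hS.extClass rfl, 0, fun h => hx ?_⟩
  obtain ⟨y, rfl⟩ := Ext.covariant_sequence_exact₃ M hS x rfl h
  have := hvan m (by lia)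
  rw [Subsingleton.elim y 0, Ext.zero_comp]

/-- Let `N` be a polynomial ring in `m` variables, viewed as an `S`-module through a ring
homomorphism `φ`. If an ideal `J` of `S` contains elements mapping to the variables, and `J` maps to
polynomials without constant term, then `Ext^m (S ⧸ J, N)` is the first nonvanishing `Ext`. -/
theorem ext_quotient_of_mvPolynomial {S K : Type} [CommRing S] [Field K] (J : Ideal S) (m : ℕ)
    (φ : S →+* MvPolynomial (Fin m) K) (r : Fin m → S) (hr : ∀ i, r i ∈ J)
    (hφ : ∀ i, φ (r i) = MvPolynomial.X i)
    (hJ : ∀ f ∈ J, MvPolynomial.constantCoeff (φ f) = 0)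
    {N : Type} [AddCommGroup N] [Module S N] (e : N ≃+ MvPolynomial (Fin m) K)
    (he : ∀ s x, e (s • x) = φ s * e x) :
    (∀ j < m, Subsingleton (Ext (ModuleCat.of S (S ⧸ J)) (ModuleCat.of S N) j)) ∧
      Nontrivial (Ext (ModuleCat.of S (S ⧸ J)) (ModuleCat.of S N) m) := by
  induction m generalizing N with
  | zero =>
    refine ⟨by simp, ?_⟩
    let l : S →ₗ[S] N := LinearMap.toSpanSingleton S N (e.symm 1)
    have hl (s : S) : e (l s) = φ s := by simp [l, he]
    have hlJ : J ≤ LinearMap.ker l := fun s hs => by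
      rw [LinearMap.mem_ker, ← e.map_eq_zero_iff, hl, (φ s).eq_C_of_isEmpty,
        ← MvPolynomial.constantCoeff_eq, hJ s hs, map_zero]
    let l' : (S ⧸ J) →ₗ[S] N := Submodule.liftQ J l hlJ
    refine ⟨Ext.mk₀ (ModuleCat.ofHom l'), 0, fun h => ?_⟩
    have h0 : l' = 0 := congrArg ModuleCat.Hom.hom ((Ext.mk₀_eq_zero_iff _).1 h)
    have h1 : l' (Submodule.Quotient.mk (1 : S)) = 0 := by rw [h0]; rfl
    rw [Submodule.liftQ_apply, ← e.map_eq_zero_iff, hl, map_one] at h1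
    exact one_ne_zero h1
  | succ m ih =>
    let q : MvPolynomial (Fin (m + 1)) K →ₐ[K] MvPolynomial (Fin m) K :=
      MvPolynomial.aeval (Fin.cases 0 MvPolynomial.X)
    have hqc (f) : MvPolynomial.constantCoeff (q f) = MvPolynomial.constantCoeff f := by
      have : (MvPolynomial.constantCoeff.comp q.toRingHom) = MvPolynomial.constantCoeff := by
        ext i
        · simp [q]
        · refine Fin.cases ?_ (fun i => ?_) i <;> simp [q]
      exact congrArg (fun h => h f) this
    have hqpoly (f) : q f = Polynomial.eval 0 (MvPolynomial.finSuccEquiv K m f) := by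
      have : q = ((Polynomial.aeval (0 : MvPolynomial (Fin m) K)).restrictScalars K).comp
          (MvPolynomial.finSuccEquiv K m).toAlgHom := by
        ext i : 1
        refine Fin.cases ?_ (fun i => ?_) i
        · simp [q, MvPolynomial.finSuccEquiv_X_zero]
        · simp [q, MvPolynomial.finSuccEquiv_X_succ]
      exact congrArg (fun h => h f) this
    let _ : Module S (MvPolynomial (Fin m) K) := Module.compHom _ (q.toRingHom.comp φ)
    obtain ⟨h₀, h₁⟩ := ih (q.toRingHom.comp φ) (fun i => r i.succ) (fun i => hr _)
      (fun i => by simp [hφ, q]) (fun f hf => by simpa [hqc] using hJ f hf)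
      (N := MvPolynomial (Fin m) K) (AddEquiv.refl _) (fun s x => rfl)
    let g : N →ₗ[S] MvPolynomial (Fin m) K :=
      { toFun := fun x => q (e x)
        map_add' := fun x y => by simp
        map_smul' := fun s x => by rw [he, map_mul]; rfl }
    have hex : Function.Exact (r 0 • LinearMap.id : N →ₗ[S] N) g := by
      intro x
      change q (e x) = 0 ↔ ∃ y, r 0 • y = x
      constructor
      · intro hf
        rw [hqpoly, ← Polynomial.IsRoot, ← Polynomial.dvd_iff_isRoot] at hf
        obtain ⟨h, hh⟩ := hf
        refine ⟨e.symm ((MvPolynomial.finSuccEquiv K m).symm h), e.injective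
          ((MvPolynomial.finSuccEquiv K m).injective ?_)⟩
        rw [he, e.apply_symm_apply, hφ, map_mul, AlgEquiv.apply_symm_apply,
          MvPolynomial.finSuccEquiv_X_zero, hh, map_zero, sub_zero]
      · rintro ⟨y, rfl⟩
        simp [he, hφ, q]
    have hS := ModuleCat.shortComplex_shortExact (ModuleCat.shortComplexOfCompEqZero _ _
      hex.linearMap_comp_eq_zero) hex
      (fun a b hab => by
        have := congrArg e (show r 0 • a = r 0 • b from hab)
        rw [he, he, hφ] at this
        exact e.injective (mul_left_cancel₀ (MvPolynomial.X_ne_zero 0) this))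
      (fun f => ⟨e.symm (MvPolynomial.rename Fin.succ f), by
        change q (e _) = f
        rw [e.apply_symm_apply]
        simp only [q, MvPolynomial.aeval_rename]
        exact MvPolynomial.aeval_X_left_apply f⟩)
    refine ext_shift_of_smul_shortExact (r := r 0) ?_ hS h₀ h₁
    change r 0 ∈ Module.annihilator S (S ⧸ J)
    rw [Ideal.annihilator_quotient]
    exact hr 0

end ReesShift

section EdgeBinomials

open MvPolynomial

/-- The binomial `x_i y_j - x_j y_i`. -/
noncomputable def edgeBinomial (K : Type) [Field K] {V : Type} (i j : V) :
    MvPolynomial (V ⊕ V) K :=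
  X (Sum.inl i) * X (Sum.inr j) - X (Sum.inl j) * X (Sum.inr i)

lemma edgeBinomial_swap (K : Type) [Field K] {V : Type} (i j : V) :
    edgeBinomial K j i = -edgeBinomial K i j := by
  rw [edgeBinomial, edgeBinomial, neg_sub]

lemma edgeBinomial_mem {K : Type} [Field K] {V : Type} {G : SimpleGraph V} {i j : V}
    (h : G.Adj i j) : edgeBinomial K i j ∈ binomialEdgeIdeal K G :=
  Ideal.subset_span ⟨i, j, h, rfl⟩

lemma binomialEdgeIdeal_le {K : Type} [Field K] {V : Type} {G : SimpleGraph V}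
    {I : Ideal (MvPolynomial (V ⊕ V) K)} (h : ∀ i j, G.Adj i j → edgeBinomial K i j ∈ I) :
    binomialEdgeIdeal K G ≤ I := by
  refine Ideal.span_le.2 ?_
  rintro f ⟨i, j, hij, rfl⟩
  exact h i j hij

lemma cycleGraph_adj_add_one {n : ℕ} (i : Fin (n + 2)) : (cycleGraph (n + 2)).Adj i (i + 1) := by
  simp [cycleGraph_adj]

lemma binomialEdgeIdeal_cycleGraph_le {K : Type} [Field K] {n : ℕ}
    {I : Ideal (MvPolynomial (Fin (n + 2) ⊕ Fin (n + 2)) K)}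
    (h : ∀ i : Fin (n + 2), edgeBinomial K i (i + 1) ∈ I) :
    binomialEdgeIdeal K (cycleGraph (n + 2)) ≤ I := by
  refine binomialEdgeIdeal_le fun i j hij => ?_
  rcases cycleGraph_adj.1 hij with hij | hij
  · rw [sub_eq_iff_eq_add'.1 hij, edgeBinomial_swap]
    exact neg_mem (h j)
  · rw [sub_eq_iff_eq_add'.1 hij]
    exact h i

end EdgeBinomials

section LowerBound

open MvPolynomial

/-- First coordinates of a family of vectors whose cyclically consecutive `2 × 2` minors are, up to
sign, `t 0, …, t (n - 1)`. -/
def cycleWitnessX {R : Type} [CommRing R] (n : ℕ) (t : ℕ → R) : ℕ → R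
  | 0 => (∑ j ∈ Finset.Ico 3 (n - 1), t j) * t 0 - t (n - 1)
  | 1 => 1
  | 2 => t 2
  | k + 3 => ∑ j ∈ Finset.Ico 3 (k + 3), t j

/-- Second coordinates of a family of vectors whose cyclically consecutive `2 × 2` minors are, up to
sign, `t 0, …, t (n - 1)`. -/
def cycleWitnessY {R : Type} [CommRing R] (t : ℕ → R) : ℕ → R
  | 0 => t 0
  | 1 => 0
  | 2 => t 1
  | _ + 3 => 1

lemma cycleWitness_minor {R : Type} [CommRing R] (m : ℕ) (t : ℕ → R) (k : Fin (m + 4)) :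
    ∃ u : ℤˣ, cycleWitnessX (m + 4) t k * cycleWitnessY t (k + 1 : Fin (m + 4)) -
      cycleWitnessX (m + 4) t (k + 1 : Fin (m + 4)) * cycleWitnessY t k = u • t k := by
  obtain ⟨k, hk⟩ := k
  by_cases hlast : k = m + 3
  · subst hlast
    have : (⟨m + 3, hk⟩ + 1 : Fin (m + 4)) = 0 := by ext; simp [Fin.val_add]
    rw [this]
    refine ⟨1, ?_⟩
    simp [cycleWitnessX, cycleWitnessY]
  · have : ((⟨k, hk⟩ + 1 : Fin (m + 4)) : ℕ) = k + 1 := by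
      rw [Fin.val_add_one_of_lt' (by simp; lia)]
    rw [this]
    match k with
    | 0 => exact ⟨-1, by simp [cycleWitnessX, cycleWitnessY]⟩
    | 1 => exact ⟨1, by simp [cycleWitnessX, cycleWitnessY]⟩
    | 2 => exact ⟨1, by simp [cycleWitnessX, cycleWitnessY]⟩
    | k + 3 =>
      refine ⟨-1, ?_⟩
      simp [cycleWitnessX, cycleWitnessY, Finset.sum_Ico_succ_top]

open CategoryTheory in
/-- The top `Ext` of the quotient by the binomial edge ideal of a cycle does not vanish. -/
theorem exists_nontrivial_ext_cycleGraph (m : ℕ) (K : Type) [Field K] :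
    ∃ N : ModuleCat.{0} (MvPolynomial (Fin (m + 4) ⊕ Fin (m + 4)) K),
      Nontrivial (Abelian.Ext (ModuleCat.of _ (MvPolynomial (Fin (m + 4) ⊕ Fin (m + 4)) K ⧸
        binomialEdgeIdeal K (cycleGraph (m + 4)))) N (m + 4)) := by
  let t : ℕ → MvPolynomial (Fin (m + 4)) K := fun k => if h : k < m + 4 then X ⟨k, h⟩ else 0
  have ht (k : Fin (m + 4)) : t k = X k := by simp [t]
  let φ : MvPolynomial (Fin (m + 4) ⊕ Fin (m + 4)) K →ₐ[K] MvPolynomial (Fin (m + 4)) K :=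
    aeval (Sum.elim (fun i => cycleWitnessX (m + 4) t i) (fun i => cycleWitnessY t i))
  have hφ (k : Fin (m + 4)) : ∃ u : ℤˣ, φ (edgeBinomial K k (k + 1)) = u • X k := by
    obtain ⟨u, hu⟩ := cycleWitness_minor m t k
    exact ⟨u, by rw [← ht, ← hu]; simp [φ, edgeBinomial]⟩
  choose u hu using hφ
  let _ : Module (MvPolynomial (Fin (m + 4) ⊕ Fin (m + 4)) K) (MvPolynomial (Fin (m + 4)) K) :=
    Module.compHom _ φ.toRingHom
  refine ⟨ModuleCat.of _ (MvPolynomial (Fin (m + 4)) K),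
    (ext_quotient_of_mvPolynomial _ (m + 4) φ.toRingHom
      (fun k => u k • edgeBinomial K k (k + 1)) (fun k => ?_) (fun k => ?_) (fun f hf => ?_)
      (AddEquiv.refl _) (fun _ _ => rfl)).2⟩
  · exact zsmul_mem (edgeBinomial_mem (cycleGraph_adj_add_one k)) _
  · change φ _ = _
    rw [Units.smul_def, map_zsmul, hu, Units.smul_def, smul_smul]
    simp
  · have : binomialEdgeIdeal K (cycleGraph (m + 4)) ≤
        RingHom.ker (constantCoeff.comp φ.toRingHom) := by
      refine binomialEdgeIdeal_cycleGraph_le fun k => ?_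
      change constantCoeff (φ _) = 0
      rw [hu, Units.smul_def, map_zsmul]
      simp
    exact this hf

end LowerBound

section BigHeight

open MvPolynomial

/-- A chain of substitutions, each killing a new element, bounds the height of the last kernel. -/
lemma le_height_ker_of_chain {R : Type} [CommRing R] [IsDomain R] (θ σ : ℕ → R →+* R) (e : ℕ → R)
    (hcomp : ∀ s, θ (s + 1) = (σ s).comp (θ s)) (s : ℕ) (hne : ∀ t < s, θ t (e t) ≠ 0)
    (hzero : ∀ t < s, θ (t + 1) (e t) = 0) :
    (s : ℕ∞) ≤ (RingHom.ker (θ s)).height := by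
  induction s with
  | zero => simp
  | succ s ih =>
    have h1 := RingHom.ker_isPrime (θ s)
    have h2 := RingHom.ker_isPrime (θ (s + 1))
    have hlt : RingHom.ker (θ s) < RingHom.ker (θ (s + 1)) := by
      refine lt_of_le_of_ne (fun a ha => ?_) (fun h => hne s (by lia) ?_)
      · rw [RingHom.mem_ker] at ha ⊢
        rw [hcomp, RingHom.comp_apply, ha, map_zero]
      · rw [← RingHom.mem_ker, h, RingHom.mem_ker]
        exact hzero s (by lia)
    calc ((s + 1 : ℕ) : ℕ∞) = s + 1 := by push_cast; rfl
      _ ≤ (RingHom.ker (θ s)).height + 1 := by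
        gcongr
        exact ih (fun t ht => hne t (by lia)) (fun t ht => hzero t (by lia))
      _ ≤ _ := Ideal.height_add_one_le_of_lt_of_isPrime hlt

variable (m : ℕ) (K : Type) [Field K]

/-- The coordinate ring of the ambient space for the cycle on `m + 4` vertices. -/
abbrev CycleRing : Type := MvPolynomial (Fin (m + 4) ⊕ Fin (m + 4)) K

/-- The substitution of the first `s` steps in the parametrization of the component of the binomial
edge variety of the cycle associated to the cut set `{0, 2}`. -/
noncomputable def cutAssign (s : ℕ) : Fin (m + 4) ⊕ Fin (m + 4) → CycleRing m K
  | Sum.inl i => if i.val = 0 ∧ 1 ≤ s ∨ i.val = 2 ∧ 3 ≤ s then 0 else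
      if 4 ≤ i.val ∧ i.val < s then X (Sum.inl i) * X (Sum.inl 3) else X (Sum.inl i)
  | Sum.inr i => if i.val = 0 ∧ 2 ≤ s ∨ i.val = 2 ∧ 4 ≤ s then 0 else
      if 4 ≤ i.val ∧ i.val < s then X (Sum.inl i) * X (Sum.inr 3) else X (Sum.inr i)

/-- The `s`-th step of the parametrization. -/
noncomputable def cutStepAssign (s : ℕ) : Fin (m + 4) ⊕ Fin (m + 4) → CycleRing m K
  | Sum.inl i => if i.val = 0 ∧ s = 0 ∨ i.val = 2 ∧ s = 2 then 0 else
      if 4 ≤ i.val ∧ i.val = s then X (Sum.inl i) * X (Sum.inl 3) else X (Sum.inl i)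
  | Sum.inr i => if i.val = 0 ∧ s = 1 ∨ i.val = 2 ∧ s = 3 then 0 else
      if 4 ≤ i.val ∧ i.val = s then X (Sum.inl i) * X (Sum.inr 3) else X (Sum.inr i)

/-- The elements killed one after the other by the parametrization. -/
noncomputable def cutElement : ℕ → CycleRing m K
  | 0 => X (Sum.inl 0)
  | 1 => X (Sum.inr 0)
  | 2 => X (Sum.inl 2)
  | 3 => X (Sum.inr 2)
  | s + 4 => if h : s + 4 < m + 4 then edgeBinomial K ⟨s + 4, h⟩ 3 else 1

lemma aeval_cutAssign_succ (s : ℕ) :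
    aeval (R := K) (cutAssign m K (s + 1)) =
      (aeval (R := K) (cutStepAssign m K s)).comp (aeval (cutAssign m K s)) := by
  have h3 : 3 % (m + 4) = 3 := Nat.mod_eq_of_lt (by lia)
  ext i : 1
  rcases i with i | i
  · simp only [AlgHom.comp_apply, aeval_X, cutAssign]
    split_ifs <;> first | lia | (simp [cutStepAssign] <;> lia)
  · simp only [AlgHom.comp_apply, aeval_X, cutAssign]
    split_ifs <;> first | lia | (simp [cutStepAssign] <;> lia)

lemma edgeBinomial_ne_zero {V : Type} {i j : V} (h : i ≠ j) : edgeBinomial K i j ≠ 0 := by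
  classical
  intro h0
  have := congrArg (eval (R := K) (Sum.elim (fun k => if k = i then 1 else 0)
    (fun k => if k = j then 1 else 0))) h0
  simp [edgeBinomial, h.symm] at this

lemma aeval_cutAssign_cutElement {s : ℕ} (hs : s < m + 4) :
    aeval (R := K) (cutAssign m K s) (cutElement m K s) ≠ 0 := by
  have h2 : 2 % (m + 4) = 2 := Nat.mod_eq_of_lt (by lia)
  have h3 : 3 % (m + 4) = 3 := Nat.mod_eq_of_lt (by lia)
  match s with
  | 0 => simp [cutElement, cutAssign]
  | 1 => simp [cutElement, cutAssign]
  | 2 => simp [cutElement, cutAssign, h2]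
  | 3 => simp [cutElement, cutAssign, h2]
  | s + 4 =>
    have := edgeBinomial_ne_zero K (i := (⟨s + 4, hs⟩ : Fin (m + 4))) (j := 3)
      (by simp [Fin.ext_iff, h3])
    simpa [cutElement, cutAssign, hs, edgeBinomial, h3] using this

lemma aeval_cutAssign_succ_cutElement {s : ℕ} (hs : s < m + 4) :
    aeval (R := K) (cutAssign m K (s + 1)) (cutElement m K s) = 0 := by
  have h2 : 2 % (m + 4) = 2 := Nat.mod_eq_of_lt (by lia)
  have h3 : 3 % (m + 4) = 3 := Nat.mod_eq_of_lt (by lia)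
  match s with
  | 0 => simp [cutElement, cutAssign]
  | 1 => simp [cutElement, cutAssign]
  | 2 => simp [cutElement, cutAssign, h2]
  | 3 => simp [cutElement, cutAssign, h2]
  | s + 4 =>
    simp [cutElement, cutAssign, hs, edgeBinomial, h3]
    ring

/-- The component of the binomial edge variety of the cycle associated to the cut set `{0, 2}`. -/
noncomputable def cutPrime : Ideal (CycleRing m K) :=
  RingHom.ker (aeval (R := K) (cutAssign m K (m + 4)))

instance : (cutPrime m K).IsPrime := RingHom.ker_isPrime _

lemma le_height_cutPrime : ((m + 4 : ℕ) : ℕ∞) ≤ (cutPrime m K).height :=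
  le_height_ker_of_chain (fun s => (aeval (R := K) (cutAssign m K s)).toRingHom)
    (fun s => (aeval (R := K) (cutStepAssign m K s)).toRingHom) (cutElement m K)
    (fun s => congrArg AlgHom.toRingHom (aeval_cutAssign_succ m K s)) (m + 4)
    (fun _ ht => aeval_cutAssign_cutElement m K ht)
    (fun _ ht => aeval_cutAssign_succ_cutElement m K ht)

/-- The proportionality factors in the parametrization. -/
noncomputable def cutFactor (i : Fin (m + 4)) : CycleRing m K :=
  if i.val = 0 ∨ i.val = 2 then 0 else if i.val = 3 then 1 else X (Sum.inl i)

lemma cutAssign_inl {i : Fin (m + 4)} (hi : i.val ≠ 1) :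
    cutAssign m K (m + 4) (Sum.inl i) = cutFactor m K i * X (Sum.inl 3) := by
  have h3 : ((3 : Fin (m + 4)) : ℕ) = 3 := rfl
  have := i.isLt
  simp only [cutAssign, cutFactor]
  split_ifs <;> first | lia | simp
  rw [Fin.ext (show i.val = (3 : Fin (m + 4)).val from by lia)]

lemma cutAssign_inr {i : Fin (m + 4)} (hi : i.val ≠ 1) :
    cutAssign m K (m + 4) (Sum.inr i) = cutFactor m K i * X (Sum.inr 3) := by
  have h3 : ((3 : Fin (m + 4)) : ℕ) = 3 := rfl
  have := i.isLt
  simp only [cutAssign, cutFactor]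
  split_ifs <;> first | lia | simp
  rw [Fin.ext (show i.val = (3 : Fin (m + 4)).val from by lia)]

lemma cutFactor_ne_zero {i : Fin (m + 4)} (hi : 3 ≤ i.val) : cutFactor m K i ≠ 0 := by
  rw [cutFactor, if_neg (by lia)]
  split_ifs
  · exact one_ne_zero
  · exact X_ne_zero _

lemma val_cycle_add_one (i : Fin (m + 4)) :
    i.val = m + 3 ∧ (i + 1).val = 0 ∨ i.val < m + 3 ∧ (i + 1).val = i.val + 1 := by
  by_cases h : i.val = m + 3
  · refine Or.inl ⟨h, ?_⟩
    simp [Fin.val_add, h]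
  · exact Or.inr ⟨by lia, Fin.val_add_one_of_lt' (by lia)⟩

lemma aeval_cutAssign_edgeBinomial {i : Fin (m + 4)} (hi : i.val ≠ 1) :
    aeval (R := K) (cutAssign m K (m + 4)) (edgeBinomial K 1 i) =
      cutFactor m K i * edgeBinomial K 1 3 := by
  rw [edgeBinomial]
  simp only [map_sub, map_mul, aeval_X, cutAssign_inl m K hi, cutAssign_inr m K hi]
  simp [cutAssign, edgeBinomial]
  ring

lemma cutFactor_eq_zero {i : Fin (m + 4)} (hi : i.val = 0 ∨ i.val = 2) : cutFactor m K i = 0 :=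
  if_pos hi

lemma binomialEdgeIdeal_le_cutPrime :
    binomialEdgeIdeal K (cycleGraph (m + 4)) ≤ cutPrime m K := by
  refine binomialEdgeIdeal_cycleGraph_le fun i => ?_
  rw [cutPrime, RingHom.mem_ker]
  have hv := val_cycle_add_one m i
  by_cases h1 : i.val = 1
  · obtain rfl : i = 1 := Fin.ext h1
    rw [aeval_cutAssign_edgeBinomial m K (by lia), cutFactor_eq_zero m K (by lia), zero_mul]
  by_cases h2 : (i + 1).val = 1
  · rw [show i + 1 = 1 from Fin.ext h2, edgeBinomial_swap, map_neg,
      aeval_cutAssign_edgeBinomial m K h1, cutFactor_eq_zero m K (by lia), zero_mul, neg_zero]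
  · rw [edgeBinomial]
    simp only [map_sub, map_mul, aeval_X, cutAssign_inl m K h1, cutAssign_inr m K h1,
      cutAssign_inl m K h2, cutAssign_inr m K h2]
    ring

variable {m K}

lemma X_mem_of_edgeBinomial_mem {V : Type} {Q : Ideal (MvPolynomial (V ⊕ V) K)} [Q.IsPrime]
    {a b c : V} (ha : edgeBinomial K c a ∈ Q) (hb : edgeBinomial K c b ∈ Q)
    (hab : edgeBinomial K a b ∉ Q) :
    (X (Sum.inl c) : MvPolynomial (V ⊕ V) K) ∈ Q ∧ (X (Sum.inr c) : MvPolynomial (V ⊕ V) K) ∈ Q := by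
  constructor
  · refine (Ideal.IsPrime.mem_or_mem inferInstance (?_ : _ * edgeBinomial K a b ∈ Q)).resolve_right
      hab
    convert Q.sub_mem (Q.mul_mem_left (X (Sum.inl a)) hb) (Q.mul_mem_left (X (Sum.inl b)) ha) using 1
    simp only [edgeBinomial]
    ring
  · refine (Ideal.IsPrime.mem_or_mem inferInstance (?_ : _ * edgeBinomial K a b ∈ Q)).resolve_right
      hab
    convert Q.sub_mem (Q.mul_mem_left (X (Sum.inr a)) hb) (Q.mul_mem_left (X (Sum.inr b)) ha) using 1
    simp only [edgeBinomial]
    ring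

lemma edgeBinomial_trans_mem {V : Type} {Q : Ideal (MvPolynomial (V ⊕ V) K)} [Q.IsPrime]
    {a b c : V} (hab : edgeBinomial K a b ∈ Q) (hbc : edgeBinomial K b c ∈ Q)
    (hb : (X (Sum.inl b) : MvPolynomial (V ⊕ V) K) ∉ Q) : edgeBinomial K a c ∈ Q := by
  refine (Ideal.IsPrime.mem_or_mem inferInstance (?_ : X (Sum.inl b) * _ ∈ Q)).resolve_left hb
  convert Q.add_mem (Q.mul_mem_left (X (Sum.inl a)) hbc) (Q.mul_mem_left (X (Sum.inl c)) hab) using 1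
  simp only [edgeBinomial]
  ring

variable (m K)

lemma X_notMem_cutPrime {i : Fin (m + 4)} (hi : 3 ≤ i.val) :
    (X (Sum.inl i) : CycleRing m K) ∉ cutPrime m K := by
  rw [cutPrime, RingHom.mem_ker, aeval_X, cutAssign_inl m K (by lia)]
  exact mul_ne_zero (cutFactor_ne_zero m K hi) (X_ne_zero _)

lemma edgeBinomial_notMem_cutPrime {i : Fin (m + 4)} (hi : 3 ≤ i.val) :
    edgeBinomial K 1 i ∉ cutPrime m K := by
  rw [cutPrime, RingHom.mem_ker, aeval_cutAssign_edgeBinomial m K (by lia)]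
  exact mul_ne_zero (cutFactor_ne_zero m K hi) (edgeBinomial_ne_zero K (by
    simp [Fin.ext_iff, Nat.mod_eq_of_lt (show 3 < m + 4 by lia)]))

lemma cutPrime_le {Q : Ideal (CycleRing m K)} [Q.IsPrime]
    (hJ : binomialEdgeIdeal K (cycleGraph (m + 4)) ≤ Q) (hQ : Q ≤ cutPrime m K) :
    cutPrime m K ≤ Q := by
  have h3 : ((3 : Fin (m + 4)) : ℕ) = 3 := rfl
  have h3m : 3 % (m + 4) = 3 := Nat.mod_eq_of_lt (by lia)
  have hx {i : Fin (m + 4)} (hi : 3 ≤ i.val) : (X (Sum.inl i) : CycleRing m K) ∉ Q :=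
    fun h => X_notMem_cutPrime m K hi (hQ h)
  have hf {i : Fin (m + 4)} (hi : 3 ≤ i.val) : edgeBinomial K 1 i ∉ Q :=
    fun h => edgeBinomial_notMem_cutPrime m K hi (hQ h)
  have hE (i : Fin (m + 4)) : edgeBinomial K i (i + 1) ∈ Q :=
    hJ (edgeBinomial_mem (cycleGraph_adj_add_one i))
  have hE' (i : Fin (m + 4)) : edgeBinomial K (i + 1) i ∈ Q := by
    rw [edgeBinomial_swap]
    exact neg_mem (hE i)
  have hz0 := X_mem_of_edgeBinomial_mem (a := (1 : Fin (m + 4))) (b := Fin.last (m + 3)) (c := 0)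
    (by simpa using hE 0) (by simpa using hE' (Fin.last (m + 3))) (hf (by simp))
  have hz2 := X_mem_of_edgeBinomial_mem (a := (1 : Fin (m + 4))) (b := 3) (c := 2)
    (hE' 1) (hE 2) (hf (by lia))
  have h3i (s : ℕ) (hs : s + 3 < m + 4) : edgeBinomial K (3 : Fin (m + 4)) ⟨s + 3, hs⟩ ∈ Q := by
    induction s with
    | zero =>
      convert Q.zero_mem
      rw [edgeBinomial, show (⟨0 + 3, hs⟩ : Fin (m + 4)) = 3 from rfl, sub_self]
    | succ s ih =>
      refine edgeBinomial_trans_mem (ih (by lia)) ?_ (hx (by simp))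
      convert hE ⟨s + 3, by lia⟩ using 2
      have := val_cycle_add_one m ⟨s + 3, by lia⟩
      ext
      simp only at this ⊢
      lia
  let π : CycleRing m K →ₐ[K] FractionRing (CycleRing m K ⧸ Q) :=
    (IsScalarTower.toAlgHom K (CycleRing m K ⧸ Q) (FractionRing (CycleRing m K ⧸ Q))).comp
      (Ideal.Quotient.mkₐ K Q)
  have hπ (f : CycleRing m K) : π f = 0 ↔ f ∈ Q := by
    simp [π, Ideal.Quotient.eq_zero_iff_mem]
  have hx3 : π (X (Sum.inl 3)) ≠ 0 := fun h => hx (i := 3) (by lia) ((hπ _).1 h)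
  let ρ : CycleRing m K →ₐ[K] FractionRing (CycleRing m K ⧸ Q) := aeval (Sum.elim
    (fun i => if 4 ≤ i.val then π (X (Sum.inl i)) / π (X (Sum.inl 3)) else π (X (Sum.inl i)))
    (fun i => π (X (Sum.inr i))))
  have hy (i : Fin (m + 4)) (hi : 4 ≤ i.val) :
      π (X (Sum.inl i)) / π (X (Sum.inl 3)) * π (X (Sum.inr 3)) = π (X (Sum.inr i)) := by
    have h := h3i (i.val - 3) (by lia)
    rw [show (⟨i.val - 3 + 3, by lia⟩ : Fin (m + 4)) = i from Fin.ext (by simp; lia), ← hπ,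
      edgeBinomial, map_sub, map_mul, map_mul] at h
    field_simp
    linear_combination -h
  have hρ : ρ.comp (aeval (cutAssign m K (m + 4))) = π := by
    ext i : 1
    rcases i with i | i
    · rw [AlgHom.comp_apply, aeval_X]
      simp only [cutAssign]
      split_ifs with h h'
      · rw [map_zero, eq_comm, hπ]
        rcases h with h | h
        · rw [show i = 0 from Fin.ext h.1]
          exact hz0.1
        · rw [show i = 2 from Fin.ext h.1]
          exact hz2.1
      · simp [ρ, h'.1, h3m, div_mul_cancel₀ _ hx3]
      · have : ¬ 4 ≤ i.val := by lia
        simp [ρ, this]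
    · rw [AlgHom.comp_apply, aeval_X]
      simp only [cutAssign]
      split_ifs with h h'
      · rw [map_zero, eq_comm, hπ]
        rcases h with h | h
        · rw [show i = 0 from Fin.ext h.1]
          exact hz0.2
        · rw [show i = 2 from Fin.ext h.1]
          exact hz2.2
      · simp [ρ, h'.1, hy]
      · simp [ρ]
  intro g hg
  rw [cutPrime, RingHom.mem_ker] at hg
  rw [← hπ, ← hρ, AlgHom.comp_apply, hg, map_zero]

lemma binomialEdgeIdeal_cycleGraph_eq_span :
    binomialEdgeIdeal K (cycleGraph (m + 4)) =
      Ideal.span (Set.range fun i : Fin (m + 4) => edgeBinomial K i (i + 1)) := by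
  refine le_antisymm (binomialEdgeIdeal_cycleGraph_le fun i => Ideal.subset_span ⟨i, rfl⟩)
    (Ideal.span_le.2 ?_)
  rintro _ ⟨i, rfl⟩
  exact edgeBinomial_mem (cycleGraph_adj_add_one i)

/-- The big height of the binomial edge ideal of a cycle is the number of vertices. -/
theorem bigHeight_cycleGraph :
    bigHeight (binomialEdgeIdeal K (cycleGraph (m + 4))) = ((m + 4 : ℕ) : ℕ∞) := by
  refine le_antisymm (sSup_le ?_) ?_
  · rintro _ ⟨p, hp, rfl⟩
    rw [← PrimeSpectrum.height_eq_orderHeight]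
    rw [binomialEdgeIdeal_cycleGraph_eq_span] at hp
    refine (Ideal.height_le_card_of_mem_minimalPrimes_span (Set.finite_range _) hp).trans ?_
    rw [← Set.image_univ]
    exact_mod_cast (Set.ncard_image_le (Set.finite_univ)).trans (by simp)
  · refine (le_height_cutPrime m K).trans (le_sSup ⟨⟨cutPrime m K, inferInstance⟩, ?_, ?_⟩)
    · exact ⟨⟨inferInstance, binomialEdgeIdeal_le_cutPrime m K⟩,
        fun Q hQ hle => have := hQ.1; cutPrime_le m K hQ.2 hle⟩
    · rw [← PrimeSpectrum.height_eq_orderHeight]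

end BigHeight

section PerfectPairing

/-- The map `b ↦ φ (b * ·)` from an algebra to its dual, for a linear form `φ`. -/
def dualMap {A B : Type} [CommRing A] [CommRing B] [Algebra A B] (φ : B →ₗ[A] A) :
    B →ₗ[A] Module.Dual A B :=
  (LinearMap.mul A B).compr₂ φ

@[simp]
lemma dualMap_apply {A B : Type} [CommRing A] [CommRing B] [Algebra A B] (φ : B →ₗ[A] A) (b c : B) :
    dualMap φ b c = φ (b * c) := rfl

variable {A B κ : Type} [CommRing A] [CommRing B] [Algebra A B] [Fintype κ]
  {φ : B →ₗ[A] A} {u v : κ → B}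

lemma pairing_sum_smul (c : κ → A) (i : κ) : φ ((∑ j, c j • v j) * u i) =
    (Matrix.of fun i j => φ (v j * u i)).mulVec c i := by
  rw [Finset.sum_mul, map_sum]
  refine Finset.sum_congr rfl fun j _ => ?_
  rw [smul_mul_assoc, map_smul, smul_eq_mul, mul_comm]
  rfl

variable [DecidableEq κ]

lemma linearIndependent_of_isUnit_det
    (hdet : IsUnit (Matrix.of fun i j => φ (v j * u i)).det) : LinearIndependent A v := by
  rw [Fintype.linearIndependent_iff]
  intro c hc
  have h : (Matrix.of fun i j => φ (v j * u i)).mulVec c =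
      (Matrix.of fun i j => φ (v j * u i)).mulVec 0 := by
    rw [Matrix.mulVec_zero]
    ext i
    rw [← pairing_sum_smul, hc, zero_mul, map_zero, Pi.zero_apply]
  exact congrFun (Matrix.mulVec_injective_of_isUnit ((Matrix.isUnit_iff_isUnit_det _).2 hdet) h)

lemma bijective_dualMap_of_isUnit_det
    (hdet : IsUnit (Matrix.of fun i j => φ (v j * u i)).det)
    (hv : Submodule.span A (Set.range v) = ⊤) (hu : Submodule.span A (Set.range u) = ⊤) :
    Function.Bijective (dualMap φ) := by
  have hG := (Matrix.isUnit_iff_isUnit_det _).2 hdet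
  constructor
  · rw [injective_iff_map_eq_zero]
    intro b hb
    obtain ⟨c, rfl⟩ := (Submodule.mem_span_range_iff_exists_fun A).1
      (hv ▸ Submodule.mem_top : b ∈ Submodule.span A (Set.range v))
    have : c = 0 := by
      refine Matrix.mulVec_injective_of_isUnit hG ?_
      rw [Matrix.mulVec_zero]
      ext i
      rw [← pairing_sum_smul, ← dualMap_apply, hb, LinearMap.zero_apply, Pi.zero_apply]
    simp [this]
  · intro l
    obtain ⟨c, hc⟩ := Matrix.mulVec_surjective_iff_isUnit.2 hG fun i => l (u i)
    refine ⟨∑ j, c j • v j, LinearMap.ext_on_range hu fun i => ?_⟩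
    rw [dualMap_apply, pairing_sum_smul, hc]

end PerfectPairing

section Residue

open MvPolynomial

variable {A ι : Type} [CommRing A] [Fintype ι]

/-- All monomials occurring in `p` have weight at most `c`. -/
def HasWeightLE (w : ι → ℕ) (c : ℕ) (p : MvPolynomial ι A) : Prop :=
  ∀ m : ι →₀ ℕ, coeff m p ≠ 0 → ∑ i, m i * w i ≤ c

variable {w : ι → ℕ} {c d : ℕ} {p q : MvPolynomial ι A}

lemma HasWeightLE.mono (hp : HasWeightLE w c p) (h : c ≤ d) : HasWeightLE w d p :=
  fun m hm => (hp m hm).trans h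

lemma hasWeightLE_zero : HasWeightLE w c (0 : MvPolynomial ι A) := by
  intro m hm
  simp at hm

lemma HasWeightLE.add (hp : HasWeightLE w c p) (hq : HasWeightLE w c q) :
    HasWeightLE w c (p + q) := by
  intro m hm
  by_cases h : coeff m p = 0
  · exact hq m fun h' => hm (by rw [coeff_add, h, h', add_zero])
  · exact hp m h

lemma HasWeightLE.neg (hp : HasWeightLE w c p) : HasWeightLE w c (-p) := by
  intro m hm
  exact hp m (by simpa using hm)

lemma HasWeightLE.sub (hp : HasWeightLE w c p) (hq : HasWeightLE w c q) :
    HasWeightLE w c (p - q) := by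
  rw [sub_eq_add_neg]
  exact hp.add hq.neg

lemma HasWeightLE.mul (hp : HasWeightLE w c p) (hq : HasWeightLE w d q) :
    HasWeightLE w (c + d) (p * q) := by
  classical
  intro m hm
  rw [coeff_mul] at hm
  obtain ⟨x, hx, hne⟩ := Finset.exists_ne_zero_of_sum_ne_zero hm
  rw [← Finset.HasAntidiagonal.mem_antidiagonal.1 hx]
  simp only [Finsupp.add_apply, add_mul, Finset.sum_add_distrib]
  exact add_le_add (hp _ (left_ne_zero_of_mul hne)) (hq _ (right_ne_zero_of_mul hne))

lemma hasWeightLE_monomial (m : ι →₀ ℕ) (a : A) :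
    HasWeightLE w (∑ i, m i * w i) (monomial m a) := by
  classical
  intro k hk
  rw [coeff_monomial] at hk
  by_cases h : m = k
  · rw [h]
  · rw [if_neg h] at hk
    exact absurd rfl hk

lemma hasWeightLE_C (a : A) : HasWeightLE w 0 (C a : MvPolynomial ι A) := by
  simpa using hasWeightLE_monomial (w := w) 0 a

lemma hasWeightLE_X (i : ι) : HasWeightLE w (w i) (X i : MvPolynomial ι A) := by
  classical
  have := hasWeightLE_monomial (w := w) (Finsupp.single i 1) (1 : A)
  rwa [Finset.sum_eq_single i (fun j _ hj => by simp [hj.symm]) (by simp), Finsupp.single_eq_same,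
    one_mul] at this

lemma HasWeightLE.pow (hp : HasWeightLE w c p) (k : ℕ) : HasWeightLE w (k * c) (p ^ k) := by
  induction k with
  | zero => simpa using hasWeightLE_C (w := w) (1 : A)
  | succ k ih =>
    rw [pow_succ, add_mul, one_mul]
    exact ih.mul hp

lemma HasWeightLE.prod {κ : Type} {s : Finset κ} {c : κ → ℕ} {p : κ → MvPolynomial ι A}
    (hp : ∀ i ∈ s, HasWeightLE w (c i) (p i)) :
    HasWeightLE w (∑ i ∈ s, c i) (∏ i ∈ s, p i) := by
  classical
  induction s using Finset.induction_on with
  | empty => simpa using hasWeightLE_C (w := w) (1 : A)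
  | insert a s ha ih =>
    rw [Finset.sum_insert ha, Finset.prod_insert ha]
    exact (hp a (by simp)).mul (ih fun i hi => hp i (by simp [hi]))

lemma exists_hasWeightLE (w : ι → ℕ) (p : MvPolynomial ι A) : ∃ c, HasWeightLE w c p :=
  ⟨p.support.sup fun m => ∑ i, m i * w i, fun _ hm =>
    Finset.le_sup (f := fun m : ι →₀ ℕ => ∑ i, m i * w i) (mem_support_iff.2 hm)⟩

/-- The exponent of the monomial `∏ i, X i ^ (2 * k i + 1)`. -/
noncomputable def oddExponent (k : ι →₀ ℕ) : ι →₀ ℕ := 2 • k + Finsupp.equivFunOnFinite.symm 1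

@[simp]
lemma oddExponent_apply (k : ι →₀ ℕ) (i : ι) : oddExponent k i = 2 * k i + 1 := by
  simp [oddExponent]

/-- The `k`-th term of the expansion of the residue of `h / ∏ i, (X i ^ 2 - g i)`. -/
noncomputable def residueTerm (g : ι → MvPolynomial ι A) (h : MvPolynomial ι A) (k : ι →₀ ℕ) : A :=
  coeff (oddExponent k) (h * ∏ i, g i ^ k i)

variable {g : ι → MvPolynomial ι A} (hg : ∀ i, ∃ c < 2 * w i, HasWeightLE w c (g i))

include hg

lemma degree_le_of_residueTerm_ne_zero {h : MvPolynomial ι A} (hh : HasWeightLE w c h)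
    {k : ι →₀ ℕ} (hk : residueTerm g h k ≠ 0) : ∑ i, k i + ∑ i, w i ≤ c := by
  have hgk : HasWeightLE w (∑ i, k i * (2 * w i - 1)) (∏ i, g i ^ k i) :=
    HasWeightLE.prod fun i _ => by
      obtain ⟨c, hc, hgc⟩ := hg i
      exact (hgc.mono (by lia)).pow _
  have hle := (hh.mul hgk) _ hk
  have hi (i : ι) : oddExponent k i * w i = k i + w i + k i * (2 * w i - 1) := by
    obtain ⟨c, hc, -⟩ := hg i
    obtain ⟨v, hv⟩ : ∃ v, w i = v + 1 := ⟨w i - 1, by lia⟩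
    rw [oddExponent_apply, hv, show 2 * (v + 1) - 1 = 2 * v + 1 by lia]
    ring
  simp only [hi, Finset.sum_add_distrib] at hle
  lia

lemma finite_support_residueTerm (h : MvPolynomial ι A) : (residueTerm g h).support.Finite := by
  obtain ⟨c, hc⟩ := exists_hasWeightLE w h
  refine (Finsupp.finite_of_degree_le (σ := ι) c).subset fun k hk => ?_
  have := degree_le_of_residueTerm_ne_zero hg hc hk
  rw [Set.mem_ofPred_eq, Finsupp.degree_eq_sum]
  lia

/-- The residue form `h ↦ Res (h / ∏ i, (X i ^ 2 - g i))`. -/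
noncomputable def residue : MvPolynomial ι A →ₗ[A] A where
  toFun h := ∑ᶠ k, residueTerm g h k
  map_add' h h' := by
    rw [← finsum_add_distrib (finite_support_residueTerm hg h) (finite_support_residueTerm hg h')]
    simp [residueTerm, add_mul]
  map_smul' a h := by
    rw [RingHom.id_apply, smul_finsum' a (finite_support_residueTerm hg h)]
    simp [residueTerm]

lemma residue_apply (h : MvPolynomial ι A) : residue hg h = ∑ᶠ k, residueTerm g h k := rfl

lemma residue_mul_X_sq (h : MvPolynomial ι A) (i : ι) :
    residue hg (h * X i ^ 2) = residue hg (h * g i) := by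
  classical
  let s : (ι →₀ ℕ) → (ι →₀ ℕ) := fun k => k + Finsupp.single i 1
  have hs : Function.Injective s := add_left_injective _
  have hterm (k : ι →₀ ℕ) : residueTerm g (h * X i ^ 2) (s k) = residueTerm g (h * g i) k := by
    have h1 : oddExponent (s k) = oddExponent k + Finsupp.single i 2 := by
      ext j
      by_cases hj : i = j
      · subst hj
        simp [s]
        ring
      · simp [s, hj]
    have h2 : ∏ j, g j ^ s k j = g i * ∏ j, g j ^ k j := by
      simp only [s, Finsupp.add_apply, pow_add, Finset.prod_mul_distrib]
      rw [mul_comm, Finset.prod_eq_single i (fun j _ hj => by simp [hj.symm]) (by simp),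
        Finsupp.single_eq_same, pow_one]
    rw [residueTerm, residueTerm, h1, h2,
      show h * X i ^ 2 * (g i * ∏ j, g j ^ k j) = h * g i * (∏ j, g j ^ k j) * X i ^ 2 by ring,
      X_pow_eq_monomial, coeff_mul_monomial, mul_one]
  have hsupp : ∀ k, k ∉ Set.range s → residueTerm g (h * X i ^ 2) k = 0 := by
    intro k hk
    have hki : k i = 0 := by
      by_contra hne
      refine hk ⟨k - Finsupp.single i 1, ?_⟩
      ext j
      by_cases hj : i = j
      · subst hj
        simp [s]
        lia
      · simp [s, hj]
    rw [residueTerm, show h * X i ^ 2 * ∏ j, g j ^ k j = h * (∏ j, g j ^ k j) * X i ^ 2 by ring,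
      X_pow_eq_monomial, coeff_mul_monomial', if_neg]
    intro hle
    have := hle i
    simp [hki] at this
  rw [residue_apply, residue_apply, ← finsum_congr hterm,
    ← finsum_mem_range (f := residueTerm g (h * X i ^ 2)) hs]
  refine finsum_congr fun k => ?_
  by_cases hk : k ∈ Set.range s
  · rw [finsum_eq_if, if_pos hk]
  · rw [hsupp k hk, finsum_eq_if, ite_self]

lemma residue_eq_zero {h : MvPolynomial ι A}
    (hh : h ∈ Ideal.span (Set.range fun i => X i ^ 2 - g i)) : residue hg h = 0 := by
  obtain ⟨c, rfl⟩ := Ideal.mem_span_range_iff_exists_fun.1 hh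
  rw [map_sum]
  exact Finset.sum_eq_zero fun i _ => by rw [mul_sub, map_sub, residue_mul_X_sq, sub_self]

lemma residue_eq_coeff {h : MvPolynomial ι A} (hh : HasWeightLE w (∑ i, w i) h) :
    residue hg h = coeff (oddExponent 0) h := by
  rw [residue_apply, finsum_eq_single _ 0]
  · simp [residueTerm]
  · intro k hk
    by_contra hne
    have := degree_le_of_residueTerm_ne_zero hg hh hne
    refine hk (Finsupp.ext fun i => ?_)
    have := Finset.single_le_sum (f := k) (fun _ _ => Nat.zero_le _) (Finset.mem_univ i)
    simp only [Finsupp.coe_zero, Pi.zero_apply]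
    lia

end Residue

section QuadraticAlgebra

open MvPolynomial

lemma exists_linearMap_factor {A P B N : Type} [CommRing A] [AddCommGroup P] [Module A P]
    [AddCommGroup B] [Module A B] [AddCommGroup N] [Module A N] (θ : P →ₗ[A] B)
    (hθ : Function.Surjective θ) (r : P →ₗ[A] N) (h : ∀ p, θ p = 0 → r p = 0) :
    ∃ φ : B →ₗ[A] N, ∀ p, φ (θ p) = r p := by
  refine ⟨(LinearMap.ker θ).liftQ r h ∘ₗ (θ.quotKerEquivOfSurjective hθ).symm.toLinearMap,
    fun p => ?_⟩
  have : (θ.quotKerEquivOfSurjective hθ).symm (θ p) = (LinearMap.ker θ).mkQ p :=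
    (LinearEquiv.symm_apply_eq _).2 rfl
  rw [LinearMap.comp_apply, LinearEquiv.coe_coe, this]
  rfl

variable {A ι : Type} [CommRing A] [Fintype ι] {w : ι → ℕ} {g : ι → MvPolynomial ι A}

lemma hasWeightLE_prod_X (s : Finset ι) :
    HasWeightLE w (∑ i ∈ s, w i) (∏ i ∈ s, X i : MvPolynomial ι A) :=
  HasWeightLE.prod fun i _ => hasWeightLE_X i

lemma prod_X_eq_monomial [DecidableEq ι] (s : Finset ι) :
    (∏ i ∈ s, X i : MvPolynomial ι A) =
      monomial (Finsupp.equivFunOnFinite.symm fun i => if i ∈ s then 1 else 0) 1 := by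
  rw [monomial_eq, C_1, one_mul, Finsupp.prod_fintype _ _ (by simp)]
  simp

lemma coeff_oddExponent_zero_prod [DecidableEq ι] (s t : Finset ι) :
    coeff (oddExponent 0) ((∏ i ∈ s, X i) * ∏ i ∈ tᶜ, X i : MvPolynomial ι A) =
      if s = t then 1 else 0 := by
  rw [prod_X_eq_monomial, prod_X_eq_monomial, monomial_mul, coeff_monomial, one_mul]
  congr 1
  rw [eq_iff_iff]
  constructor
  · intro h
    ext i
    have := DFunLike.congr_fun h i
    by_cases hs : i ∈ s <;> by_cases ht : i ∈ t <;> simp [hs, ht] at this ⊢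
  · rintro rfl
    ext i
    by_cases hs : i ∈ s <;> simp [hs]

variable {B : Type} [CommRing B] [Algebra A B] (θ : MvPolynomial ι A →ₐ[A] B)
  (hg : ∀ i, ∃ c < 2 * w i, HasWeightLE w c (g i)) (hθg : ∀ i, θ (X i ^ 2) = θ (g i))

include hg hθg

lemma mem_span_squarefree [DecidableEq ι] (c : ℕ) {h : MvPolynomial ι A} (hh : HasWeightLE w c h) :
    θ h ∈ Submodule.span A (Set.range fun s : Finset ι => θ (∏ i ∈ s, X i)) := by
  induction c using Nat.strong_induction_on generalizing h with
  | _ c ih =>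
    rw [h.as_sum, map_sum]
    refine Submodule.sum_mem _ fun m hm => ?_
    have hmc := hh m (mem_support_iff.1 hm)
    rw [← mul_one (coeff m h), ← smul_eq_mul, ← smul_monomial, map_smul]
    refine Submodule.smul_mem _ _ ?_
    by_cases hsq : ∃ i, 2 ≤ m i
    · obtain ⟨i, hi⟩ := hsq
      obtain ⟨k, rfl⟩ : ∃ k, m = k + Finsupp.single i 2 :=
        ⟨m - Finsupp.single i 2, (tsub_add_cancel_of_le (by simpa using hi)).symm⟩
      obtain ⟨d, hd, hgd⟩ := hg i
      have hk := (hasWeightLE_monomial (w := w) k (1 : A)).mul hgd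
      have hkw : ∑ j, (k + Finsupp.single i 2 : ι →₀ ℕ) j * w j = ∑ j, k j * w j + 2 * w i := by
        simp only [Finsupp.add_apply, add_mul, Finset.sum_add_distrib]
        rw [Finset.sum_eq_single (f := fun j => Finsupp.single i 2 j * w j) i
          (fun j _ hj => by simp [hj.symm]) (by simp), Finsupp.single_eq_same]
      have := ih (∑ j, k j * w j + d) (by lia) hk
      rwa [map_mul, ← hθg, ← map_mul, X_pow_eq_monomial, monomial_mul, one_mul] at this
    · push Not at hsq
      refine Submodule.subset_span ⟨Finset.univ.filter fun i => m i = 1, ?_⟩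
      have hm1 : (Finsupp.equivFunOnFinite.symm fun i =>
          if i ∈ Finset.univ.filter fun i => m i = 1 then 1 else 0) = m := by
        ext i
        have := hsq i
        by_cases h1 : m i = 1
        · simp [h1]
        · simp [h1]
          lia
      simp only [prod_X_eq_monomial, hm1]

/-- An algebra defined by as many quadrics with leading forms `X i ^ 2` as variables is free with a
perfect duality. -/
theorem free_and_bijective_dualMap (hθ : Function.Surjective θ)
    (hker : ∀ p, θ p = 0 → p ∈ Ideal.span (Set.range fun i => X i ^ 2 - g i)) :
    Module.Free A B ∧ Module.Finite A B ∧ ∃ φ : B →ₗ[A] A, Function.Bijective (dualMap φ) := by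
  classical
  obtain ⟨φ, hφ⟩ := exists_linearMap_factor θ.toLinearMap hθ (residue hg)
    fun p hp => residue_eq_zero hg (hker p hp)
  let v : Finset ι → B := fun s => θ (∏ i ∈ s, X i)
  let u : Finset ι → B := fun s => v sᶜ
  have hv : Submodule.span A (Set.range v) = ⊤ := by
    refine eq_top_iff.2 fun b _ => ?_
    obtain ⟨h, rfl⟩ := hθ b
    obtain ⟨c, hc⟩ := exists_hasWeightLE w h
    exact mem_span_squarefree θ hg hθg c hc
  have hu : Submodule.span A (Set.range u) = ⊤ := by
    rw [← hv]
    congr 1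
    exact compl_surjective.range_comp v
  have hval (s t : Finset ι) (hst : ∑ i ∈ s, w i ≤ ∑ i ∈ t, w i) :
      φ (v s * u t) = if s = t then 1 else 0 := by
    have hw := (hasWeightLE_prod_X (A := A) (w := w) s).mul (hasWeightLE_prod_X tᶜ)
    have h1 := Finset.sum_add_sum_compl t w
    rw [← coeff_oddExponent_zero_prod, ← residue_eq_coeff hg (hw.mono (by lia)), ← hφ]
    simp [v, u]
  have hdet : IsUnit (Matrix.of fun i j => φ (v j * u i)).det := by
    have htri : (Matrix.of fun i j => φ (v j * u i)).BlockTriangular fun s => ∑ i ∈ s, w i := by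
      intro s t hst
      rw [Matrix.of_apply, hval _ _ hst.le, if_neg]
      rintro rfl
      exact hst.ne rfl
    rw [htri.det, Finset.prod_eq_one]
    · exact isUnit_one
    · intro a _
      have : (Matrix.of fun i j => φ (v j * u i)).toSquareBlock (fun s => ∑ i ∈ s, w i) a = 1 := by
        ext s t
        rw [Matrix.toSquareBlock_def, Matrix.of_apply, Matrix.of_apply,
          hval _ _ (t.2.trans s.2.symm).le, Matrix.one_apply]
        congr 1
        rw [eq_iff_iff, Subtype.ext_iff, eq_comm]
      rw [this, Matrix.det_one]
  let bas := Module.Basis.mk (linearIndependent_of_isUnit_det hdet) hv.ge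
  exact ⟨Module.Free.of_basis bas, Module.Finite.of_basis bas, φ,
    bijective_dualMap_of_isUnit_det hdet hv hu⟩

end QuadraticAlgebra

section Annihilator

/-- If the ideal `M` of a free algebra with perfect duality has projective quotient and is generated
by `f` up to torsion, then the principal ideal of `f` is projective. -/
theorem projective_of_torsion {A B : Type} [CommRing A] [IsDomain A] [CommRing B] [Algebra A B]
    [Module.Free A B] [Module.Finite A B] {φ : B →ₗ[A] A} (hφ : Function.Bijective (dualMap φ))
    (f : B) (M : Ideal B) (hf : f ∈ M) [Module.Projective A (B ⧸ M)] {a : A} (ha : a ≠ 0)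
    (haM : ∀ b ∈ M, a • b ∈ Ideal.span {f}) :
    Module.Projective A (Ideal.span {f}) := by
  let M' : Submodule A B := M.restrictScalars A
  obtain ⟨σ, hσ⟩ := Module.projective_lifting_property (Ideal.Quotient.mkₐ A M).toLinearMap
    LinearMap.id (Ideal.Quotient.mkₐ_surjective A M)
  have hσ' (x : B ⧸ M) : Ideal.Quotient.mk M (σ x) = x := LinearMap.congr_fun hσ x
  let π : B →ₗ[A] M' := (LinearMap.id - σ ∘ₗ (Ideal.Quotient.mkₐ A M).toLinearMap).codRestrict M'
    fun b => by
      change b - σ (Ideal.Quotient.mk M b) ∈ M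
      rw [← Ideal.Quotient.eq_zero_iff_mem, map_sub, hσ', sub_self]
  have hπ (x : M') : π x = x := by
    ext
    change x.1 - σ (Ideal.Quotient.mk M x.1) = x.1
    rw [Ideal.Quotient.eq_zero_iff_mem.2 x.2, map_zero, sub_zero]
  have : Module.Projective A M' := Module.Projective.of_split M'.subtype π (LinearMap.ext hπ)
  have : Module.Finite A M' := Module.Finite.of_surjective π fun x => ⟨x, hπ x⟩
  let β : B →ₗ[A] Module.Dual A M' := (Module.Dual.transpose M'.subtype) ∘ₗ dualMap φ
  have hβ : Function.Surjective β := by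
    intro l
    obtain ⟨b, hb⟩ := hφ.2 (l ∘ₗ π)
    refine ⟨b, LinearMap.ext fun x => ?_⟩
    change dualMap φ b x = l x
    rw [hb, LinearMap.comp_apply, hπ]
  let μ : B →ₗ[A] Ideal.span {f} := (LinearMap.mulRight A f).codRestrict
    ((Ideal.span {f}).restrictScalars A) fun b => Ideal.mul_mem_left _ _ (Ideal.mem_span_singleton_self f)
  have hμ : Function.Surjective μ := by
    rintro ⟨x, hx⟩
    obtain ⟨b, rfl⟩ := Ideal.mem_span_singleton'.1 hx
    exact ⟨b, rfl⟩
  have hker : LinearMap.ker β = LinearMap.ker μ := by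
    ext b
    have h1 : b ∈ LinearMap.ker μ ↔ b * f = 0 := by
      rw [LinearMap.mem_ker, Subtype.ext_iff]
      rfl
    have h2 : b ∈ LinearMap.ker β ↔ ∀ x ∈ M, φ (b * x) = 0 := by
      rw [LinearMap.mem_ker, LinearMap.ext_iff]
      exact ⟨fun h x hx => h ⟨x, hx⟩, fun h x => h x.1 x.2⟩
    rw [h1, h2]
    constructor
    · intro h
      refine (injective_iff_map_eq_zero _).1 hφ.1 _ (LinearMap.ext fun c => ?_)
      rw [dualMap_apply, mul_assoc]
      exact h _ (M.mul_mem_right _ hf)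
    · intro h x hx
      obtain ⟨c, hc⟩ := Ideal.mem_span_singleton'.1 (haM x hx)
      have : a • (b * x) = 0 := by
        rw [← mul_smul_comm, ← hc, mul_left_comm, h, mul_zero]
      rw [(smul_eq_zero.1 this).resolve_left ha, map_zero]
  exact Module.Projective.of_equiv ((β.quotKerEquivOfSurjective hβ).symm ≪≫ₗ
    Submodule.quotEquivOfEq _ _ hker ≪≫ₗ μ.quotKerEquivOfSurjective hμ)

end Annihilator

section PathAlgebra

open MvPolynomial

variable {A : Type} [CommRing A] (N : ℕ) (α : ℕ → A)

/-- The sequence `0, X 0, …, X (N - 1), α (N + 1)`. -/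
noncomputable def pathX (k : ℕ) : MvPolynomial (Fin N) A :=
  if k = 0 then 0 else if h : k - 1 < N then X ⟨k - 1, h⟩ else C (α k)

@[simp]
lemma pathX_zero : pathX N α 0 = 0 := if_pos rfl

lemma pathX_succ (i : Fin N) : pathX N α (i + 1) = X i := by
  simp [pathX]

lemma pathX_last : pathX N α (N + 1) = C (α (N + 1)) := by
  simp [pathX]

/-- The lower order part of the `i`-th edge relation of the path. -/
noncomputable def pathTail (i : Fin N) : MvPolynomial (Fin N) A :=
  C (α (i + 1)) * X i + pathX N α (i + 2) * pathX N α i - C (α i) * pathX N α (i + 2)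

/-- The relation of the edge closing the path to a cycle. -/
noncomputable def closingRelation : MvPolynomial (Fin N) A :=
  C (α (N + 1)) * -C (α 0) - pathX N α 1 * (pathX N α N - C (α N))

/-- The weights for which the edge relations have leading forms `X i ^ 2`. -/
def pathWeight (i : Fin N) : ℕ := (i + 1) * (N - i)

lemma hasWeightLE_pathX {k : ℕ} (hk : k ≤ N + 1) :
    HasWeightLE (pathWeight N) (k * (N + 1 - k)) (pathX N α k) := by
  rw [pathX]
  split_ifs with h0 h1
  · exact hasWeightLE_zero
  · convert hasWeightLE_X (A := A) (w := pathWeight N) ⟨k - 1, h1⟩ using 1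
    simp only [pathWeight]
    congr 1 <;> lia
  · exact (hasWeightLE_C _).mono (Nat.zero_le _)

lemma hasWeightLE_pathTail (i : Fin N) :
    ∃ c < 2 * pathWeight N i, HasWeightLE (pathWeight N) c (pathTail N α i) := by
  obtain ⟨t, ht⟩ : ∃ t, N = i.val + 1 + t := ⟨N - (i.val + 1), by lia⟩
  have hw : pathWeight N i = i.val * t + i.val + t + 1 := by
    rw [pathWeight, show N - i.val = t + 1 by lia]
    ring
  have h2 := hasWeightLE_pathX N α (k := i.val + 2) (by lia)
  have h0 := hasWeightLE_pathX N α (k := i.val) (by lia)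
  rw [show N + 1 - (i.val + 2) = t by lia] at h2
  rw [show N + 1 - i.val = t + 2 by lia] at h0
  refine ⟨2 * (i.val * t) + 2 * i.val + 2 * t + 1, by rw [hw]; lia,
    (HasWeightLE.add ?_ ?_).sub ?_⟩
  · refine ((hasWeightLE_C _).mul (hasWeightLE_X _)).mono ?_
    rw [hw]
    lia
  · refine (h2.mul h0).mono ?_
    ring_nf
    lia
  · refine ((hasWeightLE_C _).mul h2).mono ?_
    ring_nf
    lia

variable {N α} {D : Type} [CommRing D] [Algebra A D]

lemma aeval_pathX {ξ : ℕ → D} (h0 : ξ 0 = 0) (hlast : ξ (N + 1) = algebraMap A D (α (N + 1)))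
    {k : ℕ} (hk : k ≤ N + 1) :
    aeval (fun i : Fin N => ξ (i + 1)) (pathX N α k) = ξ k := by
  rw [pathX]
  split_ifs with h h'
  · rw [h, h0, map_zero]
  · rw [aeval_X]
    congr 1
    simp only
    lia
  · obtain rfl : k = N + 1 := by lia
    rw [hlast, algHom_C]

lemma algHom_mem_span {q : MvPolynomial (Fin N) A →ₐ[A] D} {W : Submodule A D} (h1 : 1 ∈ W)
    (hW : ∀ (i : Fin N), ∀ x ∈ W, x * q (X i) ∈ W) (h : MvPolynomial (Fin N) A) : q h ∈ W := by
  induction h using MvPolynomial.induction_on with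
  | C a =>
    rw [algHom_C, Algebra.algebraMap_eq_smul_one]
    exact W.smul_mem _ h1
  | add p q hp hq =>
    rw [map_add]
    exact W.add_mem hp hq
  | mul_X p i hp =>
    rw [map_mul]
    exact hW i _ hp

/-- The candidate basis `1, x 1, …, x N`. -/
def pathBasis (N : ℕ) {D : Type} [CommRing D] (x : ℕ → D) (j : Fin (N + 1)) : D :=
  if j.val = 0 then 1 else x j

/-- At the point `α = (-1, 0, …, 0, 1)`, the cycle relations define the algebra of `N + 1`-st roots
of unity. -/
lemma mem_span_pathBasis_of_special (hN : 0 < N) (q : MvPolynomial (Fin N) A →ₐ[A] D)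
    (hq : ∀ i, q (X i ^ 2) = q (pathTail N α i)) (hf : q (closingRelation N α) = 0)
    (h0 : algebraMap A D (α 0) = -1) (hlast : algebraMap A D (α (N + 1)) = 1)
    (hα : ∀ i, 0 < i → i ≤ N → algebraMap A D (α i) = 0) (h : MvPolynomial (Fin N) A) :
    q h ∈ Submodule.span A (Set.range (pathBasis N fun k => q (pathX N α k))) := by
  set z : ℕ → D := fun k => q (pathX N α k) with hz
  have hz0 : z 0 = 0 := by simp [hz]
  have hzlast : z (N + 1) = 1 := by simp only [hz, pathX_last, algHom_C, hlast]
  have hf1 : z 1 * z N = 1 := by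
    have : q (closingRelation N α) = 1 - z 1 * z N := by
      simp [closingRelation, hz, h0, hlast, hα N hN le_rfl]
    rw [hf] at this
    linear_combination this
  have hunit : IsUnit (z 1) := IsUnit.of_mul_eq_one _ hf1
  have hrel (i : ℕ) (hi : i < N) : z (i + 1) ^ 2 = z (i + 2) * (z i - algebraMap A D (α i)) := by
    have := hq ⟨i, hi⟩
    rw [← pathX_succ N α ⟨i, hi⟩] at this
    simp only [map_pow, pathTail, map_sub, map_add, map_mul, algHom_C,
      hα (i + 1) (by lia) (by lia)] at this
    simp only [hz]
    linear_combination this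
  have hpow (k : ℕ) (hk : k ≤ N) : (0 < k → z k = z 1 ^ k) ∧ z (k + 1) = z 1 ^ (k + 1) := by
    induction k with
    | zero => simp
    | succ k ih =>
      have ih := ih (by lia)
      refine ⟨fun _ => ih.2, ?_⟩
      have h1 := hrel k (by lia)
      by_cases hk0 : k = 0
      · subst hk0
        rw [h0, hz0] at h1
        linear_combination -h1
      · rw [hα k (by lia) (by lia), ih.2, ih.1 (by lia)] at h1
        refine (hunit.pow k).mul_right_cancel ?_
        linear_combination -h1
  have hbasis (j : Fin (N + 1)) : pathBasis N z j = z 1 ^ j.val := by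
    rw [pathBasis]
    split_ifs with hj
    · rw [hj, pow_zero]
    · exact (hpow j (by lia)).1 (by lia)
  have hone : z 1 ^ (N + 1) = 1 := by rw [← (hpow N le_rfl).2, hzlast]
  have hmem (k : ℕ) : z 1 ^ k ∈ Submodule.span A (Set.range (pathBasis N z)) := by
    refine Submodule.subset_span ⟨⟨k % (N + 1), Nat.mod_lt _ (by lia)⟩, ?_⟩
    rw [hbasis, ← pow_eq_pow_mod k hone]
  refine algHom_mem_span (by simpa using hmem 0) (fun i x hx => ?_) h
  rw [← pathX_succ N α i]
  change x * z (i + 1) ∈ _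
  rw [(hpow i (by lia)).2]
  induction hx using Submodule.span_induction with
  | mem x hx =>
    obtain ⟨j, rfl⟩ := hx
    rw [hbasis, ← pow_add]
    exact hmem _
  | zero => simp
  | add x y _ _ hx hy =>
    rw [add_mul]
    exact Submodule.add_mem _ hx hy
  | smul a x _ hx =>
    rw [smul_mul_assoc]
    exact Submodule.smul_mem _ _ hx

end PathAlgebra

section ChainAlgebra

open MvPolynomial

variable {A D : Type} [CommRing A] [CommRing D] [Algebra A D] {N : ℕ} {α : ℕ → A} {ξ : ℕ → D} {b : D}
  (h0 : ξ 0 = 0) (hlast : ξ (N + 1) = algebraMap A D (α (N + 1)))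
  (hξ : ∀ k ≤ N, ξ k = algebraMap A D (α k) + b * ξ (k + 1))

include h0 hlast

lemma mem_span_pathBasis {k : ℕ} (hk : k ≤ N + 1) :
    ξ k ∈ Submodule.span A (Set.range (pathBasis N ξ)) := by
  have h1 : (1 : D) ∈ Submodule.span A (Set.range (pathBasis N ξ)) :=
    Submodule.subset_span ⟨0, by simp [pathBasis]⟩
  by_cases hk0 : k = 0
  · rw [hk0, h0]
    exact zero_mem _
  by_cases hkN : k = N + 1
  · rw [hkN, hlast, Algebra.algebraMap_eq_smul_one]
    exact Submodule.smul_mem _ _ h1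
  · exact Submodule.subset_span ⟨⟨k, by lia⟩, if_neg hk0⟩

include hξ

lemma aeval_pathTail (i : Fin N) :
    aeval (R := A) (fun i : Fin N => ξ (i + 1)) (X i ^ 2) =
      aeval (fun i : Fin N => ξ (i + 1)) (pathTail N α i) := by
  simp only [pathTail, map_pow, aeval_X, map_add, map_sub, map_mul, algHom_C,
    aeval_pathX h0 hlast (show i.val + 2 ≤ N + 1 by lia),
    aeval_pathX h0 hlast (show i.val ≤ N + 1 by lia)]
  linear_combination ξ (i + 1) * hξ (i + 1) (by lia) - ξ (i + 2) * hξ i (by lia)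

lemma aeval_closingRelation : aeval (fun i : Fin N => ξ (i + 1)) (closingRelation N α) = 0 := by
  simp only [closingRelation, map_sub, map_mul, map_neg, algHom_C,
    aeval_pathX h0 hlast (show 1 ≤ N + 1 by lia), aeval_pathX h0 hlast (show N ≤ N + 1 by lia)]
  linear_combination (-ξ 1) * hξ N le_rfl + algebraMap A D (α (N + 1)) * (hξ 0 (by lia)) -
    algebraMap A D (α (N + 1)) * h0 - ξ 1 * b * hlast

lemma mul_mem_span_pathBasis {i j : ℕ} (hi : i ≤ N + 1) (hj : j ≤ N + 1) :
    ξ i * ξ j ∈ Submodule.span A (Set.range (pathBasis N ξ)) := by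
  induction i generalizing j with
  | zero =>
    rw [h0, zero_mul]
    exact zero_mem _
  | succ i ih =>
    by_cases hjN : j = N + 1
    · rw [hjN, hlast, mul_comm, ← Algebra.smul_def]
      exact Submodule.smul_mem _ _ (mem_span_pathBasis h0 hlast hi)
    · have : ξ (i + 1) * ξ j = α j • ξ (i + 1) + ξ i * ξ (j + 1) - α i • ξ (j + 1) := by
        rw [Algebra.smul_def, Algebra.smul_def]
        linear_combination ξ (i + 1) * hξ j (by lia) - ξ (j + 1) * hξ i (by lia)
      rw [this]
      exact sub_mem (add_mem (Submodule.smul_mem _ _ (mem_span_pathBasis h0 hlast hi))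
        (ih (by lia) (by lia))) (Submodule.smul_mem _ _ (mem_span_pathBasis h0 hlast (by lia)))

lemma range_aeval_eq_span :
    (aeval (R := A) fun i : Fin N => ξ (i + 1)).toLinearMap.range =
      Submodule.span A (Set.range (pathBasis N ξ)) := by
  apply le_antisymm
  · rintro _ ⟨h, rfl⟩
    rw [AlgHom.toLinearMap_apply]
    refine algHom_mem_span (W := Submodule.span A (Set.range (pathBasis N ξ)))
      (Submodule.subset_span ⟨0, by simp [pathBasis]⟩) (fun i x hx => ?_) h
    rw [aeval_X]
    induction hx using Submodule.span_induction with
    | mem x hx =>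
      obtain ⟨j, rfl⟩ := hx
      rw [pathBasis]
      split_ifs with hj
      · rw [one_mul]
        exact mem_span_pathBasis h0 hlast (by lia)
      · exact mul_mem_span_pathBasis h0 hlast hξ (by lia) (by lia)
    | zero => simp
    | add x y _ _ hx hy =>
      rw [add_mul]
      exact Submodule.add_mem _ hx hy
    | smul a x _ hx =>
      rw [smul_mul_assoc]
      exact Submodule.smul_mem _ _ hx
  · rw [Submodule.span_le]
    rintro _ ⟨j, rfl⟩
    rw [pathBasis]
    split_ifs with hj
    · exact ⟨1, map_one (aeval (R := A) fun i : Fin N => ξ (i + 1))⟩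
    · refine ⟨X ⟨j - 1, by lia⟩, ?_⟩
      rw [AlgHom.toLinearMap_apply, aeval_X]
      congr 1
      simp only
      lia

end ChainAlgebra

section Horner

open Polynomial

variable {A : Type} [CommRing A] (α : ℕ → A) (n : ℕ)

/-- The polynomial `α k + α (k + 1) X + ⋯ + α (n - 1) X ^ (n - 1 - k)`. -/
noncomputable def hornerTail (k : ℕ) : A[X] := ∑ j ∈ Finset.range (n - k), C (α (k + j)) * X ^ j

lemma hornerTail_eq {k : ℕ} (hk : k < n) :
    hornerTail α n k = C (α k) + X * hornerTail α n (k + 1) := by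
  rw [hornerTail, show n - k = n - (k + 1) + 1 by lia, Finset.sum_range_succ', hornerTail,
    Finset.mul_sum, add_comm]
  congr 1
  · simp
  · refine Finset.sum_congr rfl fun j _ => ?_
    rw [show k + 1 + j = k + (j + 1) by ring]
    ring

lemma hornerTail_self : hornerTail α n n = 0 := by simp [hornerTail]

lemma degree_hornerTail {k : ℕ} (hk : k < n) (hα : α (n - 1) ≠ 0) :
    (hornerTail α n k).degree = ((n - 1 - k : ℕ) : WithBot ℕ) := by
  rw [hornerTail, show n - k = (n - 1 - k) + 1 by lia, Finset.sum_range_succ,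
    degree_add_eq_right_of_degree_lt] <;>
  rw [degree_C_mul_X_pow _ (by rwa [show k + (n - 1 - k) = n - 1 by lia])]
  refine (degree_sum_le _ _).trans_lt ((Finset.sup_lt_iff (WithBot.bot_lt_coe _)).2 fun j hj => ?_)
  exact (degree_C_mul_X_pow_le _ _).trans_lt (by exact_mod_cast Finset.mem_range.1 hj)

variable [IsDomain A] (N : ℕ) (hα : α (N + 1) ≠ 0)

include hα in
lemma linearIndependent_pathBasis_hornerTail :
    LinearIndependent A (pathBasis N fun k =>
      AdjoinRoot.mk (hornerTail α (N + 2) 0) (hornerTail α (N + 2) k)) := by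
  let S : Polynomial.Sequence A :=
    { elems' := fun i => if 0 < i ∧ i ≤ N then hornerTail α (N + 2) (N + 1 - i) else X ^ i
      degree_eq' := fun i => by
        split_ifs with hi
        · rw [degree_hornerTail α _ (by lia) hα]
          congr 1
          lia
        · rw [degree_X_pow] }
  let idx (j : Fin (N + 1)) : ℕ := if j.val = 0 then 0 else N + 1 - j
  have hidx : Function.Injective idx := fun i j h => by
    simp only [idx] at h
    ext
    split_ifs at h <;> lia
  have hlin := S.linearIndependent.comp idx hidx
  have hb : (pathBasis N fun k =>
      AdjoinRoot.mk (hornerTail α (N + 2) 0) (hornerTail α (N + 2) k)) =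
      (AdjoinRoot.mkₐ (hornerTail α (N + 2) 0)).toLinearMap ∘ (S ∘ idx) := by
    funext j
    simp only [pathBasis, Function.comp_apply, idx, S, AlgHom.toLinearMap_apply]
    split_ifs with hj h h
    · lia
    · simp
    · rw [show N + 1 - (N + 1 - j.val) = j by lia]
      rfl
    · lia
  rw [hb]
  refine hlin.map ?_
  rw [Submodule.disjoint_def]
  intro p hp hp0
  have hdvd : hornerTail α (N + 2) 0 ∣ p := AdjoinRoot.mk_eq_zero.1 hp0
  refine eq_zero_of_dvd_of_degree_lt hdvd ?_
  rw [degree_hornerTail α _ (by lia) hα, ← mem_degreeLT]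
  refine Submodule.span_le.2 ?_ hp
  rintro _ ⟨j, rfl⟩
  rw [SetLike.mem_coe, mem_degreeLT, Function.comp_apply, S.degree_eq]
  simp only [idx]
  split_ifs <;> norm_cast <;> lia

end Horner

section PathProjective

open MvPolynomial

variable {A : Type} [CommRing A] {N : ℕ} {α : ℕ → A}

lemma map_pathBasis {B D : Type} [CommRing B] [CommRing D] [Algebra A B] [Algebra A D]
    (q : B →ₐ[A] D) (x : ℕ → B) : q ∘ pathBasis N x = pathBasis N (q ∘ x) := by
  funext j
  simp only [Function.comp_apply, pathBasis]
  split_ifs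
  · exact map_one q
  · rfl

lemma exists_smul_mem_span_pathBasis (hN : 0 < N) {k : Type} [CommRing k] [Nontrivial k] (pt : A →+* k)
    (hpt0 : pt (α 0) = -1) (hptlast : pt (α (N + 1)) = 1)
    (hpt : ∀ i, 0 < i → i ≤ N → pt (α i) = 0)
    {B : Type} [CommRing B] [Algebra A B] [Module.Finite A B]
    (θ : MvPolynomial (Fin N) A →ₐ[A] B) (hθ : Function.Surjective θ)
    (hrel : ∀ i, θ (X i ^ 2) = θ (pathTail N α i)) (hf : θ (closingRelation N α) = 0) :
    ∃ r : A, r ≠ 0 ∧ ∀ b : B,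
      r • b ∈ Submodule.span A (Set.range (pathBasis N fun k => θ (pathX N α k))) := by
  set W := Submodule.span A (Set.range (pathBasis N fun k => θ (pathX N α k))) with hW
  set I := RingHom.ker pt with hI
  let π := Ideal.Quotient.mkₐ A (I.map (algebraMap A B))
  have hval {a c : A} (h : pt a = pt c) : algebraMap A (B ⧸ I.map (algebraMap A B)) a =
      algebraMap A (B ⧸ I.map (algebraMap A B)) c := by
    rw [← sub_eq_zero, ← map_sub, ← Ideal.Quotient.mk_algebraMap, Ideal.Quotient.eq_zero_iff_mem]
    exact Ideal.mem_map_of_mem _ (by rw [hI, RingHom.mem_ker, map_sub, h, sub_self])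
  have hspan (b : B) : b ∈ W ⊔ I • (⊤ : Submodule A B) := by
    obtain ⟨h, rfl⟩ := hθ b
    have := mem_span_pathBasis_of_special hN (π.comp θ)
      (fun i => by rw [AlgHom.comp_apply, hrel, AlgHom.comp_apply])
      (by rw [AlgHom.comp_apply, hf, map_zero])
      (by rw [hval (c := -1) (by simpa using hpt0), map_neg, map_one])
      (by rw [hval (c := 1) (by simpa using hptlast), map_one])
      (fun i h1 h2 => by rw [hval (c := 0) (by simpa using hpt i h1 h2), map_zero]) h
    have hmap : (pathBasis N fun k => (π.comp θ) (pathX N α k)) =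
        π.toLinearMap ∘ pathBasis N fun k => θ (pathX N α k) :=
      (map_pathBasis π fun k => θ (pathX N α k)).symm
    rw [hmap, Set.range_comp, ← Submodule.map_span] at this
    obtain ⟨w, hw, hwh⟩ := this
    rw [← add_sub_cancel w (θ h)]
    refine Submodule.add_mem_sup hw ?_
    rw [Ideal.smul_top_eq_map, Submodule.restrictScalars_mem]
    exact Ideal.Quotient.eq.1 hwh.symm
  obtain ⟨r, hr1, hr⟩ := Submodule.exists_sub_one_mem_and_smul_le_of_fg_of_le_sup
    (Module.Finite.fg_top (R := A) (M := B)) le_rfl fun b _ => hspan b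
  refine ⟨r, ?_, fun b => hr (Submodule.smul_mem_pointwise_smul b r ⊤ trivial)⟩
  rintro rfl
  rw [hI, RingHom.mem_ker, map_sub, map_zero, map_one, zero_sub, neg_eq_zero] at hr1
  exact one_ne_zero hr1

/-- The path algebra is free over `A`, and so is the ideal generated in it by the closing
relation. -/
theorem projective_path [IsDomain A] (hN : 0 < N) (hα : α (N + 1) ≠ 0) {k : Type} [CommRing k]
    [Nontrivial k] (pt : A →+* k) (hpt0 : pt (α 0) = -1) (hptlast : pt (α (N + 1)) = 1)
    (hpt : ∀ i, 0 < i → i ≤ N → pt (α i) = 0) {B : Type} [CommRing B] [Algebra A B]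
    (θ : MvPolynomial (Fin N) A →ₐ[A] B) (hθ : Function.Surjective θ)
    (hrel : ∀ i, θ (X i ^ 2) = θ (pathTail N α i))
    (hker : ∀ p, θ p = 0 → p ∈ Ideal.span (Set.range fun i => X i ^ 2 - pathTail N α i)) :
    Module.Projective A B ∧ Module.Projective A (Ideal.span {θ (closingRelation N α)}) := by
  obtain ⟨_, _, φ, hφ⟩ := free_and_bijective_dualMap θ (hasWeightLE_pathTail N α) hrel hθ hker
  refine ⟨inferInstance, ?_⟩
  let ξ (k : ℕ) := AdjoinRoot.mk (hornerTail α (N + 2) 0) (hornerTail α (N + 2) k)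
  have h0 : ξ 0 = 0 := AdjoinRoot.mk_self
  have hξ : ∀ k ≤ N + 1, ξ k = algebraMap A _ (α k) + AdjoinRoot.root _ * ξ (k + 1) :=
    fun k hk => by
      simp only [ξ]
      rw [hornerTail_eq α _ (by lia : k < N + 2), map_add, map_mul, AdjoinRoot.mk_X,
        AdjoinRoot.mk_C, AdjoinRoot.algebraMap_eq]
  have hlast : ξ (N + 1) = algebraMap A _ (α (N + 1)) := by
    rw [hξ _ le_rfl]
    simp only [ξ]
    rw [hornerTail_self, map_zero, mul_zero, add_zero]
  replace hξ : ∀ k ≤ N, _ := fun k hk => hξ k (by lia)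
  have hlin : LinearIndependent A (pathBasis N ξ) := linearIndependent_pathBasis_hornerTail α N hα
  let ψ := aeval (R := A) fun i : Fin N => ξ (i + 1)
  have hkerψ : RingHom.ker θ.toRingHom ≤ RingHom.ker ψ.toRingHom := fun p hp => by
    refine (Ideal.span_le.2 ?_ : Ideal.span _ ≤ _) (hker p hp)
    rintro _ ⟨i, rfl⟩
    rw [SetLike.mem_coe, RingHom.mem_ker, map_sub, sub_eq_zero]
    exact aeval_pathTail h0 hlast hξ i
  let ψ' := AlgHom.liftOfSurjective θ hθ ψ hkerψ
  have hψ' (p) : ψ' (θ p) = ψ p := AlgHom.liftOfSurjective_apply ..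
  have hf : ψ' (θ (closingRelation N α)) = 0 := by
    rw [hψ']
    exact aeval_closingRelation h0 hlast hξ
  have hrange : (Ideal.kerLiftAlg ψ').toLinearMap.range =
      Submodule.span A (Set.range (pathBasis N ξ)) := by
    rw [← range_aeval_eq_span h0 hlast hξ]
    ext c
    constructor
    · rintro ⟨x, rfl⟩
      obtain ⟨y, rfl⟩ := Ideal.Quotient.mk_surjective x
      obtain ⟨p, rfl⟩ := hθ y
      exact ⟨p, (hψ' p).symm⟩
    · rintro ⟨p, rfl⟩
      exact ⟨Ideal.Quotient.mk _ (θ p), hψ' p⟩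
  have : Module.Projective A (B ⧸ RingHom.ker ψ') := by
    have : Module.Free A (Ideal.kerLiftAlg ψ').toLinearMap.range := by
      rw [hrange]
      exact .of_basis (.span hlin)
    exact .of_equiv
      (LinearEquiv.ofInjective (Ideal.kerLiftAlg ψ').toLinearMap (Ideal.kerLiftAlg_injective ψ')).symm
  let μ := Ideal.Quotient.mkₐ A (Ideal.span {θ (closingRelation N α)})
  have : Module.Finite A (B ⧸ Ideal.span {θ (closingRelation N α)}) :=
    .of_surjective μ.toLinearMap Ideal.Quotient.mk_surjective
  obtain ⟨r, hr0, hr⟩ := exists_smul_mem_span_pathBasis hN pt hpt0 hptlast hpt (μ.comp θ)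
    (Ideal.Quotient.mk_surjective.comp hθ)
    (fun i => by rw [AlgHom.comp_apply, hrel, AlgHom.comp_apply])
    (Ideal.Quotient.eq_zero_iff_mem.2 (Ideal.mem_span_singleton_self _))
  refine projective_of_torsion hφ _ (RingHom.ker ψ') hf hr0 fun b hb => ?_
  obtain ⟨c, hc⟩ := (Submodule.mem_span_range_iff_exists_fun A).1 (hr (μ b))
  have hmap : (pathBasis N fun k => (μ.comp θ) (pathX N α k)) =
      μ ∘ pathBasis N fun k => θ (pathX N α k) :=
    (map_pathBasis μ fun k => θ (pathX N α k)).symm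
  have hmem : r • b - ∑ j, c j • pathBasis N (fun k => θ (pathX N α k)) j ∈
      Ideal.span {θ (closingRelation N α)} := by
    refine Ideal.Quotient.eq.1 (?_ : μ _ = μ _)
    rw [map_smul, ← hc, hmap, map_sum]
    simp
  have hzero : ∑ j, c j • pathBasis N ξ j = 0 := by
    have h1 : Ideal.span {θ (closingRelation N α)} ≤ RingHom.ker ψ' :=
      (Ideal.span_singleton_le_iff_mem _).2 hf
    have h2 := h1 hmem
    rw [RingHom.mem_ker, map_sub, map_smul, RingHom.mem_ker.1 hb, smul_zero, zero_sub, neg_eq_zero,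
      map_sum] at h2
    rw [← h2]
    refine Finset.sum_congr rfl fun j _ => ?_
    rw [map_smul, ← Function.comp_apply (f := ψ'), map_pathBasis]
    congr 1
    simp only [pathBasis, Function.comp_apply, hψ', ψ]
    rw [aeval_pathX h0 hlast (by lia)]
  have hc0 := Fintype.linearIndependent_iff.1 hlin c hzero
  simpa [hc0] using hmem

end PathProjective

section PathResolution

open MvPolynomial CategoryTheory

/-- A polynomial ring over `A` modulo the path relations and the closing relation. -/
theorem hasProjectiveDimensionLE_of_path {A S : Type} [CommRing A] [IsDomain A] [CommRing S]
    [Algebra A S] {N : ℕ} {α : ℕ → A} (hN : 0 < N) (hα : α (N + 1) ≠ 0) {k : Type} [CommRing k]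
    [Nontrivial k] (pt : A →+* k) (hpt0 : pt (α 0) = -1) (hptlast : pt (α (N + 1)) = 1)
    (hpt : ∀ i, 0 < i → i ≤ N → pt (α i) = 0) (e : MvPolynomial (Fin N) A ≃ₐ[A] S) {J : Ideal S}
    (hJ : J = Ideal.span (Set.range fun i => e (X i ^ 2 - pathTail N α i)) ⊔
      Ideal.span {e (closingRelation N α)}) :
    HasProjectiveDimensionLE (ModuleCat.of S (S ⧸ J)) (N + 1) := by
  set J' := Ideal.span (Set.range fun i => e (X i ^ 2 - pathTail N α i)) with hJ'
  let θ : MvPolynomial (Fin N) A →ₐ[A] S ⧸ J' := (Ideal.Quotient.mkₐ A J').comp e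
  obtain ⟨_, _⟩ := projective_path hN hα pt hpt0 hptlast hpt θ
    (Ideal.Quotient.mk_surjective.comp e.surjective)
    (fun i => Ideal.Quotient.eq.2 (by
      rw [← map_sub]
      exact Ideal.subset_span ⟨i, rfl⟩))
    (fun p hp => by
      have hp : e p ∈ J' := Ideal.Quotient.eq_zero_iff_mem.1 hp
      have hmap : J' = (Ideal.span (Set.range fun i => X i ^ 2 - pathTail N α i)).map
          e.toRingEquiv := by
        rw [Ideal.map_span, ← Set.range_comp]
        rfl
      rw [hmap] at hp
      obtain ⟨q, hq, hqp⟩ := (Ideal.mem_map_of_equiv e.toRingEquiv _).1 hp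
      rwa [← e.injective hqp])
  have hle : J' ≤ J := hJ ▸ le_sup_left
  let F := Ideal.span {θ (closingRelation N α)}
  let f : F →ₗ[S] S ⧸ J' := F.subtype.restrictScalars S
  let g : (S ⧸ J') →ₗ[S] S ⧸ J := (Ideal.Quotient.factorₐ S hle).toLinearMap
  have hex : Function.Exact f g := fun x => by
    obtain ⟨x, rfl⟩ := Ideal.Quotient.mk_surjective x
    have h1 : g (Ideal.Quotient.mk J' x) = 0 ↔ x ∈ J := Ideal.Quotient.eq_zero_iff_mem
    have h2 : Ideal.Quotient.mk J' x ∈ Set.range f ↔ Ideal.Quotient.mk J' x ∈ F := by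
      exact ⟨fun ⟨y, hy⟩ => hy ▸ y.2, fun h => ⟨⟨_, h⟩, rfl⟩⟩
    have h3 : F = (Ideal.span {e (closingRelation N α)}).map (Ideal.Quotient.mk J') := by
      rw [Ideal.map_span, Set.image_singleton]
      rfl
    rw [h1, h2, h3, hJ, Ideal.mem_quotient_iff_mem_sup, sup_comm]
  have hS := ModuleCat.shortComplex_shortExact (ModuleCat.shortComplexOfCompEqZero _ _
    hex.linearMap_comp_eq_zero) hex Subtype.val_injective
    (Ideal.Quotient.factor_surjective hle)
  have h1 : HasProjectiveDimensionLE (ModuleCat.of S F) N :=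
    hasProjectiveDimensionLE_of_algEquiv_mvPolynomial N e
  have h2 : HasProjectiveDimensionLE (ModuleCat.of S (S ⧸ J')) N :=
    hasProjectiveDimensionLE_of_algEquiv_mvPolynomial N e
  exact hS.hasProjectiveDimensionLT_X₃ (N + 1) h1 (hasProjectiveDimensionLT_of_ge _ (N + 1) _ (by lia))

end PathResolution

section CycleCoordinates

open MvPolynomial

variable (m : ℕ) (K : Type) [Field K]

/-- The coefficient ring of the path algebra of a cycle. -/
abbrev CoeffRing : Type := MvPolynomial (Fin (m + 5)) K

/-- The coefficients of the path relations of a cycle. -/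
noncomputable def cycleCoeff (k : ℕ) : CoeffRing m K :=
  if h : k < m + 5 then X ⟨k, h⟩ else 0

/-- The sequence `0, x_0, x_1, …`. -/
noncomputable def cycleX (k : ℕ) : CycleRing m K :=
  if h : 0 < k ∧ k < m + 5 then X (Sum.inl ⟨k - 1, by lia⟩) else 0

/-- The sequence `y_0, y_1, …, 0`. -/
noncomputable def cycleY (k : ℕ) : CycleRing m K :=
  if h : k < m + 4 then X (Sum.inr ⟨k, h⟩) else 0

lemma cycleX_zero : cycleX m K 0 = 0 := dif_neg (by simp)

lemma cycleX_succ (v : Fin (m + 4)) : cycleX m K (v + 1) = X (Sum.inl v) :=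
  dif_pos ⟨by lia, by lia⟩

lemma cycleY_val (v : Fin (m + 4)) : cycleY m K v = X (Sum.inr v) :=
  dif_pos v.isLt

lemma cycleY_last : cycleY m K (m + 4) = 0 := dif_neg (by simp)

/-- The embedding of the coefficient ring given by the differences of the two sequences. -/
noncomputable def coeffHom : CoeffRing m K →ₐ[K] CycleRing m K :=
  aeval fun k => cycleX m K k - cycleY m K k

lemma coeffHom_cycleCoeff {k : ℕ} (hk : k < m + 5) :
    coeffHom m K (cycleCoeff m K k) = cycleX m K k - cycleY m K k := by
  rw [cycleCoeff, dif_pos hk, coeffHom, aeval_X]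

noncomputable instance : Algebra (CoeffRing m K) (CycleRing m K) := (coeffHom m K).toAlgebra

lemma algebraMap_cycleCoeff {k : ℕ} (hk : k < m + 5) :
    algebraMap (CoeffRing m K) (CycleRing m K) (cycleCoeff m K k) =
      cycleX m K k - cycleY m K k :=
  coeffHom_cycleCoeff m K hk

/-- The coordinate change identifying the polynomial ring of a cycle with the polynomial ring in
which the path relations are written. -/
noncomputable def pathToCycle :
    MvPolynomial (Fin (m + 3)) (CoeffRing m K) →ₐ[CoeffRing m K] CycleRing m K :=
  aeval fun i => cycleX m K (i + 1)

lemma pathToCycle_pathX {k : ℕ} (hk : k ≤ m + 4) :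
    pathToCycle m K (pathX (m + 3) (cycleCoeff m K) k) = cycleX m K k :=
  aeval_pathX (cycleX_zero m K)
    (by rw [algebraMap_cycleCoeff m K (by lia), cycleY_last, sub_zero]) hk

/-- The inverse of `pathToCycle`. -/
noncomputable def cycleToPath :
    CycleRing m K →ₐ[K] MvPolynomial (Fin (m + 3)) (CoeffRing m K) :=
  aeval (Sum.elim (fun v => pathX (m + 3) (cycleCoeff m K) (v + 1))
    fun v => pathX (m + 3) (cycleCoeff m K) v - C (cycleCoeff m K v))

lemma cycleToPath_cycleX {k : ℕ} (hk : k < m + 5) :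
    cycleToPath m K (cycleX m K k) = pathX (m + 3) (cycleCoeff m K) k := by
  obtain _ | k := k
  · rw [cycleX_zero, map_zero, pathX_zero]
  · rw [cycleX_succ m K ⟨k, by lia⟩, cycleToPath, aeval_X, Sum.elim_inl]

lemma cycleToPath_cycleY {k : ℕ} (hk : k < m + 5) :
    cycleToPath m K (cycleY m K k) =
      pathX (m + 3) (cycleCoeff m K) k - C (cycleCoeff m K k) := by
  by_cases h : k = m + 4
  · subst h
    rw [cycleY_last, map_zero, pathX_last, sub_self]
  · rw [cycleY_val m K ⟨k, by lia⟩, cycleToPath, aeval_X, Sum.elim_inr]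

lemma cycleToPath_pathToCycle (p : MvPolynomial (Fin (m + 3)) (CoeffRing m K)) :
    cycleToPath m K (pathToCycle m K p) = p := by
  suffices h : (cycleToPath m K).toRingHom.comp (pathToCycle m K).toRingHom = RingHom.id _ from
    DFunLike.congr_fun h p
  refine ringHom_ext' (ringHom_ext (fun c => ?_) fun k => ?_) fun i => ?_
  · change cycleToPath m K (pathToCycle m K (C (C c))) = C (C c)
    rw [algHom_C]
    change cycleToPath m K (coeffHom m K (C c)) = C (C c)
    rw [algHom_C, AlgHom.commutes]
    rfl
  · have hX : (X k : CoeffRing m K) = cycleCoeff m K k := by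
      rw [cycleCoeff, dif_pos k.isLt]
    change cycleToPath m K (pathToCycle m K (C (X k))) = C (X k)
    rw [algHom_C, hX, algebraMap_cycleCoeff m K k.isLt, map_sub, cycleToPath_cycleX m K k.isLt,
      cycleToPath_cycleY m K k.isLt, sub_sub_cancel]
  · change cycleToPath m K (pathToCycle m K (X i)) = X i
    rw [pathToCycle, aeval_X, cycleToPath_cycleX m K (by lia), pathX_succ]

lemma pathToCycle_cycleToPath (p : CycleRing m K) : pathToCycle m K (cycleToPath m K p) = p := by
  suffices h : (pathToCycle m K).toRingHom.comp (cycleToPath m K).toRingHom = RingHom.id _ from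
    DFunLike.congr_fun h p
  refine ringHom_ext (fun c => ?_) fun v => ?_
  · change pathToCycle m K (cycleToPath m K (C c)) = C c
    rw [algHom_C]
    change pathToCycle m K (C (C c)) = C c
    rw [algHom_C]
    exact algHom_C (coeffHom m K) c
  · change pathToCycle m K (cycleToPath m K (X v)) = X v
    obtain v | v := v
    · rw [cycleToPath, aeval_X, Sum.elim_inl, pathToCycle_pathX m K (by lia), cycleX_succ]
    · rw [cycleToPath, aeval_X, Sum.elim_inr, map_sub, pathToCycle_pathX m K (by lia), algHom_C,
        algebraMap_cycleCoeff m K (by lia), sub_sub_cancel, cycleY_val]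

/-- `pathToCycle` as an isomorphism. -/
noncomputable def pathEquivCycle :
    MvPolynomial (Fin (m + 3)) (CoeffRing m K) ≃ₐ[CoeffRing m K] CycleRing m K :=
  AlgEquiv.ofBijective (pathToCycle m K)
    ⟨Function.LeftInverse.injective (cycleToPath_pathToCycle m K),
      Function.RightInverse.surjective (pathToCycle_cycleToPath m K)⟩

lemma pathEquivCycle_relation (i : Fin (m + 3)) :
    pathEquivCycle m K (X i ^ 2 - pathTail (m + 3) (cycleCoeff m K) i) =
      edgeBinomial K i.castSucc (i.castSucc + 1) := by
  change pathToCycle m K _ = _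
  rw [← pathX_succ (m + 3) (cycleCoeff m K) i, Fin.coeSucc_eq_succ, edgeBinomial,
    ← cycleX_succ, ← cycleX_succ, ← cycleY_val, ← cycleY_val, Fin.val_succ, Fin.val_castSucc]
  simp only [pathTail, map_sub, map_add, map_mul, map_pow, algHom_C,
    ← pathX_succ (m + 3) (cycleCoeff m K) i]
  rw [pathToCycle_pathX m K (by lia), pathToCycle_pathX m K (by lia),
    pathToCycle_pathX m K (by lia), algebraMap_cycleCoeff m K (by lia),
    algebraMap_cycleCoeff m K (by lia)]
  ring

lemma pathEquivCycle_closingRelation :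
    pathEquivCycle m K (closingRelation (m + 3) (cycleCoeff m K)) =
      edgeBinomial K (Fin.last (m + 3)) (Fin.last (m + 3) + 1) := by
  change pathToCycle m K _ = _
  rw [Fin.last_add_one, edgeBinomial, ← cycleX_succ, ← cycleX_succ, ← cycleY_val, ← cycleY_val,
    Fin.val_last, Fin.val_zero]
  simp only [closingRelation, map_sub, map_neg, map_mul, algHom_C]
  rw [pathToCycle_pathX m K (by lia), pathToCycle_pathX m K (by lia),
    algebraMap_cycleCoeff m K (by lia), algebraMap_cycleCoeff m K (by lia),
    algebraMap_cycleCoeff m K (by lia), cycleX_zero, cycleY_last]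
  ring

open CategoryTheory in
theorem hasProjectiveDimensionLE_cycleGraph :
    HasProjectiveDimensionLE
      (ModuleCat.of (CycleRing m K) (CycleRing m K ⧸ binomialEdgeIdeal K (cycleGraph (m + 4))))
      (m + 4) := by
  let pt : CoeffRing m K →+* K :=
    eval fun k => if k.val = 0 then -1 else if k.val = m + 4 then 1 else 0
  have hpt {k : ℕ} (hk : k < m + 5) : pt (cycleCoeff m K k) =
      if k = 0 then -1 else if k = m + 4 then 1 else 0 := by
    rw [cycleCoeff, dif_pos hk, eval_X]
  refine hasProjectiveDimensionLE_of_path (N := m + 3) (α := cycleCoeff m K) (by lia) ?_ pt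
    (by simp [hpt]) (by simp [hpt]) (fun i h1 h2 => ?_) (pathEquivCycle m K) ?_
  · rw [cycleCoeff, dif_pos (by lia)]
    exact X_ne_zero _
  · rw [hpt (by lia), if_neg (by lia), if_neg (by lia)]
  · rw [binomialEdgeIdeal_cycleGraph_eq_span, ← Ideal.span_union]
    congr 1
    simp only [pathEquivCycle_relation, pathEquivCycle_closingRelation]
    apply Set.Subset.antisymm
    · rintro _ ⟨v, rfl⟩
      induction v using Fin.lastCases with
      | last => exact Or.inr rfl
      | cast i => exact Or.inl ⟨i, rfl⟩
    · rintro _ (⟨i, rfl⟩ | rfl) <;> exact ⟨_, rfl⟩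

end CycleCoordinates

theorem cycle_pd_eq_bigHeight (n : ℕ) (hn : 4 ≤ n) (K : Type) [Field K] :
    projDim (MvPolynomial (Fin n ⊕ Fin n) K)
        (ModuleCat.of _ (MvPolynomial (Fin n ⊕ Fin n) K ⧸ binomialEdgeIdeal K (cycleGraph n)))
      = bigHeight (binomialEdgeIdeal K (cycleGraph n)) ∧
    bigHeight (binomialEdgeIdeal K (cycleGraph n)) = ((n : ℕ) : ℕ∞) := by
  obtain ⟨m, rfl⟩ : ∃ m, n = m + 4 := ⟨n - 4, by lia⟩
  have hbig := bigHeight_cycleGraph m K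
  refine ⟨?_, hbig⟩
  rw [hbig]
  have hpd := hasProjectiveDimensionLE_cycleGraph m K
  apply le_antisymm
  · refine sInf_le fun N k hk => ?_
    obtain ⟨k, rfl⟩ := Nat.exists_eq_succ_of_ne_zero (Nat.ne_zero_of_lt (Nat.cast_lt.1 hk))
    exact (subsingleton_extFunctor_iff _ N k).2
      (hpd.subsingleton _ (m + 5) (k + 1) (Nat.cast_lt.1 hk) N)
  · refine le_sInf fun d hd => not_lt.1 fun hlt => ?_
    obtain ⟨N, hN⟩ := exists_nontrivial_ext_cycleGraph m K
    exact not_subsingleton_iff_nontrivial.2 hN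
      ((subsingleton_extFunctor_iff _ N (m + 3)).1 (hd N (m + 4) hlt))
end
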